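/- Let 𝒫 = {0, p₁, …, p_n, m₁, …, m_t} be a finite rooted homeomorphically irreducible tree with root 0, where m₁, …, m_t are the maximal elements, and let p₁, …, p_k be the minimal elements of 𝒫 \ {0}. Let Σ̃_𝒫 be the function such that Σ̃_𝒫(a₁, …, a_n, b₁, …, b_t, c₁, …, c_t) equals the number of (semi)star operations of any semilocal finite-dimensional Prüfer domain D with hiSpec(D) ≅ 𝒫, ω(Pᵢ) = aᵢ, ω(Mⱼ) = bⱼ and ε(Mⱼ) = cⱼ (this is well defined). Then, for every fixed choice of the arguments other than the ω-values at p₁, …, p_k, the resulting function π̃_𝒫(X₁, …, X_k) of these k variables is a polynomial (with rational coefficients) of total degree k·(2^{k−1} − 1). -/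

import Mathlib

/- Common background: Prüfer domains, semistar and (fractional) star operations,
standard decomposition, skeleton, supports, `hiSpec`, the rings `Z(P)`,
and the invariants `ω` and `ε`, following Spirito,
"Semistar operations on semilocal Prüfer domains". -/

set_option linter.unusedSectionVars false
set_option maxHeartbeats 1000000

open Pointwise

noncomputable section

namespace Paper

variable (D : Type*) [CommRing D] [IsDomain D]
variable (K : Type*) [Field K] [Algebra D K] [IsFractionRing D K]

/-- The localization of `D` at a prime ideal `P`, viewed as an overring of `D`
inside its quotient field `K`. -/
def locAt (P : Ideal D) (hP : P.IsPrime) : Subalgebra D K :=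
  Localization.subalgebra K (@Ideal.primeCompl D _ P hP)
    (fun _ hx => mem_nonZeroDivisors_of_ne_zero fun h => hx (h ▸ P.zero_mem))

/-- A Prüfer domain: every localization at a prime ideal is a valuation domain
(any two elements are comparable w.r.t. divisibility). -/
def IsPrufer : Prop :=
  ∀ (P : Ideal D) (hP : P.IsPrime), ∀ x y : locAt D K P hP, ∃ z, x * z = y ∨ y * z = x

/-- A semilocal ring: finitely many maximal ideals. -/
def IsSemilocal : Prop := {I : Ideal D | I.IsMaximal}.Finite

/-- Two ideals are dependent if some nonzero prime ideal is contained in both. -/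
def Dependent (M N : Ideal D) : Prop :=
  ∃ P : Ideal D, P.IsPrime ∧ P ≠ ⊥ ∧ P ≤ M ∧ P ≤ N

/-- The member of the standard decomposition corresponding to the dependence class
of the maximal ideal `M`: the intersection of the localizations of `D` at the
maximal ideals dependent on `M`. -/
def TOf (M : Ideal D) : Subalgebra D K :=
  sInf {A | ∃ (N : Ideal D) (hN : N.IsMaximal), Dependent D M N ∧ A = locAt D K N hN.isPrime}

/-- The standard decomposition of `D`. -/
def stdDecomp : Set (Subalgebra D K) :=
  {T | ∃ M : Ideal D, M.IsMaximal ∧ T = TOf D K M}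

/-- The skeleton of `Over(D)`: all intersections of subsets of the standard
decomposition (including the empty intersection `K` and the total one `D`). -/
def SkOver : Set (Subalgebra D K) :=
  {A | ∃ S ⊆ stdDecomp D K, A = sInf S}

/-- `I` is a fractional ideal of the overring `A` of `D`: it is an `A`-submodule
of `K` and `dI ⊆ A` for some nonzero `d ∈ K`. -/
def IsFracOf (A : Subalgebra D K) (I : Submodule D K) : Prop :=
  (∀ a ∈ A, ∀ x ∈ I, a * x ∈ I) ∧ ∃ d : K, d ≠ 0 ∧ ∀ x ∈ I, d * x ∈ A

end Paper

namespace Paper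

/-- A semistar operation on a domain `R` with quotient field `K`: an extensive,
order-preserving, idempotent self-map of the set of `R`-submodules of `K` such
that `(xI)^⋆ = x·I^⋆` for every nonzero `x ∈ K`. -/
structure Semistar (R : Type*) [CommRing R] (K : Type*) [Field K] [Algebra R K] where
  toFun : Submodule R K → Submodule R K
  le_star' : ∀ I, I ≤ toFun I
  mono' : ∀ ⦃I J⦄, I ≤ J → toFun I ≤ toFun J
  idem' : ∀ I, toFun (toFun I) = toFun I
  smul' : ∀ (x : K), x ≠ 0 → ∀ I,
    toFun (Submodule.span R {x} * I) = Submodule.span R {x} * toFun I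

namespace Semistar

variable {R : Type*} [CommRing R] {K : Type*} [Field K] [Algebra R K]

theorem ext' {s t : Semistar R K} (h : s.toFun = t.toFun) : s = t := by
  cases s; cases t; cases h; rfl

instance : PartialOrder (Semistar R K) where
  le s t := ∀ I, s.toFun I ≤ t.toFun I
  le_refl _ _ := le_rfl
  le_trans _ _ _ hab hbc I := (hab I).trans (hbc I)
  le_antisymm _ _ h h' := ext' (funext fun I => le_antisymm (h I) (h' I))

end Semistar

/-- The identity semistar operation `d`. -/
def dOp (R : Type*) [CommRing R] (K : Type*) [Field K] [Algebra R K] : Semistar R K where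
  toFun I := I
  le_star' _ := le_rfl
  mono' _ _ h := h
  idem' _ := rfl
  smul' _ _ _ := rfl

end Paper

namespace Paper

variable (D : Type*) [CommRing D] [IsDomain D]
variable (K : Type*) [Field K] [Algebra D K] [IsFractionRing D K]

/-- A fractional star operation on an overring `A` of `D` (inside `K`): a
semistar-like closure operation defined on the fractional ideals of `A`.
In particular `FracStar D K ⊥` is the set of fractional star operations on `D`. -/
structure FracStar (A : Subalgebra D K) where
  toFun : {I : Submodule D K // IsFracOf D K A I} → {I : Submodule D K // IsFracOf D K A I}
  le_star' : ∀ I, I.1 ≤ (toFun I).1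
  mono' : ∀ I J, I.1 ≤ J.1 → (toFun I).1 ≤ (toFun J).1
  idem' : ∀ I, toFun (toFun I) = toFun I
  smul' : ∀ (x : K), x ≠ 0 → ∀ I J, J.1 = Submodule.span D {x} * I.1 →
    (toFun J).1 = Submodule.span D {x} * (toFun I).1

namespace FracStar

variable {D K} {A : Subalgebra D K}

theorem ext' {s t : FracStar D K A} (h : s.toFun = t.toFun) : s = t := by
  cases s; cases t; cases h; rfl

instance : PartialOrder (FracStar D K A) where
  le s t := ∀ I, (s.toFun I).1 ≤ (t.toFun I).1
  le_refl _ _ := le_rfl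
  le_trans _ _ _ hab hbc I := (hab I).trans (hbc I)
  le_antisymm _ _ h h' := ext' (funext fun I => Subtype.ext (le_antisymm (h I) (h' I)))

end FracStar

/-- A fractional star operation on the overring `A` is a *star operation* if it
closes `A` itself. -/
def FracStar.IsStarOp {A : Subalgebra D K} (f : FracStar D K A) : Prop :=
  ∀ h : IsFracOf D K A (Subalgebra.toSubmodule A),
    (f.toFun ⟨Subalgebra.toSubmodule A, h⟩).1 = Subalgebra.toSubmodule A

/-- The support of a semistar operation on `D`: the elements `A` of the skeleton
such that `A^⋆` is a fractional ideal of `A`. -/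
def supp (s : Semistar D K) : Set (Subalgebra D K) :=
  {A | A ∈ SkOver D K ∧ IsFracOf D K A (s.toFun (Subalgebra.toSubmodule A))}

/-- The image of an ideal of `D` inside `K`. -/
def idealToK (P : Ideal D) : Submodule D K := Submodule.map (Algebra.linearMap D K) P

end Paper

namespace Paper

/-- An abstract fractional star operation on a commutative ring `A`, acting on
the fractional ideals of `A` inside its fraction ring. -/
structure AFracStar (A : Type*) [CommRing A] where
  toFun : FractionalIdeal (nonZeroDivisors A) (FractionRing A) →
    FractionalIdeal (nonZeroDivisors A) (FractionRing A)
  le_star' : ∀ I, I ≤ toFun I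
  mono' : ∀ ⦃I J⦄, I ≤ J → toFun I ≤ toFun J
  idem' : ∀ I, toFun (toFun I) = toFun I
  smul' : ∀ (x : FractionRing A), x ≠ 0 → ∀ I,
    toFun (FractionalIdeal.spanSingleton (nonZeroDivisors A) x * I) =
      FractionalIdeal.spanSingleton (nonZeroDivisors A) x * toFun I

namespace AFracStar

variable {A : Type*} [CommRing A]

theorem ext' {s t : AFracStar A} (h : s.toFun = t.toFun) : s = t := by
  cases s; cases t; cases h; rfl

instance : PartialOrder (AFracStar A) where
  le s t := ∀ I, s.toFun I ≤ t.toFun I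
  le_refl _ _ := le_rfl
  le_trans _ _ _ hab hbc I := (hab I).trans (hbc I)
  le_antisymm _ _ h h' := ext' (funext fun I => le_antisymm (h I) (h' I))

end AFracStar

/-- Abstract star operations on `A`: fractional star operations closing `A`. -/
def AStar (A : Type*) [CommRing A] : Type _ := {s : AFracStar A // s.toFun 1 = 1}

instance (A : Type*) [CommRing A] : PartialOrder (AStar A) :=
  inferInstanceAs (PartialOrder {s : AFracStar A // s.toFun 1 = 1})

end Paper

namespace Paper

variable (D : Type*) [CommRing D] [IsDomain D]

/-- `P` is a branching point of `Spec(D)`: the infimum (among the primes) of a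
family of pairwise incomparable primes not containing `P`. -/
def IsBranchPoint (P : Ideal D) : Prop :=
  ∃ S : Set (Ideal D), (∀ Q ∈ S, Q.IsPrime) ∧
    (S.Pairwise fun Q₁ Q₂ => ¬Q₁ ≤ Q₂ ∧ ¬Q₂ ≤ Q₁) ∧ P ∉ S ∧
    (∀ Q ∈ S, P ≤ Q) ∧ ∀ P' : Ideal D, P'.IsPrime → (∀ Q ∈ S, P' ≤ Q) → P' ≤ P

/-- The homeomorphically irreducible tree underlying `Spec(D)`: the zero ideal,
the maximal ideals and the branching points, ordered by inclusion. -/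
def hiSpec : Set (Ideal D) :=
  {P | P.IsPrime ∧ (P = ⊥ ∨ P.IsMaximal ∨ IsBranchPoint D P)}

/-- `Q` is the element of `hiSpec D` directly below `P`. -/
def DirectlyBelow (Q P : Ideal D) : Prop :=
  Q ∈ hiSpec D ∧ P ∈ hiSpec D ∧ Q < P ∧ ∀ R ∈ hiSpec D, Q < R → ¬R < P

/-- The localization of `D` at the prime ideal `P`, as an abstract ring. -/
abbrev locRing (P : Ideal D) (hP : P.IsPrime) : Type _ :=
  Localization (@Ideal.primeCompl D _ P hP)

/-- The valuation ring `Z(P) = D_P / Q·D_P`. -/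
abbrev Zring (P Q : Ideal D) (hP : P.IsPrime) : Type _ :=
  locRing D P hP ⧸ Ideal.map (algebraMap D (locRing D P hP)) Q

/-- `ω(P) = |FStar(Z(P))|`, where `Q` is the element of `hiSpec D` directly
below `P`. -/
def omegaAt (P Q : Ideal D) (hP : P.IsPrime) : ℕ :=
  Nat.card (AFracStar (Zring D P Q hP))

open Classical in
/-- `ε(P) = |Star(D_P)| ∈ {1,2}` for a (nonzero) prime `P`. -/
def epsilonOf (A : Ideal D) : ℕ :=
  if h : A.IsPrime then Nat.card (AStar (locRing D A h)) else 0

end Paper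

namespace Paper

theorem mem_hiSpec_prime {D : Type*} [CommRing D] [IsDomain D] {P : Ideal D}
    (h : P ∈ hiSpec D) : P.IsPrime := h.1

theorem maximal_mem_hiSpec {D : Type*} [CommRing D] [IsDomain D] {M : Ideal D}
    (h : M.IsMaximal) : M ∈ hiSpec D := ⟨h.isPrime, Or.inr (Or.inl h)⟩

end Paper

namespace Paper

universe u v

/-- `x` is a minimal element of `𝒫 \ {⊥}`. -/
def IsMinNR {P : Type*} [PartialOrder P] [OrderBot P] (x : P) : Prop :=
  x ≠ ⊥ ∧ ∀ y : P, y ≠ ⊥ → y ≤ x → y = x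

/-- Closure operators on a poset commuting with a family of order automorphisms. -/
structure EqClo {G X : Type*} [PartialOrder X] (act : G → X ≃o X) where
  toFun : X → X
  le' : ∀ x, x ≤ toFun x
  mono' : Monotone toFun
  idem' : ∀ x, toFun (toFun x) = toFun x
  equiv' : ∀ g x, toFun (act g x) = act g (toFun x)

namespace EqClo

variable {G X : Type*} [PartialOrder X] {act : G → X ≃o X}

theorem ext' {s t : EqClo act} (h : ∀ x, s.toFun x = t.toFun x) : s = t := by
  cases s; cases t; congr; exact funext h

instance : PartialOrder (EqClo act) where
  le s t := ∀ x, s.toFun x ≤ t.toFun x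
  le_refl _ _ := le_rfl
  le_trans _ _ _ hab hbc x := (hab x).trans (hbc x)
  le_antisymm _ _ h h' := ext' fun x => le_antisymm (h x) (h' x)

theorem le_def {s t : EqClo act} : s ≤ t ↔ ∀ x, s.toFun x ≤ t.toFun x := Iff.rfl

variable {G' X' : Type*} [PartialOrder X'] {act' : G' → X' ≃o X'}

/-- Transport of a closure operator along an order isomorphism. -/
def transportFun (φ : X ≃o X') (h : ∀ g', ∃ g, ∀ x, φ (act g x) = act' g' (φ x))
    (c : EqClo act) : EqClo act' where
  toFun x := φ (c.toFun (φ.symm x))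
  le' x := by
    have := φ.monotone (c.le' (φ.symm x))
    simpa using this
  mono' x y hxy := φ.monotone (c.mono' (φ.symm.monotone hxy))
  idem' x := by simp [c.idem']
  equiv' g' x := by
    obtain ⟨g, hg⟩ := h g'
    have : φ.symm (act' g' x) = act g (φ.symm x) := by
      rw [OrderIso.symm_apply_eq, hg]; simp
    rw [this, c.equiv', hg]

/-- Transport of closure operators along an order isomorphism compatible with the families. -/
def transport (φ : X ≃o X') (h : ∀ g', ∃ g, ∀ x, φ (act g x) = act' g' (φ x))
    (h' : ∀ g, ∃ g', ∀ x, φ (act g x) = act' g' (φ x)) : EqClo act ≃o EqClo act' where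
  toFun := transportFun φ h
  invFun := transportFun φ.symm (by
    intro g
    obtain ⟨g', hg⟩ := h' g
    refine ⟨g', fun x => ?_⟩
    rw [OrderIso.symm_apply_eq, hg]; simp)
  left_inv c := ext' fun x => by simp [transportFun]
  right_inv c := ext' fun x => by simp [transportFun]
  map_rel_iff' := by
    intro c d
    constructor
    · intro hcd x
      have := hcd (φ x)
      simpa [transportFun] using this
    · intro hcd x
      exact φ.monotone (hcd _)

theorem transport_apply (φ : X ≃o X') (h : ∀ g', ∃ g, ∀ x, φ (act g x) = act' g' (φ x))
    (h' : ∀ g, ∃ g', ∀ x, φ (act g x) = act' g' (φ x)) (c : EqClo act) (x : X) :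
    (transport φ h h' c).toFun (φ x) = φ (c.toFun x) := by
  simp [transport, transportFun]

end EqClo

/-- The support of a tuple: the coordinates that are not `⊤`. -/
def suppT {ι : Type*} {F : ι → Type*} (x : ∀ i, WithTop (F i)) : Set ι := {i | x i ≠ ⊤}

/-- Combinatorial model for the equivariant closure operators on a product. -/
structure Phi {ι : Type*} (F : ι → Type*) [∀ i, PartialOrder (F i)] where
  toFun : Set ι → ∀ i, WithTop (F i)
  anti : Antitone toFun
  supp_sub : ∀ S, suppT (toFun S) ⊆ S
  idem : ∀ S, toFun (suppT (toFun S)) = toFun S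

namespace Phi

variable {ι : Type*} {F : ι → Type*} [∀ i, PartialOrder (F i)]

theorem ext' {s t : Phi F} (h : ∀ S i, s.toFun S i = t.toFun S i) : s = t := by
  cases s; cases t; congr; exact funext fun S => funext fun i => h S i

instance : PartialOrder (Phi F) where
  le s t := ∀ S, s.toFun S ≤ t.toFun S
  le_refl _ _ := le_rfl
  le_trans _ _ _ hab hbc x := (hab x).trans (hbc x)
  le_antisymm _ _ h h' := ext' fun S i => congrFun (le_antisymm (h S) (h' S)) i

theorem le_def {s t : Phi F} : s ≤ t ↔ ∀ S, s.toFun S ≤ t.toFun S := Iff.rfl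

/-- The elements which on the whole index set take marked values. -/
def Star (St : ∀ i, Set (F i)) (g : Phi F) : Prop :=
  ∀ i, ∃ f ∈ St i, g.toFun Set.univ i = (f : WithTop (F i))

/-- The trivial element, taking only the value `⊤`. -/
def Triv (g : Phi F) : Prop := ∀ i, g.toFun Set.univ i = ⊤

instance [Finite ι] [∀ i, Finite (F i)] : Finite (Phi F) := by
  have : ∀ i, Finite (WithTop (F i)) := fun i => inferInstanceAs (Finite (Option (F i)))
  exact Finite.of_injective (fun g : Phi F => g.toFun)
    fun g h hgh => ext' fun S i => congrFun (congrFun hgh S) i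

variable {F' : ι → Type*} [∀ i, PartialOrder (F' i)]

/-- Functoriality of the model on isomorphisms. -/
def mapFun (φ : ∀ i, F i ≃o F' i) (g : Phi F) : Phi F' where
  toFun S i := (φ i).withTopCongr (g.toFun S i)
  anti S S' h i := (φ i).withTopCongr.monotone (g.anti h i)
  supp_sub S i hi := g.supp_sub S (by simpa [suppT] using hi)
  idem S := by
    have : suppT (fun i => (φ i).withTopCongr (g.toFun S i)) = suppT (g.toFun S) := by
      ext i; simp [suppT]
    rw [this, g.idem]

/-- Functoriality of the model on isomorphisms. -/
def map (φ : ∀ i, F i ≃o F' i) : Phi F ≃o Phi F' where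
  toFun := mapFun φ
  invFun := mapFun fun i => (φ i).symm
  left_inv g := ext' fun S i => (φ i).withTopCongr.symm_apply_apply _
  right_inv g := ext' fun S i => (φ i).withTopCongr.apply_symm_apply _
  map_rel_iff' := by
    intro g h
    constructor
    · intro H S i
      exact (φ i).withTopCongr.le_iff_le.1 (H S i)
    · intro H S i
      exact (φ i).withTopCongr.monotone (H S i)

theorem map_toFun (φ : ∀ i, F i ≃o F' i) (g : Phi F) (S i) :
    (map φ g).toFun S i = WithTop.map (φ i) (g.toFun S i) := rfl

theorem map_star (φ : ∀ i, F i ≃o F' i) {St : ∀ i, Set (F i)} {St' : ∀ i, Set (F' i)}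
    (h : ∀ i f, f ∈ St i ↔ φ i f ∈ St' i) (g : Phi F) : Star St g ↔ Star St' (map φ g) := by
  refine forall_congr' fun i => ?_
  rw [map_toFun]
  constructor
  · rintro ⟨f, hf, e⟩
    exact ⟨φ i f, (h i f).1 hf, by rw [e]; rfl⟩
  · rintro ⟨f, hf, e⟩
    refine ⟨(φ i).symm f, (h i _).2 (by simpa using hf), ?_⟩
    cases hg : g.toFun Set.univ i with
    | top => rw [hg] at e; exact absurd e (by simp)
    | coe a =>
      rw [hg, WithTop.map_coe, WithTop.coe_inj] at e
      rw [← e]; simp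

theorem map_triv (φ : ∀ i, F i ≃o F' i) (g : Phi F) : Triv g ↔ Triv (map φ g) := by
  refine forall_congr' fun i => ?_
  rw [map_toFun]
  cases g.toFun Set.univ i <;> simp

end Phi

section product

variable {ι : Type*} {G : ι → Type*} {Y : ι → Type*} [∀ i, PartialOrder (Y i)]
  (act : ∀ i, G i → Y i ≃o Y i)

/-- Order isomorphisms of a product from those of the factors. -/
def piIso {X X' : ι → Type*} [∀ i, PartialOrder (X i)] [∀ i, PartialOrder (X' i)]
    (φ : ∀ i, X i ≃o X' i) : (∀ i, X i) ≃o (∀ i, X' i) where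
  toEquiv := Equiv.piCongrRight fun i => (φ i).toEquiv
  map_rel_iff' := by
    intro x y
    simp [Pi.le_def]

/-- The product action on tuples with adjoined top elements. -/
def piAct (γ : ∀ i, G i) : (∀ i, WithTop (Y i)) ≃o (∀ i, WithTop (Y i)) :=
  piIso fun i => (act i (γ i)).withTopCongr

theorem piAct_apply (γ : ∀ i, G i) (x : ∀ i, WithTop (Y i)) (i : ι) :
    piAct act γ x i = (x i).map (act i (γ i)) := rfl

/-- Evaluation of a closure operator, with `⊤` acting as the constant `⊤`. -/
def appT {G X : Type*} [PartialOrder X] {act : G → X ≃o X} :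
    WithTop (EqClo act) → WithTop X → WithTop X
  | (c : EqClo act), (x : X) => (c.toFun x : X)
  | _, _ => ⊤

section appT
variable {G X : Type*} [PartialOrder X] {act : G → X ≃o X}
@[simp] theorem appT_coe (c : EqClo act) (x : X) :
    appT (c : WithTop (EqClo act)) (x : WithTop X) = (c.toFun x : X) := rfl
@[simp] theorem appT_top_left (x : WithTop X) :
    appT (⊤ : WithTop (EqClo act)) x = ⊤ := rfl
@[simp] theorem appT_top_right (c : WithTop (EqClo act)) :
    appT c (⊤ : WithTop X) = ⊤ := by cases c <;> rfl

theorem appT_mono {c d : WithTop (EqClo act)} {x y : WithTop X} (h : c ≤ d) (h' : x ≤ y) :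
    appT c x ≤ appT d y := by
  cases d <;> cases y <;> simp_all
  rename_i d y
  cases c <;> cases x <;> simp_all
  rename_i c x
  exact (c.mono' h').trans (h y)

theorem le_appT (c : WithTop (EqClo act)) (x : WithTop X) : x ≤ appT c x := by
  cases c <;> cases x <;> simp
  exact EqClo.le' _ _

theorem appT_idem (c : WithTop (EqClo act)) (x : WithTop X) :
    appT c (appT c x) = appT c x := by
  cases c <;> cases x <;> simp
  exact EqClo.idem' _ _

theorem appT_equiv (c : WithTop (EqClo act)) (g : G) (x : WithTop X) :
    appT c (x.map (act g)) = (appT c x).map (act g) := by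
  cases c <;> cases x <;> simp
  exact EqClo.equiv' _ _ _

theorem appT_eq_top {c : WithTop (EqClo act)} {x : WithTop X} :
    appT c x = ⊤ ↔ c = ⊤ ∨ x = ⊤ := by
  cases c <;> cases x <;> simp

end appT

/-- The closure operator attached to an element of the model. -/
def ofPhi (g : Phi fun i => EqClo (act i)) : EqClo (piAct act) where
  toFun x i := appT (g.toFun (suppT x) i) (x i)
  le' x i := le_appT _ _
  mono' x y h i := by
    refine appT_mono (g.anti ?_ i) (h i)
    intro j hj hx
    exact hj (top_unique (hx ▸ h j))
  idem' x := by
    have : suppT (fun i => appT (g.toFun (suppT x) i) (x i)) = suppT (g.toFun (suppT x)) := by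
      ext i
      have := @g.supp_sub (suppT x) i
      simp only [suppT, Set.mem_ofPred_eq, ne_eq, appT_eq_top, not_or] at this ⊢
      tauto
    rw [this, g.idem]
    ext1 i
    exact appT_idem _ _
  equiv' γ x := by
    have : suppT (piAct act γ x) = suppT x := by
      ext i
      simp only [suppT, Set.mem_ofPred_eq, piAct_apply]
      cases x i <;> simp
    rw [this]
    ext1 i
    simp only [piAct_apply, appT_equiv]

variable {act}
variable (b : ∀ i, Y i) (hid : ∀ i, ∃ g, ∀ y, act i g y = y)
  (harch : ∀ i y y', ∃ g, y ≤ act i g y')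

include hid harch in
theorem EqClo.coord_le (c : EqClo (piAct act)) (x x' : ∀ i, WithTop (Y i))
    (hs : suppT x' ⊆ suppT x) (i : ι) (hi : x i ≤ x' i) : c.toFun x i ≤ c.toFun x' i := by
  classical
  have key : ∀ j, ∃ g : G j, x j ≤ (x' j).map (act j g) ∧ (j = i → ∀ y, act j g y = y) := by
    intro j
    by_cases hj : j = i
    · subst hj
      obtain ⟨g, hg⟩ := hid j
      refine ⟨g, ?_, fun _ => hg⟩
      have : WithTop.map (act j g) (x' j) = x' j := by
        cases x' j <;> simp [hg]
      rwa [this]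
    · cases h' : x' j with
      | top => exact ⟨(hid j).choose, by simp, fun h => absurd h hj⟩
      | coe y' =>
        have hx : x j ≠ ⊤ := hs (show x' j ≠ ⊤ by simp [h'])
        obtain ⟨y, hy⟩ := WithTop.ne_top_iff_exists.1 hx
        obtain ⟨g, hg⟩ := harch j y y'
        refine ⟨g, ?_, fun h => absurd h hj⟩
        rw [← hy]
        exact WithTop.coe_le_coe.2 hg
  choose γ h1 h2 using key
  have h3 : x ≤ piAct act γ x' := fun j => h1 j
  have h4 := c.mono' h3 i
  rw [c.equiv', piAct_apply] at h4
  have : WithTop.map (act i (γ i)) (c.toFun x' i) = c.toFun x' i := by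
    cases c.toFun x' i <;> simp [h2 i rfl]
  rwa [this] at h4

/-- The tuple with value `y` at `i`, base values at the other elements of `S`, and `⊤` outside. -/
def pt (S : Set ι) (i : ι) (y : Y i) : ∀ j, WithTop (Y j) := by
  classical
  exact Function.update (fun j => if j ∈ S then ((b j : Y j) : WithTop (Y j)) else ⊤) i y

theorem pt_self (S : Set ι) (i : ι) (y : Y i) : pt b S i y i = y := by simp [pt]

theorem suppT_pt {S : Set ι} {i : ι} (hi : i ∈ S) (y : Y i) : suppT (pt b S i y) = S := by
  classical
  ext j
  simp only [suppT, Set.mem_ofPred_eq, pt]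
  by_cases h : j = i
  · subst h; simp [hi]
  · simp [h]

theorem suppT_piAct (γ : ∀ i, G i) (x : ∀ i, WithTop (Y i)) :
    suppT (piAct act γ x) = suppT x := by
  ext i
  simp only [suppT, Set.mem_ofPred_eq, piAct_apply]
  cases x i <;> simp

include hid harch in
theorem EqClo.pt_eq_top (c : EqClo (piAct act)) {S : Set ι} {i : ι} (hi : i ∈ S) {y : Y i}
    (y' : Y i) (h : c.toFun (pt b S i y) i = ⊤) : c.toFun (pt b S i y') i = ⊤ := by
  classical
  obtain ⟨g, hg⟩ := harch i y y'
  let γ : ∀ j, G j := Function.update (fun j => (hid j).choose) i g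
  have := c.coord_le hid harch (pt b S i y) (piAct act γ (pt b S i y'))
    (by rw [suppT_piAct, suppT_pt b hi, suppT_pt b hi]) i (by
      rw [piAct_apply, pt_self, pt_self]
      simpa [γ] using hg)
  rw [h, c.equiv', piAct_apply, top_le_iff] at this
  revert this
  cases c.toFun (pt b S i y') i <;> simp

/-- The restriction of a closure operator on a product to one coordinate. -/
def coordClo (c : EqClo (piAct act)) (S : Set ι) (i : ι) (hi : i ∈ S)
    (h : ∀ y, c.toFun (pt b S i y) i ≠ ⊤) : EqClo (act i) where
  toFun y := (c.toFun (pt b S i y) i).untop (h y)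
  le' y := by
    rw [WithTop.le_untop_iff]
    simpa [pt_self] using c.le' (pt b S i y) i
  mono' y y' hy := by
    simp only [WithTop.untop_le_iff, WithTop.coe_untop]
    exact c.coord_le hid harch _ _ (by rw [suppT_pt b hi, suppT_pt b hi]) i
      (by simpa [pt_self] using hy)
  idem' y := by
    apply WithTop.coe_injective
    simp only [WithTop.coe_untop]
    apply le_antisymm
    · have := c.coord_le hid harch (pt b S i ((c.toFun (pt b S i y) i).untop (h y)))
        (c.toFun (pt b S i y)) (by
          intro j hj
          rw [suppT_pt b hi, ← suppT_pt b hi y]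
          intro hj'
          exact hj (top_unique (hj' ▸ c.le' (pt b S i y) j))) i (by simp [pt_self])
      rwa [c.idem'] at this
    · have := c.le' (pt b S i ((c.toFun (pt b S i y) i).untop (h y))) i
      rwa [pt_self, WithTop.coe_untop] at this
  equiv' g y := by
    classical
    apply WithTop.coe_injective
    simp only [WithTop.coe_untop]
    let γ : ∀ j, G j := Function.update (fun j => (hid j).choose) i g
    have h1 : c.toFun (pt b S i (act i g y)) i = c.toFun (piAct act γ (pt b S i y)) i := by
      apply le_antisymm <;> apply c.coord_le hid harch
      · rw [suppT_piAct, suppT_pt b hi, suppT_pt b hi]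
      · simp [piAct_apply, pt_self, γ]
      · rw [suppT_piAct, suppT_pt b hi, suppT_pt b hi]
      · simp [piAct_apply, pt_self, γ]
    rw [h1, c.equiv', piAct_apply]
    have h2 : ∀ (w : WithTop (Y i)) (hw : w ≠ ⊤),
        WithTop.map (act i g) w = (act i g (w.untop hw) : Y i) := by
      intro w hw
      cases w with
      | top => exact absurd rfl hw
      | coe w => rfl
    rw [← h2]
    simp [γ]

open Classical in
/-- The coordinates of a closure operator on a product. -/
def toPhiVal (c : EqClo (piAct act)) (S : Set ι) (i : ι) : WithTop (EqClo (act i)) :=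
  if h : i ∈ S ∧ ∀ y, c.toFun (pt b S i y) i ≠ ⊤ then
    (coordClo b hid harch c S i h.1 h.2 : WithTop (EqClo (act i)))
  else ⊤

theorem toPhiVal_of_notMem (c : EqClo (piAct act)) {S : Set ι} {i : ι} (hi : i ∉ S) :
    toPhiVal b hid harch c S i = ⊤ := dif_neg fun h => hi h.1

theorem appT_toPhiVal_coe (c : EqClo (piAct act)) {S : Set ι} {i : ι} (hi : i ∈ S) (y : Y i) :
    appT (toPhiVal b hid harch c S i) (y : WithTop (Y i)) = c.toFun (pt b S i y) i := by
  by_cases h : ∀ y, c.toFun (pt b S i y) i ≠ ⊤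
  · rw [toPhiVal, dif_pos ⟨hi, h⟩, appT_coe]
    simp [coordClo]
  · rw [toPhiVal, dif_neg (fun h' => h h'.2)]
    push Not at h
    obtain ⟨y', hy'⟩ := h
    rw [c.pt_eq_top b hid harch hi y hy']
    rfl

theorem appT_toPhiVal (c : EqClo (piAct act)) (x : ∀ i, WithTop (Y i)) (i : ι) :
    appT (toPhiVal b hid harch c (suppT x) i) (x i) = c.toFun x i := by
  cases hx : x i with
  | top =>
    have := c.le' x i
    rw [hx, top_le_iff] at this
    rw [this]; simp
  | coe y =>
    have hi : i ∈ suppT x := by simp [suppT, hx]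
    rw [appT_toPhiVal_coe b hid harch c hi]
    apply le_antisymm <;> apply c.coord_le hid harch
    · rw [suppT_pt b hi]
    · rw [pt_self, hx]
    · rw [suppT_pt b hi]
    · rw [pt_self, hx]

theorem withTop_eqClo_le_iff {G X : Type*} [PartialOrder X] {act : G → X ≃o X} (x₀ : X)
    {c d : WithTop (EqClo act)} :
    c ≤ d ↔ ∀ y : X, appT c (y : WithTop X) ≤ appT d y := by
  refine ⟨fun h y => appT_mono h le_rfl, fun h => ?_⟩
  cases d with
  | top => exact le_top
  | coe d =>
    cases c with
    | top => exact absurd (h x₀) (by simp)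
    | coe c => exact WithTop.coe_le_coe.2 fun y => by simpa using h y

/-- The element of the model attached to a closure operator. -/
def toPhi (c : EqClo (piAct act)) : Phi fun i => EqClo (act i) where
  toFun S i := toPhiVal b hid harch c S i
  anti S S' hS i := by
    by_cases hi : i ∈ S
    · refine (withTop_eqClo_le_iff (b i)).2 fun y => ?_
      rw [appT_toPhiVal_coe _ _ _ _ hi, appT_toPhiVal_coe _ _ _ _ (hS hi)]
      apply c.coord_le hid harch
      · rwa [suppT_pt b hi, suppT_pt b (hS hi)]
      · rw [pt_self, pt_self]
    · simp only [toPhiVal_of_notMem b hid harch c hi]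
      exact le_top
  supp_sub S i hi := by
    by_contra h
    exact hi (toPhiVal_of_notMem b hid harch c h)
  idem S := by
    set S' := suppT (fun i => toPhiVal b hid harch c S i) with hS'
    have hsub : S' ⊆ S := by
      intro i hi
      by_contra h
      exact hi (toPhiVal_of_notMem b hid harch c h)
    ext1 i
    by_cases hi : i ∈ S'
    · have h1 : ∀ y : Y i, suppT (c.toFun (pt b S i y)) = S' := by
        intro y
        ext j
        have : c.toFun (pt b S i y) j ≠ ⊤ ↔ j ∈ S' := by
          rw [← appT_toPhiVal b hid harch, suppT_pt b (hsub hi), ne_eq, appT_eq_top, not_or]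
          have h2 : pt b S i y j ≠ ⊤ ↔ j ∈ S :=
            Set.ext_iff.1 (suppT_pt b (hsub hi) y) j
          rw [← ne_eq, ← ne_eq, h2]
          exact ⟨fun h => h.1, fun h => ⟨h, hsub h⟩⟩
        exact this
      apply le_antisymm
      · refine (withTop_eqClo_le_iff (b i)).2 fun y => ?_
        rw [appT_toPhiVal_coe _ _ _ _ hi, appT_toPhiVal_coe _ _ _ _ (hsub hi)]
        rw [← c.idem' (pt b S i y)]
        apply c.coord_le hid harch
        · rw [suppT_pt b hi, h1]
        · have := c.le' (pt b S i y) i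
          rwa [pt_self] at this ⊢
      · refine (withTop_eqClo_le_iff (b i)).2 fun y => ?_
        rw [appT_toPhiVal_coe _ _ _ _ hi, appT_toPhiVal_coe _ _ _ _ (hsub hi)]
        apply c.coord_le hid harch
        · rwa [suppT_pt b hi, suppT_pt b (hsub hi)]
        · rw [pt_self, pt_self]
    · have : toPhiVal b hid harch c S i = ⊤ := by
        by_contra h
        exact hi h
      rw [this, toPhiVal_of_notMem b hid harch c hi]

/-- Equivariant closure operators on a product of archimedean posets with tops adjoined are
described by the combinatorial model. -/
def prodIso : EqClo (piAct act) ≃o Phi fun i => EqClo (act i) :=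
  Equiv.toOrderIso
    { toFun := toPhi b hid harch
      invFun := ofPhi act
      left_inv := fun c => EqClo.ext' fun x => funext fun i => appT_toPhiVal b hid harch c x i
      right_inv := fun g => Phi.ext' fun S i => by
        by_cases hi : i ∈ S
        · have key : ∀ y : Y i, appT (toPhiVal b hid harch (ofPhi act g) S i) (y : WithTop (Y i)) =
              appT (g.toFun S i) y := by
            intro y
            rw [appT_toPhiVal_coe _ _ _ _ hi]
            simp only [ofPhi]
            rw [pt_self, suppT_pt b hi]
          apply le_antisymm
          · exact (withTop_eqClo_le_iff (b i)).2 fun y => (key y).le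
          · exact (withTop_eqClo_le_iff (b i)).2 fun y => (key y).ge
        · have : g.toFun S i = ⊤ := by
            by_contra h
            exact hi (g.supp_sub S h)
          rw [this]
          exact toPhiVal_of_notMem b hid harch _ hi }
    (by
      intro c d h S i
      by_cases hi : i ∈ S
      · refine (withTop_eqClo_le_iff (b i)).2 fun y => ?_
        simp only [Equiv.coe_fn_mk, toPhi]
        rw [appT_toPhiVal_coe _ _ _ _ hi, appT_toPhiVal_coe _ _ _ _ hi]
        exact h _ i
      · simp only [Equiv.coe_fn_mk, toPhi, toPhiVal_of_notMem b hid harch _ hi]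
        exact le_rfl)
    (by
      intro g h H x i
      exact appT_mono (H _ i) le_rfl)

theorem prodIso_apply (c : EqClo (piAct act)) (i : ι) :
    appT ((prodIso b hid harch c).toFun Set.univ i) (b i : WithTop (Y i)) =
      c.toFun (fun j => (b j : WithTop (Y j))) i := by
  have : suppT (fun j => ((b j : Y j) : WithTop (Y j))) = Set.univ := by
    ext j; simp [suppT]
  rw [← appT_toPhiVal b hid harch c, this]
  rfl

theorem prodIso_star (c : EqClo (piAct act)) :
    c.toFun (fun j => (b j : WithTop (Y j))) = (fun j => (b j : WithTop (Y j))) ↔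
      Phi.Star (fun i => {f : EqClo (act i) | f.toFun (b i) = b i}) (prodIso b hid harch c) := by
  rw [funext_iff]
  refine forall_congr' fun i => ?_
  rw [← prodIso_apply b hid harch]
  cases (prodIso b hid harch c).toFun Set.univ i with
  | top => simp
  | coe f => simp

theorem prodIso_triv (c : EqClo (piAct act)) :
    c.toFun (fun j => (b j : WithTop (Y j))) = ⊤ ↔ Phi.Triv (prodIso b hid harch c) := by
  rw [funext_iff]
  refine forall_congr' fun i => ?_
  rw [← prodIso_apply b hid harch]
  simp [appT_eq_top]

end product

section valuationModules

variable {K : Type*} [Field K]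

/-- The translate of an additive subgroup by a unit. -/
def scale (u : Kˣ) (I : AddSubgroup K) : AddSubgroup K where
  carrier := {y | (u⁻¹ : Kˣ) * y ∈ I}
  add_mem' {a b} ha hb := by
    simp only [Set.mem_ofPred_eq] at *
    rw [mul_add]; exact I.add_mem ha hb
  zero_mem' := by simp [I.zero_mem]
  neg_mem' {a} ha := by
    simp only [Set.mem_ofPred_eq] at *
    rw [mul_neg]; exact I.neg_mem ha

theorem mem_scale {u : Kˣ} {I : AddSubgroup K} {y : K} :
    y ∈ scale u I ↔ ((u⁻¹ : Kˣ) : K) * y ∈ I := Iff.rfl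

theorem mul_mem_scale {u : Kˣ} {I : AddSubgroup K} {y : K} :
    (u : K) * y ∈ scale u I ↔ y ∈ I := by
  rw [mem_scale, Units.inv_mul_cancel_left]

theorem scale_mul (u v : Kˣ) (I : AddSubgroup K) : scale (u * v) I = scale u (scale v I) := by
  ext y
  simp only [mem_scale, mul_inv_rev, Units.val_mul, mul_assoc]

theorem scale_one (I : AddSubgroup K) : scale 1 I = I := by
  ext y; simp [mem_scale]

theorem scale_mono (u : Kˣ) {I J : AddSubgroup K} (h : I ≤ J) : scale u I ≤ scale u J :=
  fun _ hy => h hy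

/-- `I` is a `T`-module lying in `U` and strictly containing the maximal ideal of `U`. -/
structure IsModX (T : Subring K) (U : ValuationSubring K) (I : AddSubgroup K) : Prop where
  stable : ∀ t ∈ T, ∀ y ∈ I, t * y ∈ I
  of_lt : ∀ y, U.valuation y < 1 → y ∈ I
  unit : ∃ y ∈ I, U.valuation y = 1
  le_one : ∀ y ∈ I, U.valuation y ≤ 1

/-- `I` is a `T`-module strictly between the maximal ideal of `U` and `U`. -/
structure IsModY (T : Subring K) (U : ValuationSubring K) (I : AddSubgroup K) : Prop
    extends IsModX T U I where
  missing : ∃ y, U.valuation y = 1 ∧ y ∉ I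

/-- The poset of `T`-modules in `U` strictly containing the maximal ideal of `U`. -/
abbrev ModX (T : Subring K) (U : ValuationSubring K) : Type _ :=
  {I : AddSubgroup K // IsModX T U I}

/-- The poset of `T`-modules strictly between the maximal ideal of `U` and `U`. -/
abbrev ModY (T : Subring K) (U : ValuationSubring K) : Type _ :=
  {I : AddSubgroup K // IsModY T U I}

variable {T : Subring K} {U V : ValuationSubring K}

theorem val_unit (u : U.unitGroup) : U.valuation ((u : Kˣ) : K) = 1 :=
  (U.mem_unitGroup_iff _).1 u.2

theorem val_unit_inv (u : U.unitGroup) : U.valuation (((u : Kˣ)⁻¹ : Kˣ) : K) = 1 := by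
  simp [val_unit u]

/-- An element of valuation one as a unit. -/
def unitOf (y : K) (h : U.valuation y = 1) : U.unitGroup :=
  ⟨Units.mk0 y (by rintro rfl; simp at h), by rw [U.mem_unitGroup_iff]; exact h⟩

@[simp] theorem coe_unitOf (y : K) (h : U.valuation y = 1) :
    (((unitOf y h : U.unitGroup) : Kˣ) : K) = y := rfl

theorem IsModX.scale {I : AddSubgroup K} (h : IsModX T U I) (u : U.unitGroup) :
    IsModX T U (scale u I) where
  stable t ht y hy := by
    rw [mem_scale] at *
    rw [mul_left_comm]; exact h.stable t ht _ hy
  of_lt y hy := h.of_lt _ (by rw [map_mul, val_unit_inv, one_mul]; exact hy)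
  unit := by
    obtain ⟨y, hy, h1⟩ := h.unit
    exact ⟨((u : Kˣ) : K) * y, mul_mem_scale.2 hy, by rw [map_mul, val_unit, one_mul, h1]⟩
  le_one y hy := by
    have := h.le_one _ hy
    rwa [map_mul, val_unit_inv, one_mul] at this

theorem IsModY.scale {I : AddSubgroup K} (h : IsModY T U I) (u : U.unitGroup) :
    IsModY T U (scale u I) where
  toIsModX := h.toIsModX.scale u
  missing := by
    obtain ⟨y, h1, hy⟩ := h.missing
    exact ⟨((u : Kˣ) : K) * y, by rw [map_mul, val_unit, one_mul, h1], fun h => hy (mul_mem_scale.1 h)⟩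

variable (T U) in
/-- The action of the units of `U` by translation. -/
def actX (u : U.unitGroup) : ModX T U ≃o ModX T U where
  toFun I := ⟨scale u I.1, I.2.scale u⟩
  invFun I := ⟨scale u⁻¹ I.1, I.2.scale u⁻¹⟩
  left_inv I := Subtype.ext (by simp [← scale_mul, scale_one])
  right_inv I := Subtype.ext (by simp [← scale_mul, scale_one])
  map_rel_iff' := by
    intro I J
    refine ⟨fun h y hy => mul_mem_scale.1 (h (mul_mem_scale.2 hy)), fun h => scale_mono _ h⟩

variable (T U) in
/-- The action of the units of `U` by translation. -/
def actY (u : U.unitGroup) : ModY T U ≃o ModY T U where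
  toFun I := ⟨scale u I.1, I.2.scale u⟩
  invFun I := ⟨scale u⁻¹ I.1, I.2.scale u⁻¹⟩
  left_inv I := Subtype.ext (by simp [← scale_mul, scale_one])
  right_inv I := Subtype.ext (by simp [← scale_mul, scale_one])
  map_rel_iff' := by
    intro I J
    refine ⟨fun h y hy => mul_mem_scale.1 (h (mul_mem_scale.2 hy)), fun h => scale_mono _ h⟩

theorem actX_coe (u : U.unitGroup) (I : ModX T U) : (actX T U u I).1 = scale u I.1 := rfl
theorem actY_coe (u : U.unitGroup) (I : ModY T U) : (actY T U u I).1 = scale u I.1 := rfl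

theorem actY_one (I : ModY T U) : actY T U 1 I = I := Subtype.ext (scale_one _)

theorem actY_mul (u v : U.unitGroup) (I : ModY T U) :
    actY T U (u * v) I = actY T U u (actY T U v I) := Subtype.ext (scale_mul _ _ _)

theorem div_mem_valuationSubring {a b : K} (h : V.valuation a ≤ V.valuation b) : a / b ∈ V := by
  rw [← V.valuation_le_one_iff, map_div₀]
  exact div_le_one_of_le₀ h zero_le

theorem val_div_lt_one {a b : K} (h : V.valuation a < V.valuation b) :
    V.valuation (a / b) < 1 := by
  rw [map_div₀]
  exact (div_lt_one₀ (lt_of_le_of_lt zero_le h)).2 h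

/-- Modules over a valuation ring are linearly ordered. -/
theorem stable_total {I J : AddSubgroup K} (hI : ∀ t ∈ V, ∀ y ∈ I, t * y ∈ I)
    (hJ : ∀ t ∈ V, ∀ y ∈ J, t * y ∈ J) : I ≤ J ∨ J ≤ I := by
  by_contra! h
  obtain ⟨a, ha, ha'⟩ := SetLike.not_le_iff_exists.1 h.1
  obtain ⟨b, hb, hb'⟩ := SetLike.not_le_iff_exists.1 h.2
  have ha0 : a ≠ 0 := by rintro rfl; exact ha' J.zero_mem
  have hb0 : b ≠ 0 := by rintro rfl; exact hb' I.zero_mem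
  rcases le_total (V.valuation a) (V.valuation b) with h1 | h1
  · apply ha'
    have := hJ _ (div_mem_valuationSubring h1) b hb
    rwa [div_mul_cancel₀ _ hb0] at this
  · apply hb'
    have := hI _ (div_mem_valuationSubring h1) a ha
    rwa [div_mul_cancel₀ _ ha0] at this

/-- The closure operators on modules over a valuation ring are linearly ordered. -/
theorem eqClo_valuation_total (c d : EqClo (actY V.toSubring U)) : c ≤ d ∨ d ≤ c := by
  by_contra! h
  have key : ∀ c d : EqClo (actY V.toSubring U), ¬ c ≤ d →
      ∃ J : ModY V.toSubring U, d.toFun J = J ∧ ∃ y ∈ (c.toFun J).1, y ∉ J.1 := by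
    intro c d hcd
    rw [EqClo.le_def] at hcd
    push Not at hcd
    obtain ⟨I, hI⟩ := hcd
    obtain ⟨y, hy, hy'⟩ := SetLike.not_le_iff_exists (p := (c.toFun I).1) (q := (d.toFun I).1) |>.1 hI
    exact ⟨d.toFun I, d.idem' I, y, c.mono' (d.le' I) hy, hy'⟩
  obtain ⟨J, hJ, y, hy, hyJ⟩ := key c d h.1
  obtain ⟨J', hJ', y', hy', hyJ'⟩ := key d c h.2
  have one : ∀ (I I' : ModY V.toSubring U) (y : K), y ∈ I'.1 → y ∉ I.1 → U.valuation y = 1 := by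
    intro I I' y h1 h2
    refine le_antisymm (I'.2.le_one y h1) (not_lt.1 fun h => h2 (I.2.of_lt y h))
  have hv := one _ _ _ hy hyJ
  have hv' := one _ _ _ hy' hyJ'
  have step : ∀ (c : EqClo (actY V.toSubring U)) (J J' : ModY V.toSubring U) (y y' : K)
      (hv : U.valuation y = 1) (hv' : U.valuation y' = 1), c.toFun J' = J' → y ∈ (c.toFun J).1 →
      y' ∉ J'.1 → ¬ J ≤ actY _ _ (unitOf y hv * (unitOf y' hv')⁻¹) J' := by
    intro c J J' y y' hv hv' hc hy hy' hle
    have := c.mono' hle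
    rw [c.equiv', hc] at this
    have := this hy
    apply hy'
    rw [actY_coe, mem_scale] at this
    have hy0 : y ≠ 0 := by rintro rfl; simp at hv
    simpa [hy0] using this
  rcases stable_total (V := V) J.2.stable
    (actY _ _ (unitOf y hv * (unitOf y' hv')⁻¹) J').2.stable with h1 | h1
  · exact step c J J' y y' hv hv' hJ' hy hyJ' h1
  · apply step d J' J y' y hv' hv hJ hy' hyJ
    have := (actY V.toSubring U (unitOf y' hv' * (unitOf y hv)⁻¹)).monotone h1
    rw [← actY_mul] at this
    simpa [mul_assoc, actY_one] using this

end valuationModules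

section tower

variable {K : Type*} [Field K]

/-- `T ⊆ V ⊂ U` with `T` containing the maximal ideal of `V`. -/
structure Tower (T : Subring K) (V U : ValuationSubring K) : Prop where
  le : ∀ t ∈ T, t ∈ V
  of_lt : ∀ y, V.valuation y < 1 → y ∈ T
  le' : ∀ y ∈ V, y ∈ U
  lt : ∃ z ∈ U, z ∉ V

variable {T : Subring K} {U V : ValuationSubring K}

namespace Tower

variable (H : Tower T V U)

include H

theorem toV : Tower V.toSubring V U :=
  ⟨fun _ h => h, fun y h => (V.valuation_le_one_iff y).1 h.le, H.le', H.lt⟩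

theorem val_one {x : K} (h : V.valuation x = 1) : U.valuation x = 1 := by
  refine le_antisymm ((U.valuation_le_one_iff _).2 (H.le' _ ((V.valuation_le_one_iff _).1 h.le))) ?_
  have h1 : V.valuation x⁻¹ = 1 := by rw [map_inv₀, h, inv_one]
  have h2 := (U.valuation_le_one_iff _).2 (H.le' _ ((V.valuation_le_one_iff _).1 h1.le))
  rw [map_inv₀] at h2
  have h0 : U.valuation x ≠ 0 := by
    rw [Valuation.ne_zero_iff]; rintro rfl; simp at h
  exact (inv_le_one₀ (zero_lt_iff.2 h0)).1 h2

theorem val_lt {y : K} (h : U.valuation y < 1) : V.valuation y < 1 := by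
  by_contra! h'
  have h0 : V.valuation y ≠ 0 := fun h0 => by rw [h0] at h'; exact absurd h' (by simp)
  have h1 : V.valuation y⁻¹ ≤ 1 := by
    rw [map_inv₀]; exact (inv_le_one₀ (zero_lt_iff.2 h0)).2 h'
  have h2 := (U.valuation_le_one_iff _).2 (H.le' _ ((V.valuation_le_one_iff _).1 h1))
  rw [map_inv₀] at h2
  have h3 : U.valuation y ≠ 0 := by
    rw [Valuation.ne_zero_iff]; rintro rfl; simp at h0
  exact absurd ((inv_le_one₀ (zero_lt_iff.2 h3)).1 h2) (not_le.2 h)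

theorem val_mono {x y : K} (hy : y ≠ 0) (h : V.valuation x ≤ V.valuation y) :
    U.valuation x ≤ U.valuation y := by
  have h1 := (U.valuation_le_one_iff _).2 (H.le' _ (div_mem_valuationSubring h))
  rw [map_div₀] at h1
  have h0 : U.valuation y ≠ 0 := by rwa [Valuation.ne_zero_iff]
  exact (div_le_one₀ (zero_lt_iff.2 h0)).1 h1

theorem le_U {x : K} (h : V.valuation x ≤ 1) : U.valuation x ≤ 1 :=
  (U.valuation_le_one_iff _).2 (H.le' _ ((V.valuation_le_one_iff _).1 h))

theorem exists_gt : ∃ z, U.valuation z = 1 ∧ 1 < V.valuation z := by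
  obtain ⟨z, hz, hz'⟩ := H.lt
  have h1 : 1 < V.valuation z := not_le.1 fun h => hz' ((V.valuation_le_one_iff _).1 h)
  refine ⟨z, le_antisymm ((U.valuation_le_one_iff _).2 hz) (not_lt.1 fun h => ?_), h1⟩
  exact absurd (H.val_lt h) (not_lt.2 h1.le)

theorem isModY {J : AddSubgroup K} (hJ : IsModX T V J) : IsModY T U J where
  stable := hJ.stable
  of_lt y hy := hJ.of_lt y (H.val_lt hy)
  unit := by
    obtain ⟨y, hy, h1⟩ := hJ.unit
    exact ⟨y, hy, H.val_one h1⟩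
  le_one y hy := H.le_U (hJ.le_one y hy)
  missing := by
    obtain ⟨z, hz, hz'⟩ := H.exists_gt
    exact ⟨z, hz, fun h => absurd (hJ.le_one z h) (not_le.2 hz')⟩

/-- Modules in `V`, seen as modules in `U`. -/
def emb (J : ModX T V) : ModY T U := ⟨J.1, H.isModY J.2⟩

@[simp] theorem emb_coe (J : ModX T V) : (H.emb J).1 = J.1 := rfl

theorem emb_injective : Function.Injective H.emb := fun _ _ h =>
  Subtype.ext (Subtype.ext_iff.1 h :)

/-- `T` itself as a module in `V`. -/
def base : ModX T V :=
  ⟨T.toAddSubgroup, fun _ ht _ hy => T.mul_mem ht hy, H.of_lt, ⟨1, T.one_mem, by simp⟩,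
    fun y hy => (V.valuation_le_one_iff y).2 (H.le y hy)⟩

theorem mem_base {y : K} : y ∈ H.base.1 ↔ y ∈ T := Iff.rfl

/-- `V` as a module in `V`. -/
def topX : ModX T V :=
  ⟨V.toAddSubgroup, fun t ht _ hy => V.mul_mem _ _ (H.le t ht) hy,
    fun y hy => (V.valuation_le_one_iff y).1 hy.le, ⟨1, V.one_mem, by simp⟩,
    fun y hy => (V.valuation_le_one_iff y).2 hy⟩

theorem mem_topX {y : K} : y ∈ H.topX.1 ↔ V.valuation y ≤ 1 := (V.valuation_le_one_iff y).symm

theorem le_topX (J : ModX T V) : J ≤ H.topX := fun y hy => H.mem_topX.2 (J.2.le_one y hy)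

theorem isModY_of_V {J : AddSubgroup K} (hJ : IsModY V.toSubring U J) : IsModY T U J :=
  { hJ with stable := fun t ht => hJ.stable t (H.le t ht) }

/-- Modules over `V` seen as modules over `T`. -/
def embV (J : ModY V.toSubring U) : ModY T U := ⟨J.1, H.isModY_of_V J.2⟩

@[simp] theorem embV_coe (J : ModY V.toSubring U) : (H.embV J).1 = J.1 := rfl

omit H in
/-- The `V`-span of an additive group. -/
def spanGroup (V : ValuationSubring K) (I : AddSubgroup K) : AddSubgroup K where
  carrier := {y | ∃ z ∈ I, V.valuation y ≤ V.valuation z}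
  zero_mem' := ⟨0, I.zero_mem, le_rfl⟩
  neg_mem' {a} ha := by
    obtain ⟨z, hz, h⟩ := ha
    exact ⟨z, hz, by rwa [Valuation.map_neg]⟩
  add_mem' {a b} ha hb := by
    obtain ⟨z, hz, h⟩ := ha
    obtain ⟨z', hz', h'⟩ := hb
    rcases le_total (V.valuation z) (V.valuation z') with h1 | h1
    · exact ⟨z', hz', Valuation.map_add_le _ (h.trans h1) h'⟩
    · exact ⟨z, hz, Valuation.map_add_le _ h (h'.trans h1)⟩

theorem ratio_mem {I : AddSubgroup K} (hI : ∀ t ∈ T, ∀ y ∈ I, t * y ∈ I) {y z : K} (hz : z ∈ I)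
    (h : V.valuation y < V.valuation z) : y ∈ I := by
  have := hI _ (H.of_lt _ (val_div_lt_one h)) z hz
  rwa [div_mul_cancel₀ _ (by rintro rfl; simp at h)] at this

/-- The `V`-span of a module. -/
def vspan (I : ModY T U) : ModY V.toSubring U :=
  ⟨spanGroup V I.1,
    { stable := by
        rintro t ht y ⟨z, hz, h⟩
        refine ⟨z, hz, ?_⟩
        rw [map_mul]
        exact (mul_le_of_le_one_left' ((V.valuation_le_one_iff t).2 ht)).trans h
      of_lt := fun y hy => ⟨y, I.2.of_lt y hy, le_rfl⟩
      unit := by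
        obtain ⟨y, hy, h1⟩ := I.2.unit
        exact ⟨y, ⟨y, hy, le_rfl⟩, h1⟩
      le_one := by
        rintro y ⟨z, hz, h⟩
        by_cases hz0 : z = 0
        · subst hz0
          have : y = 0 := by simpa using h
          simp [this]
        · exact (H.val_mono hz0 h).trans (I.2.le_one z hz)
      missing := by
        obtain ⟨y, h1, hy⟩ := I.2.missing
        obtain ⟨m, hm, hm'⟩ := H.exists_gt
        refine ⟨y * m, by rw [map_mul, h1, hm, one_mul], ?_⟩
        rintro ⟨z, hz, h⟩
        apply hy
        have hy0 : V.valuation y ≠ 0 := by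
          rw [Valuation.ne_zero_iff]; rintro rfl; simp at h1
        refine H.ratio_mem I.2.stable hz (lt_of_lt_of_le ?_ h)
        rw [map_mul]
        exact lt_mul_of_one_lt_right (zero_lt_iff.2 hy0) hm' }⟩

theorem mem_vspan {I : ModY T U} {y : K} :
    y ∈ (H.vspan I).1 ↔ ∃ z ∈ I.1, V.valuation y ≤ V.valuation z := Iff.rfl

theorem le_vspan (I : ModY T U) : I ≤ H.embV (H.vspan I) := fun y hy => ⟨y, hy, le_rfl⟩

theorem vspan_mono {I J : ModY T U} (h : I ≤ J) : H.vspan I ≤ H.vspan J :=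
  fun _ ⟨z, hz, h'⟩ => ⟨z, h hz, h'⟩

theorem vspan_embV (J : ModY V.toSubring U) : H.vspan (H.embV J) = J := by
  apply le_antisymm
  · rintro y ⟨z, hz, h⟩
    by_cases hz0 : z = 0
    · subst hz0
      have : y = 0 := by simpa using h
      rw [this]; exact J.1.zero_mem
    · have := J.2.stable _ (div_mem_valuationSubring h) z hz
      rwa [div_mul_cancel₀ _ hz0] at this
  · exact fun y hy => ⟨y, hy, le_rfl⟩

theorem vspan_le {I : ModY T U} {J : ModY V.toSubring U} (h : I ≤ H.embV J) : H.vspan I ≤ J := by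
  rw [← H.vspan_embV J]; exact H.vspan_mono h

theorem vspan_act (u : U.unitGroup) (I : ModY T U) :
    H.vspan (actY T U u I) = actY _ U u (H.vspan I) := by
  apply Subtype.ext
  ext y
  rw [mem_vspan, actY_coe, actY_coe, mem_scale]
  constructor
  · rintro ⟨z, hz, h⟩
    refine ⟨_, hz, ?_⟩
    rw [map_mul, map_mul]
    exact mul_le_mul_right h _
  · rintro ⟨z, hz, h⟩
    refine ⟨((u : Kˣ) : K) * z, mul_mem_scale.2 hz, ?_⟩
    have := mul_le_mul_right h (V.valuation ((u : Kˣ) : K))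
    rwa [← map_mul, Units.mul_inv_cancel_left, ← map_mul] at this

/-- Every module is contained in a translate of any other one. -/
theorem arch (I I' : ModY T U) : ∃ g : U.unitGroup, I ≤ actY T U g I' := by
  obtain ⟨a, ha, ha'⟩ := (H.vspan I).2.missing
  obtain ⟨b, hb, hb'⟩ := I'.2.unit
  have hb0 : b ≠ 0 := by rintro rfl; simp at hb'
  refine ⟨unitOf a ha * (unitOf b hb')⁻¹, fun y hy => ?_⟩
  rw [actY_mul, actY_coe, actY_coe, mem_scale, mem_scale]
  have : V.valuation y < V.valuation a := not_le.1 fun h => ha' ⟨y, hy, h⟩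
  have h2 := I'.2.stable _ (H.of_lt _ (val_div_lt_one this)) b hb
  convert h2 using 1
  simp
  ring

/-- Presentation of a module as a translate of a module in `V`. -/
def Rep (I : ModY T U) (x : U.unitGroup) (J : ModX T V) : Prop := I = actY T U x (H.emb J)

theorem rep_or (I : ModY T U) : (∃ x J, H.Rep I x J) ∨ I = H.embV (H.vspan I) := by
  by_cases hI : H.embV (H.vspan I) ≤ I
  · exact Or.inr (le_antisymm (H.le_vspan I) hI)
  left
  obtain ⟨y, ⟨z, hz, hyz⟩, hy⟩ := SetLike.not_le_iff_exists (p := (H.embV (H.vspan I)).1)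
    (q := I.1) |>.1 hI
  have hyz' : V.valuation y = V.valuation z :=
    le_antisymm hyz (not_lt.1 fun h => hy (H.ratio_mem I.2.stable hz h))
  have hmax : ∀ w ∈ I.1, V.valuation w ≤ V.valuation z := fun w hw =>
    not_lt.1 fun h => hy (H.ratio_mem I.2.stable hw (hyz.trans_lt h))
  have hz0 : z ≠ 0 := by
    rintro rfl
    have : y = 0 := by simpa using hyz
    exact hy (this ▸ I.1.zero_mem)
  have hzU : U.valuation z = 1 := by
    refine le_antisymm (I.2.le_one z hz) (not_lt.1 fun h => hy (I.2.of_lt y ?_))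
    exact (H.val_mono hz0 hyz).trans_lt h
  have hzv : V.valuation z ≠ 0 := by rwa [Valuation.ne_zero_iff]
  refine ⟨unitOf z hzU, ⟨scale (unitOf z hzU)⁻¹ I.1, ⟨?_, ?_, ?_, ?_⟩⟩, ?_⟩
  · intro t ht w hw
    rw [mem_scale] at *
    rw [mul_left_comm]; exact I.2.stable t ht _ hw
  · intro w hw
    rw [mem_scale]
    have := I.2.stable w (H.of_lt w hw) z hz
    rw [mul_comm]
    simpa using this
  · refine ⟨1, ?_, by simp⟩
    rw [mem_scale]
    simpa using hz
  · intro w hw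
    rw [mem_scale] at hw
    have := hmax _ hw
    simp only [inv_inv, coe_unitOf, map_mul] at this
    have h2 : V.valuation z * V.valuation w ≤ V.valuation z * 1 := by simpa using this
    exact (mul_le_mul_iff_right₀ (zero_lt_iff.2 hzv)).1 h2
  · apply Subtype.ext
    rw [actY_coe, emb_coe, ← scale_mul, mul_inv_cancel, scale_one]

variable {H}

omit H in
theorem Rep.act {H : Tower T V U} {I : ModY T U} {x : U.unitGroup} {J : ModX T V}
    (h : H.Rep I x J) (u : U.unitGroup) : H.Rep (actY T U u I) (u * x) J := by
  unfold Rep at *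
  rw [h, actY_mul]

omit H in
theorem Rep.val_le {H : Tower T V U} {I : ModY T U} {x : U.unitGroup} {J : ModX T V}
    (h : H.Rep I x J) {y : K} (hy : y ∈ I.1) : V.valuation y ≤ V.valuation ((x : Kˣ) : K) := by
  rw [h, actY_coe, mem_scale] at hy
  have := mul_le_mul_right (J.2.le_one _ hy) (V.valuation ((x : Kˣ) : K))
  rwa [← map_mul, Units.mul_inv_cancel_left, mul_one] at this

omit H in
theorem Rep.exists_val {H : Tower T V U} {I : ModY T U} {x : U.unitGroup} {J : ModX T V}
    (h : H.Rep I x J) : ∃ y ∈ I.1, V.valuation y = V.valuation ((x : Kˣ) : K) := by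
  obtain ⟨y, hy, h1⟩ := J.2.unit
  refine ⟨((x : Kˣ) : K) * y, ?_, by rw [map_mul, h1, mul_one]⟩
  rw [h, actY_coe]
  exact mul_mem_scale.2 hy

omit H in
/-- Presentations with translation factors of the same value can be given the same factor. -/
theorem Rep.change {H : Tower T V U} {I : ModY T U} {x : U.unitGroup} {J : ModX T V}
    (h : H.Rep I x J) (x' : U.unitGroup)
    (hx : V.valuation ((x : Kˣ) : K) = V.valuation ((x' : Kˣ) : K)) :
    ∃ u : V.unitGroup, H.Rep I x' (actX T V u J) ∧
      ∀ J' : ModX T V, actY T U x (H.emb J') = actY T U x' (H.emb (actX T V u J')) := by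
  have h1 : V.valuation (((x'⁻¹ * x : U.unitGroup) : Kˣ) : K) = 1 := by
    have h0 : V.valuation ((x' : Kˣ) : K) ≠ 0 := by simp
    simp [hx, h0]
  have h2 : ∀ J' : ModX T V,
      actY T U x (H.emb J') = actY T U x' (H.emb (actX T V (unitOf _ h1) J')) := by
    intro J'
    apply Subtype.ext
    rw [actY_coe, actY_coe, emb_coe, emb_coe, actX_coe, ← scale_mul]
    congr 1
    apply Units.ext
    simp
  exact ⟨unitOf _ h1, by unfold Rep at *; rw [h, h2], h2⟩

variable (H)

open Classical in
/-- Extension of a closure operator on the modules in `V`. -/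
def extFun (c : EqClo (actX T V)) (I : ModY T U) : ModY T U :=
  if h : ∃ x J, H.Rep I x J then actY T U h.choose (H.emb (c.toFun h.choose_spec.choose)) else I

theorem extFun_rep (c : EqClo (actX T V)) {I : ModY T U} {x : U.unitGroup} {J : ModX T V}
    (h : H.Rep I x J) : H.extFun c I = actY T U x (H.emb (c.toFun J)) := by
  have h' : ∃ x J, H.Rep I x J := ⟨x, J, h⟩
  rw [extFun, dif_pos h']
  have hs := h'.choose_spec.choose_spec
  set x' := h'.choose
  set J' := h'.choose_spec.choose
  have hx : V.valuation ((x' : Kˣ) : K) = V.valuation ((x : Kˣ) : K) := by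
    obtain ⟨y, hy, hy'⟩ := h.exists_val
    obtain ⟨z, hz, hz'⟩ := hs.exists_val
    exact le_antisymm (hz' ▸ h.val_le hz) (hy' ▸ hs.val_le hy)
  obtain ⟨u, hu, hu'⟩ := hs.change x hx
  have : actX T V u J' = J := by
    unfold Rep at hu h
    rw [hu] at h
    have := (actY T U x).injective h
    exact H.emb_injective this
  rw [hu', ← c.equiv', this]

theorem extFun_not (c : EqClo (actX T V)) {I : ModY T U} (h : ¬ ∃ x J, H.Rep I x J) :
    H.extFun c I = I := by
  rw [extFun, dif_neg h]

theorem extFun_emb (c : EqClo (actX T V)) (J : ModX T V) :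
    H.extFun c (H.emb J) = H.emb (c.toFun J) := by
  rw [H.extFun_rep c (x := 1) (J := J) (by unfold Rep; rw [actY_one]), actY_one]

theorem le_extFun (c : EqClo (actX T V)) (I : ModY T U) : I ≤ H.extFun c I := by
  by_cases h : ∃ x J, H.Rep I x J
  · obtain ⟨x, J, h⟩ := h
    rw [H.extFun_rep c h]
    conv_lhs => rw [h]
    refine (actY T U x).monotone (?_ : (H.emb J).1 ≤ _)
    exact c.le' J
  · rw [H.extFun_not c h]

theorem extFun_le_vspan (c : EqClo (actX T V)) (I : ModY T U) :
    H.extFun c I ≤ H.embV (H.vspan I) := by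
  by_cases h : ∃ x J, H.Rep I x J
  · obtain ⟨x, J, h⟩ := h
    intro y hy
    have h' : H.Rep (H.extFun c I) x (c.toFun J) := H.extFun_rep c h
    obtain ⟨z, hz, hz'⟩ := h.exists_val
    exact ⟨z, hz, hz' ▸ h'.val_le hy⟩
  · rw [H.extFun_not c h]; exact H.le_vspan I

/-- Extension of a closure operator on the modules in `V` to the modules in `U`. -/
def ext (c : EqClo (actX T V)) : EqClo (actY T U) where
  toFun := H.extFun c
  le' := H.le_extFun c
  mono' I I' hI := by
    by_cases h' : ∃ x J, H.Rep I' x J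
    · by_cases h : ∃ x J, H.Rep I x J
      · obtain ⟨x, J, h⟩ := h
        obtain ⟨x', J', h'⟩ := h'
        have hx : V.valuation ((x : Kˣ) : K) ≤ V.valuation ((x' : Kˣ) : K) := by
          obtain ⟨y, hy, hy'⟩ := h.exists_val
          exact hy' ▸ h'.val_le (hI hy)
        rcases hx.eq_or_lt with hx | hx
        · obtain ⟨u, hu, -⟩ := h.change x' hx
          rw [H.extFun_rep c hu, H.extFun_rep c h']
          refine (actY T U x').monotone (?_ : (H.emb _).1 ≤ _)
          apply c.mono'
          rw [hu, h'] at hI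
          exact (actY T U x').le_iff_le.1 hI
        · refine le_trans ?_ (H.le_extFun c I')
          intro y hy
          have h2 : H.Rep (H.extFun c I) x (c.toFun J) := H.extFun_rep c h
          obtain ⟨z, hz, hz'⟩ := h'.exists_val
          exact H.ratio_mem I'.2.stable hz (hz' ▸ (h2.val_le hy).trans_lt hx)
      · rw [H.extFun_not c h]
        exact hI.trans (H.le_extFun c I')
    · rw [H.extFun_not c h']
      have h2 := (H.rep_or I').resolve_left h'
      refine (H.extFun_le_vspan c I).trans ?_
      rw [h2]
      exact H.vspan_mono hI
  idem' I := by
    by_cases h : ∃ x J, H.Rep I x J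
    · obtain ⟨x, J, h⟩ := h
      have h2 : H.Rep (H.extFun c I) x (c.toFun J) := H.extFun_rep c h
      rw [H.extFun_rep c h2, c.idem', H.extFun_rep c h]
    · rw [H.extFun_not c h, H.extFun_not c h]
  equiv' u I := by
    by_cases h : ∃ x J, H.Rep I x J
    · obtain ⟨x, J, h⟩ := h
      rw [H.extFun_rep c h, H.extFun_rep c (h.act u), actY_mul]
    · have h' : ¬ ∃ x J, H.Rep (actY T U u I) x J := by
        rintro ⟨x, J, h2⟩
        apply h
        refine ⟨u⁻¹ * x, J, ?_⟩
        have := h2.act u⁻¹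
        rwa [← actY_mul, inv_mul_cancel, actY_one] at this
      rw [H.extFun_not c h, H.extFun_not c h']

/-- Extension of a closure operator on the `V`-modules to the `T`-modules. -/
def extV (d : EqClo (actY V.toSubring U)) : EqClo (actY T U) where
  toFun I := H.embV (d.toFun (H.vspan I))
  le' I := (H.le_vspan I).trans (d.le' _)
  mono' I J h := d.mono' (H.vspan_mono h)
  idem' I := by rw [vspan_embV, d.idem']
  equiv' u I := by
    rw [vspan_act, d.equiv']
    rfl

end Tower

end tower

namespace Tower

variable {K : Type*} [Field K] {T : Subring K} {U V : ValuationSubring K} (H : Tower T V U)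

include H

/-- `V` as a `V`-module in `U`. -/
def topV : ModY V.toSubring U := ⟨V.toAddSubgroup, H.toV.isModY H.toV.base.2⟩

theorem mem_topV {y : K} : y ∈ H.topV.1 ↔ V.valuation y ≤ 1 := (V.valuation_le_one_iff y).symm

theorem vspan_base : H.vspan (H.emb H.base) = H.topV := by
  apply Subtype.ext
  ext y
  rw [H.mem_topV, H.mem_vspan]
  constructor
  · rintro ⟨z, hz, h⟩
    exact h.trans (H.base.2.le_one z hz)
  · exact fun h => ⟨1, T.one_mem, by simpa using h⟩

theorem not_le_of_ne {c : EqClo (actX T V)} (hc : c.toFun H.base ≠ H.topX) :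
    ¬ H.topV.1 ≤ (c.toFun H.base).1 := fun h =>
  hc (le_antisymm (H.le_topX _) fun _ hy => h (H.mem_topV.2 (H.mem_topX.1 hy)))

/-- The comparison map from the lexicographic sum. -/
def lexFun : {c : EqClo (actX T V) // c.toFun H.base ≠ H.topX} ⊕ₗ EqClo (actY V.toSubring U) →
    EqClo (actY T U) := fun x => Sum.elim (fun c => H.ext c.1) H.extV (ofLex x)

@[simp] theorem lexFun_inl (c : {c : EqClo (actX T V) // c.toFun H.base ≠ H.topX}) :
    H.lexFun (Sum.inlₗ c) = H.ext c.1 := rfl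

@[simp] theorem lexFun_inr (d : EqClo (actY V.toSubring U)) :
    H.lexFun (Sum.inrₗ d) = H.extV d := rfl

theorem ext_emb (c : EqClo (actX T V)) (J : ModX T V) :
    (H.ext c).toFun (H.emb J) = H.emb (c.toFun J) := H.extFun_emb c J

theorem lexFun_le_iff
    (x y : {c : EqClo (actX T V) // c.toFun H.base ≠ H.topX} ⊕ₗ EqClo (actY V.toSubring U)) :
    H.lexFun x ≤ H.lexFun y ↔ x ≤ y := by
  induction x using Lex.rec with
  | _ x =>
  induction y using Lex.rec with
  | _ y =>
  rcases x with c | d <;> rcases y with c' | d'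
  · change H.ext c.1 ≤ H.ext c'.1 ↔ _
    rw [Sum.Lex.inl_le_inl_iff]
    constructor
    · intro h J
      have := h (H.emb J)
      rw [ext_emb, ext_emb] at this
      exact this
    · intro h I
      change H.extFun _ _ ≤ H.extFun _ _
      by_cases hI : ∃ x J, H.Rep I x J
      · obtain ⟨x, J, hI⟩ := hI
        rw [H.extFun_rep _ hI, H.extFun_rep _ hI]
        exact (actY T U x).monotone (h J : (H.emb _).1 ≤ _)
      · rw [H.extFun_not _ hI, H.extFun_not _ hI]
  · change H.ext c.1 ≤ H.extV d' ↔ _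
    refine ⟨fun _ => Sum.Lex.inl_le_inr _ _, fun _ I => ?_⟩
    exact (H.extFun_le_vspan c.1 I).trans (d'.le' _)
  · change H.extV d ≤ H.ext c'.1 ↔ _
    refine ⟨fun h => ?_, fun h => absurd h Sum.Lex.not_inr_le_inl⟩
    exfalso
    have := h (H.emb H.base)
    rw [ext_emb] at this
    refine H.not_le_of_ne c'.2 (le_trans ?_ this)
    have h2 := d.le' (H.vspan (H.emb H.base))
    rw [vspan_base] at h2
    change H.topV.1 ≤ (d.toFun (H.vspan (H.emb H.base))).1
    rwa [vspan_base]
  · change H.extV d ≤ H.extV d' ↔ _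
    rw [Sum.Lex.inr_le_inr_iff]
    constructor
    · intro h J
      have := h (H.embV J)
      change (d.toFun (H.vspan (H.embV J))).1 ≤ (d'.toFun (H.vspan (H.embV J))).1 at this
      rwa [vspan_embV] at this
    · intro h I
      exact h _

/-- Restriction to `V`-modules of an operator making every module a `V`-module. -/
theorem exists_inr (C : EqClo (actY T U)) (h : H.topV.1 ≤ (C.toFun (H.emb H.base)).1) :
    ∃ d, H.extV d = C := by
  have hst : ∀ I z, z ∈ (C.toFun I).1 → ∀ y, V.valuation y ≤ V.valuation z →
      y ∈ (C.toFun I).1 := by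
    intro I z hz y hyz
    rcases ((C.toFun I).2.le_one z hz).lt_or_eq with h1 | h1
    · refine (C.toFun I).2.of_lt y ?_
      by_cases hz0 : z = 0
      · subst hz0
        have : y = 0 := by simpa using hyz
        simp [this]
      · exact (H.val_mono hz0 hyz).trans_lt h1
    · have h2 : actY T U (unitOf z h1) (H.emb H.base) ≤ C.toFun I := by
        intro t ht
        rw [actY_coe, mem_scale] at ht
        have := (C.toFun I).2.stable _ ht z hz
        have hz0 : z ≠ 0 := by rintro rfl; simp at h1
        simpa [mul_assoc, mul_comm _ z, hz0] using this
      have h3 := C.mono' h2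
      rw [C.idem', C.equiv'] at h3
      apply h3
      rw [actY_coe, mem_scale]
      apply h
      rw [H.mem_topV]
      have hz0 : z ≠ 0 := by rintro rfl; simp at h1
      have := (V.valuation_le_one_iff _).2 (div_mem_valuationSubring hyz)
      simpa [div_eq_inv_mul] using this
  have hst' : ∀ I, ∀ t ∈ V, ∀ y ∈ (C.toFun I).1, t * y ∈ (C.toFun I).1 := by
    intro I t ht y hy
    refine hst I y hy _ ?_
    rw [map_mul]
    exact mul_le_of_le_one_left' ((V.valuation_le_one_iff t).2 ht)
  let r : ModY T U → ModY V.toSubring U := fun I =>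
    ⟨(C.toFun I).1, { (C.toFun I).2 with stable := hst' I }⟩
  have hr : ∀ I, H.embV (r I) = C.toFun I := fun I => rfl
  refine ⟨⟨fun J => r (H.embV J), fun J => C.le' (H.embV J), fun J J' hJ => C.mono' hJ, ?_, ?_⟩, ?_⟩
  · intro J
    apply Subtype.ext
    exact (Subtype.ext_iff.1 (C.idem' (H.embV J)) :)
  · intro g J
    apply Subtype.ext
    exact (Subtype.ext_iff.1 (C.equiv' g (H.embV J)) :)
  · refine EqClo.ext' fun I => ?_
    change C.toFun (H.embV (H.vspan I)) = C.toFun I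
    apply le_antisymm
    · rw [← C.idem' I]
      apply C.mono'
      rw [← hr I]
      exact H.vspan_le (J := r I) (C.le' I)
    · exact C.mono' (H.le_vspan I)

/-- The maximal ideal of `V` as a module in `U`. -/
def maxMod : ModY T U :=
  ⟨{ carrier := {y | V.valuation y < 1}
     zero_mem' := by simp
     add_mem' := fun {a b} ha hb => show V.valuation (a + b) < 1 from
       Valuation.map_add_lt _ ha hb
     neg_mem' := fun {a} ha => by simpa [Valuation.map_neg] using ha },
    { stable := by
        intro t ht y hy
        change V.valuation (t * y) < 1
        rw [map_mul]
        exact (mul_le_of_le_one_left' ((V.valuation_le_one_iff t).2 (H.le t ht))).trans_lt hy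
      of_lt := fun y hy => H.val_lt hy
      unit := by
        obtain ⟨z, hz, hz'⟩ := H.exists_gt
        refine ⟨z⁻¹, ?_, by rw [map_inv₀, hz, inv_one]⟩
        change V.valuation z⁻¹ < 1
        rw [map_inv₀]
        exact inv_lt_one_of_one_lt₀ hz'
      le_one := fun y hy => H.le_U hy.le
      missing := ⟨1, by simp, fun h => absurd h (by
        change ¬ V.valuation 1 < 1
        simp)⟩ }⟩

theorem mem_maxMod {y : K} : y ∈ H.maxMod.1 ↔ V.valuation y < 1 := Iff.rfl

theorem exists_inl (C : EqClo (actY T U)) (h : ¬ H.topV.1 ≤ (C.toFun (H.emb H.base)).1) :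
    ∃ c : {c : EqClo (actX T V) // c.toFun H.base ≠ H.topX}, H.ext c.1 = C := by
  have hle : ∀ w ∈ (C.toFun (H.emb H.base)).1, V.valuation w ≤ 1 := by
    intro w hw
    by_contra! hw1
    apply h
    intro v hv
    exact H.ratio_mem (C.toFun _).2.stable hw ((H.mem_topV.1 hv).trans_lt hw1)
  have hmax : C.toFun H.maxMod = H.maxMod := by
    refine le_antisymm ?_ (C.le' _)
    have hsub : C.toFun H.maxMod ≤ C.toFun (H.emb H.base) := C.mono' fun y hy => H.of_lt y hy
    intro y hy
    refine lt_of_le_of_ne (hle y (hsub hy)) fun hy1 => h ?_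
    intro v hv
    apply hsub
    rcases (H.mem_topV.1 hv).lt_or_eq with hv1 | hv1
    · exact C.le' _ hv1
    have hy0 : y ≠ 0 := by rintro rfl; simp at hy1
    have huV : V.valuation (v / y) = 1 := by rw [map_div₀, hv1, hy1, div_one]
    have hu : U.valuation (v / y) = 1 := H.val_one huV
    have hm : actY T U (unitOf _ hu) H.maxMod = H.maxMod := by
      apply Subtype.ext
      ext a
      rw [actY_coe, mem_scale, H.mem_maxMod, H.mem_maxMod]
      simp only [Units.val_inv_eq_inv_val, coe_unitOf, map_mul, map_inv₀, huV, inv_one, one_mul]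
    rw [← hm, C.equiv', actY_coe, mem_scale]
    have : (v / y)⁻¹ * v = y := by
      have hv0 : v ≠ 0 := by rintro rfl; simp at hv1
      field_simp
    simp only [Units.val_inv_eq_inv_val, coe_unitOf]
    rwa [this]
  have hV : ∀ J : ModY V.toSubring U, C.toFun (H.embV J) = H.embV J := by
    intro J
    refine le_antisymm (fun y hy => ?_) (C.le' _)
    by_contra hyJ
    have hy1 : U.valuation y = 1 :=
      le_antisymm ((C.toFun _).2.le_one y hy) (not_lt.1 fun h => hyJ (J.2.of_lt y h))
    have hy0 : y ≠ 0 := by rintro rfl; simp at hy1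
    have h2 : H.embV J ≤ actY T U (unitOf y hy1) H.maxMod := by
      intro z hz
      rw [actY_coe, mem_scale, H.mem_maxMod]
      have hlt : V.valuation z < V.valuation y := by
        by_contra! hyz
        have hz0 : z ≠ 0 := by
          rintro rfl
          rw [map_zero, le_zero_iff, map_eq_zero] at hyz
          exact hy0 hyz
        have := J.2.stable _ (div_mem_valuationSubring hyz) z hz
        rw [div_mul_cancel₀ _ hz0] at this
        exact hyJ this
      simpa [div_eq_inv_mul] using val_div_lt_one hlt
    have h3 := C.mono' h2
    rw [C.equiv', hmax] at h3
    have h4 := h3 hy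
    rw [actY_coe, mem_scale, H.mem_maxMod] at h4
    simp [hy0] at h4
  have hJ : ∀ J : ModX T V, IsModX T V (C.toFun (H.emb J)).1 := by
    intro J
    refine ⟨(C.toFun _).2.stable, fun y hy => C.le' _ (J.2.of_lt y hy), ?_, ?_⟩
    · obtain ⟨y, hy, h1⟩ := J.2.unit
      exact ⟨y, C.le' _ hy, h1⟩
    · intro y hy
      have h2 : H.emb J ≤ H.embV H.topV := fun a ha => H.mem_topV.2 (J.2.le_one a ha)
      have h3 := C.mono' h2
      rw [hV] at h3
      exact H.mem_topV.1 (h3 hy)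
  refine ⟨⟨⟨fun J => ⟨_, hJ J⟩, fun J => C.le' (H.emb J), ?_, ?_, ?_⟩, ?_⟩, ?_⟩
  · intro J J' hJJ
    exact C.mono' (show H.emb J ≤ H.emb J' from hJJ)
  · intro J
    apply Subtype.ext
    exact (Subtype.ext_iff.1 (C.idem' (H.emb J)) :)
  · intro u J
    apply Subtype.ext
    have hu : U.valuation ((u : Kˣ) : K) = 1 := H.val_one (val_unit u)
    have hu' : ∀ I : AddSubgroup K, scale (u : Kˣ) I = scale ((unitOf _ hu : U.unitGroup) : Kˣ) I := by
      intro I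
      congr 1
      exact Units.ext rfl
    have h2 : H.emb (actX T V u J) = actY T U (unitOf _ hu) (H.emb J) :=
      Subtype.ext (hu' J.1)
    change (C.toFun (H.emb (actX T V u J))).1 = scale (u : Kˣ) (C.toFun (H.emb J)).1
    rw [h2, C.equiv', hu']
    rfl
  · intro h2
    apply h
    have h3 := Subtype.ext_iff.1 h2
    intro y hy
    have : y ∈ (H.topX).1 := H.mem_topX.2 (H.mem_topV.1 hy)
    rw [← h3] at this
    exact this
  · refine EqClo.ext' fun I => ?_
    change H.extFun _ I = _
    by_cases hI : ∃ x J, H.Rep I x J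
    · obtain ⟨x, J, hI⟩ := hI
      rw [H.extFun_rep _ hI]
      conv_rhs => rw [hI, C.equiv']
      rfl
    · rw [H.extFun_not _ hI]
      have := (H.rep_or I).resolve_left hI
      rw [this, hV]

theorem lexFun_surjective : Function.Surjective H.lexFun := by
  intro C
  by_cases h : H.topV.1 ≤ (C.toFun (H.emb H.base)).1
  · obtain ⟨d, hd⟩ := H.exists_inr C h
    exact ⟨Sum.inrₗ d, hd⟩
  · obtain ⟨c, hc⟩ := H.exists_inl C h
    exact ⟨Sum.inlₗ c, hc⟩

/-- The operators on `T`-modules in `U` split into those coming from `V` and those over `V`. -/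
def lexIso : EqClo (actY T U) ≃o
    {c : EqClo (actX T V) // c.toFun H.base ≠ H.topX} ⊕ₗ EqClo (actY V.toSubring U) :=
  (RelIso.mk (Equiv.ofBijective H.lexFun
    ⟨fun x y h => le_antisymm ((H.lexFun_le_iff x y).1 h.le) ((H.lexFun_le_iff y x).1 h.ge),
      H.lexFun_surjective⟩) (fun {x y} => H.lexFun_le_iff x y)).symm

end Tower

section pruefer

variable {D : Type*} [CommRing D] [IsDomain D]
variable {K : Type*} [Field K] [Algebra D K] [IsFractionRing D K]

theorem algebraMap_ne_zero_of_notMem {P : Ideal D} {d : D} (hd : d ∉ P) :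
    algebraMap D K d ≠ 0 := fun h =>
  hd (by rw [FaithfulSMul.algebraMap_eq_zero_iff] at h; exact h ▸ P.zero_mem)

theorem mem_locAt {P : Ideal D} {hP : P.IsPrime} {x : K} :
    x ∈ locAt D K P hP ↔ ∃ d ∉ P, ∃ a, algebraMap D K d * x = algebraMap D K a := by
  rw [locAt, ← Localization.subalgebra.ofField_eq]
  change (∃ (a s : D) (_ : s ∈ P.primeCompl), x = algebraMap D K a * (algebraMap D K s)⁻¹) ↔ _
  constructor
  · rintro ⟨a, d, hd, rfl⟩
    have := algebraMap_ne_zero_of_notMem (K := K) (P := P) hd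
    exact ⟨d, hd, a, by field_simp⟩
  · rintro ⟨d, hd, a, h⟩
    have := algebraMap_ne_zero_of_notMem (K := K) hd
    exact ⟨a, d, hd, by rw [← h]; field_simp⟩

/-- The valuation ring of a Prüfer domain at a prime. -/
def valAt (hP : IsPrufer D K) (p : PrimeSpectrum D) : ValuationSubring K :=
  { (locAt D K p.asIdeal p.2).toSubring with
    mem_or_inv_mem' := by
      intro x
      change x ∈ locAt D K p.asIdeal p.2 ∨ x⁻¹ ∈ locAt D K p.asIdeal p.2
      obtain ⟨a, s, hs, rfl⟩ := IsFractionRing.div_surjective (A := D) x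
      have hs0 : algebraMap D K s ≠ 0 := by
        rw [Ne, FaithfulSMul.algebraMap_eq_zero_iff]; exact nonZeroDivisors.ne_zero hs
      obtain ⟨z, h | h⟩ := hP p.asIdeal p.2 (algebraMap D _ a) (algebraMap D _ s)
      · right
        have h' : algebraMap D K a * z = algebraMap D K s := congrArg Subtype.val h
        have : (algebraMap D K a / algebraMap D K s)⁻¹ = z := by
          have ha0 : algebraMap D K a ≠ 0 := by
            intro ha; rw [ha, zero_mul] at h'; exact hs0 h'.symm
          rw [← h']; field_simp
        rw [this]; exact z.2
      · left
        have h' : algebraMap D K s * z = algebraMap D K a := congrArg Subtype.val h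
        have : algebraMap D K a / algebraMap D K s = z := by
          rw [← h']; field_simp
        rw [this]; exact z.2 }

variable {hP : IsPrufer D K} {p q r : PrimeSpectrum D}

theorem mem_valAt {x : K} :
    x ∈ valAt hP p ↔ ∃ d ∉ p.asIdeal, ∃ a, algebraMap D K d * x = algebraMap D K a :=
  mem_locAt (hP := p.2)

theorem algebraMap_mem_valAt (d : D) : algebraMap D K d ∈ valAt hP p :=
  (locAt D K p.asIdeal p.2).algebraMap_mem d

theorem val_algebraMap_le (d : D) : (valAt hP p).valuation (algebraMap D K d) ≤ 1 :=
  ((valAt hP p).valuation_le_one_iff _).2 (algebraMap_mem_valAt d)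

theorem val_algebraMap_lt {d : D} :
    (valAt hP p).valuation (algebraMap D K d) < 1 ↔ d ∈ p.asIdeal := by
  rw [← not_iff_not, not_lt]
  constructor
  · intro h hd
    have h0 : algebraMap D K d ≠ 0 := by
      intro h0; rw [h0, map_zero] at h; exact absurd h (by simp)
    have h1 : (algebraMap D K d)⁻¹ ∈ valAt hP p := by
      rw [← ValuationSubring.valuation_le_one_iff, map_inv₀]
      refine (inv_le_one₀ (zero_lt_iff.2 ?_)).2 h
      rwa [Valuation.ne_zero_iff]
    obtain ⟨e, he, a, ha⟩ := mem_valAt.1 h1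
    have h2 : algebraMap D K e = algebraMap D K (a * d) := by
      rw [map_mul, ← ha]; field_simp
    have := FaithfulSMul.algebraMap_injective D K h2
    exact he (this ▸ p.asIdeal.mul_mem_left _ hd)
  · intro hd
    have h0 := algebraMap_ne_zero_of_notMem (K := K) hd
    have h1 : (algebraMap D K d)⁻¹ ∈ valAt hP p :=
      mem_valAt.2 ⟨d, hd, 1, by rw [map_one]; field_simp⟩
    rw [← ValuationSubring.valuation_le_one_iff, map_inv₀] at h1
    refine (inv_le_one₀ (zero_lt_iff.2 ?_)).1 h1
    rwa [Valuation.ne_zero_iff]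

theorem val_algebraMap_eq {d : D} (hd : d ∉ p.asIdeal) :
    (valAt hP p).valuation (algebraMap D K d) = 1 :=
  le_antisymm (val_algebraMap_le d) (not_lt.1 fun h => hd (val_algebraMap_lt.1 h))

theorem valAt_mono (h : q ≤ p) {x : K} (hx : x ∈ valAt hP p) : x ∈ valAt hP q := by
  obtain ⟨d, hd, a, ha⟩ := mem_valAt.1 hx
  exact mem_valAt.2 ⟨d, fun h' => hd (h h'), a, ha⟩

theorem valAt_lt (h : q < p) : ∃ z ∈ valAt hP q, z ∉ valAt hP p := by
  obtain ⟨d, hd, hd'⟩ := SetLike.exists_of_lt (show q.asIdeal < p.asIdeal from h)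
  have h0 := algebraMap_ne_zero_of_notMem (K := K) hd'
  refine ⟨(algebraMap D K d)⁻¹, mem_valAt.2 ⟨d, hd', 1, by rw [map_one]; field_simp⟩, fun h1 => ?_⟩
  rw [← ValuationSubring.valuation_le_one_iff, map_inv₀] at h1
  have h2 := val_algebraMap_lt (hP := hP) |>.2 hd
  refine absurd ((inv_le_one₀ (zero_lt_iff.2 ?_)).1 h1) (not_le.2 h2)
  rwa [Valuation.ne_zero_iff]

/-- The primes below a given prime form a chain. -/
theorem prime_chain (K : Type*) [Field K] [Algebra D K] [IsFractionRing D K]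
    (hP : IsPrufer D K) {p q r : PrimeSpectrum D} (hq : q ≤ p) (hr : r ≤ p) : q ≤ r ∨ r ≤ q := by
  by_contra! h
  obtain ⟨a, ha, ha'⟩ := SetLike.not_le_iff_exists (p := q.asIdeal) (q := r.asIdeal) |>.1 h.1
  obtain ⟨b, hb, hb'⟩ := SetLike.not_le_iff_exists (p := r.asIdeal) (q := q.asIdeal) |>.1 h.2
  have key : ∀ (q r : PrimeSpectrum D) (a b : D), r ≤ p → a ∉ r.asIdeal → b ∈ r.asIdeal →
      ¬ (valAt hP p).valuation (algebraMap D K a) ≤ (valAt hP p).valuation (algebraMap D K b) := by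
    intro q r a b hr ha hb h
    obtain ⟨d, hd, c, hc⟩ := mem_valAt.1 (div_mem_valuationSubring h)
    have hb0 : algebraMap D K b ≠ 0 := by
      intro h0
      rw [h0, map_zero, le_zero_iff, map_eq_zero] at h
      exact algebraMap_ne_zero_of_notMem ha h
    have h2 : algebraMap D K (d * a) = algebraMap D K (c * b) := by
      rw [map_mul, map_mul, ← hc]; field_simp
    have h3 := FaithfulSMul.algebraMap_injective D K h2
    have h4 : d * a ∈ r.asIdeal := h3 ▸ r.asIdeal.mul_mem_left _ hb
    rcases r.2.mem_or_mem h4 with h5 | h5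
    · exact hd (hr h5)
    · exact ha h5
  rcases le_total ((valAt hP p).valuation (algebraMap D K a))
    ((valAt hP p).valuation (algebraMap D K b)) with h1 | h1
  · exact key q r a b hr ha' hb h1
  · exact key r q b a hq hb' ha h1

/-- The maximal ideals above a prime. -/
def maxAbove (p : PrimeSpectrum D) : Set (PrimeSpectrum D) := {M | M.asIdeal.IsMaximal ∧ p ≤ M}

theorem maxAbove_finite (hs : IsSemilocal D) (p : PrimeSpectrum D) : (maxAbove p).Finite := by
  refine Set.Finite.of_finite_image (f := PrimeSpectrum.asIdeal) (hs.subset ?_) ?_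
  · rintro _ ⟨M, hM, rfl⟩; exact hM.1
  · intro M _ N _ h; exact PrimeSpectrum.ext h

theorem maxAbove_nonempty (p : PrimeSpectrum D) : (maxAbove p).Nonempty := by
  obtain ⟨M, hM, h⟩ := p.asIdeal.exists_le_maximal p.2.ne_top
  exact ⟨⟨M, hM.isPrime⟩, hM, h⟩

variable (hP) in
/-- The intersection of the localizations at the maximal ideals above a prime. -/
def ringAt (p : PrimeSpectrum D) : Subring K := ⨅ M ∈ maxAbove p, (valAt hP M).toSubring

theorem mem_ringAt {x : K} : x ∈ ringAt hP p ↔ ∀ M ∈ maxAbove p, x ∈ valAt hP M := by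
  simp [ringAt, Subring.mem_iInf]

theorem algebraMap_mem_ringAt (d : D) : algebraMap D K d ∈ ringAt hP p :=
  mem_ringAt.2 fun _ _ => algebraMap_mem_valAt d

theorem ringAt_le {x : K} (hx : x ∈ ringAt hP p) : x ∈ valAt hP p := by
  obtain ⟨M, hM⟩ := maxAbove_nonempty p
  exact valAt_mono hM.2 (mem_ringAt.1 hx M hM)

theorem ringAt_mono (h : q ≤ p) {x : K} (hx : x ∈ ringAt hP q) : x ∈ ringAt hP p :=
  mem_ringAt.2 fun M hM => mem_ringAt.1 hx M ⟨hM.1, h.trans hM.2⟩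

theorem val_lt_of_le (h : q ≤ p) {x : K} (hx : (valAt hP q).valuation x < 1) :
    (valAt hP p).valuation x < 1 := by
  rcases h.eq_or_lt with rfl | h
  · exact hx
  · refine Tower.val_lt (T := (valAt hP p).toSubring) (U := valAt hP q) ⟨fun _ h => h, fun y hy =>
      ((valAt hP p).valuation_le_one_iff y).1 hy.le, fun y => valAt_mono h.le, valAt_lt h⟩ hx

theorem val_one_of_le (h : q ≤ p) {x : K} (hx : (valAt hP p).valuation x = 1) :
    (valAt hP q).valuation x = 1 := by
  rcases h.eq_or_lt with rfl | h
  · exact hx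
  · refine Tower.val_one (T := (valAt hP p).toSubring) (V := valAt hP p) ⟨fun _ h => h, fun y hy =>
      ((valAt hP p).valuation_le_one_iff y).1 hy.le, fun y => valAt_mono h.le, valAt_lt h⟩ hx

theorem mem_ringAt_of_lt {x : K} (hx : (valAt hP p).valuation x < 1) : x ∈ ringAt hP p :=
  mem_ringAt.2 fun _ hM =>
    ((valAt hP _).valuation_le_one_iff x).1 (val_lt_of_le hM.2 hx).le

variable (hP) in
theorem tower (h : q < p) : Tower (ringAt hP p) (valAt hP p) (valAt hP q) where
  le _ := ringAt_le
  of_lt _ := mem_ringAt_of_lt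
  le' _ := valAt_mono h.le
  lt := valAt_lt h

theorem ringAt_of_isMaximal (h : p.asIdeal.IsMaximal) :
    ringAt hP p = (valAt hP p).toSubring := by
  ext x
  refine ⟨fun hx => ringAt_le hx, fun hx => mem_ringAt.2 fun M hM => ?_⟩
  have : p = M := PrimeSpectrum.ext (h.eq_of_le hM.1.ne_top hM.2)
  exact this ▸ hx

theorem isMaximal_of_ringAt (h : ∀ x ∈ valAt hP p, x ∈ ringAt hP p) : p.asIdeal.IsMaximal := by
  obtain ⟨M, hM⟩ := maxAbove_nonempty p
  rcases hM.2.eq_or_lt with rfl | h'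
  · exact hM.1
  · obtain ⟨z, hz, hz'⟩ := valAt_lt (hP := hP) h'
    exact absurd (mem_ringAt.1 (h z hz) M hM) hz'

end pruefer

section pruefer

variable {D : Type*} [CommRing D] [IsDomain D]
variable {K : Type*} [Field K] [Algebra D K] [IsFractionRing D K]
variable {hP : IsPrufer D K} {p q r : PrimeSpectrum D}

/-- The localization of a module at the maximal ideals above a prime. -/
def locMod (p : PrimeSpectrum D) (I : AddSubgroup K)
    (hI : ∀ d : D, ∀ y ∈ I, algebraMap D K d * y ∈ I) : AddSubgroup K where
  carrier := {y | ∀ M ∈ maxAbove p, ∃ d ∉ M.asIdeal, algebraMap D K d * y ∈ I}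
  zero_mem' M _ := ⟨1, (Ideal.ne_top_iff_one _).1 M.2.ne_top, by simp [I.zero_mem]⟩
  neg_mem' {y} hy M hM := by
    obtain ⟨d, hd, h⟩ := hy M hM
    exact ⟨d, hd, by rw [mul_neg]; exact I.neg_mem h⟩
  add_mem' {y z} hy hz M hM := by
    obtain ⟨d, hd, h⟩ := hy M hM
    obtain ⟨e, he, h'⟩ := hz M hM
    refine ⟨d * e, fun hde => (M.2.mem_or_mem hde).elim hd he, ?_⟩
    rw [mul_add, map_mul]
    refine I.add_mem ?_ ?_
    · rw [mul_comm (algebraMap D K d), mul_assoc]; exact hI _ _ h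
    · rw [mul_assoc]; exact hI _ _ h'

/-- Prime avoidance for the maximal ideals above a prime. -/
theorem exists_avoid (hs : IsSemilocal D) (𝔞 : Ideal D)
    (h : ∀ M ∈ maxAbove p, ¬ 𝔞 ≤ M.asIdeal) :
    ∃ s ∈ 𝔞, ∀ M ∈ maxAbove p, s ∉ M.asIdeal := by
  have := (Ideal.subset_union_prime_finite (maxAbove_finite hs p) (f := PrimeSpectrum.asIdeal)
    p p (fun i _ _ _ => i.2) (I := 𝔞)).not
  have h2 : ¬ (𝔞 : Set D) ⊆ ⋃ i ∈ maxAbove p, (i.asIdeal : Set D) := by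
    rw [this]; rintro ⟨M, hM, h'⟩; exact h M hM h'
  obtain ⟨s, hs, hs'⟩ := Set.not_subset.1 h2
  refine ⟨s, hs, fun M hM h3 => hs' ?_⟩
  simp only [Set.mem_iUnion]
  exact ⟨M, hM, h3⟩

theorem inv_mem_ringAt {s : D} (h : ∀ M ∈ maxAbove p, s ∉ M.asIdeal) :
    (algebraMap D K s)⁻¹ ∈ ringAt hP p := by
  refine mem_ringAt.2 fun M hM => mem_valAt.2 ⟨s, h M hM, 1, ?_⟩
  have := algebraMap_ne_zero_of_notMem (K := K) (h M hM)
  rw [map_one]; field_simp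

/-- Modules over the localization are local. -/
theorem locMod_le (hs : IsSemilocal D) {I : AddSubgroup K}
    (hI : ∀ t ∈ ringAt hP p, ∀ y ∈ I, t * y ∈ I) {y : K}
    (hy : ∀ M ∈ maxAbove p, ∃ d ∉ M.asIdeal, algebraMap D K d * y ∈ I) : y ∈ I := by
  let 𝔞 : Ideal D :=
    { carrier := {d | algebraMap D K d * y ∈ I}
      zero_mem' := by simp [I.zero_mem]
      add_mem' := fun {a b} ha hb => by
        change algebraMap D K (a + b) * y ∈ I
        rw [map_add, add_mul]; exact I.add_mem ha hb
      smul_mem' := fun c d hd => by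
        change algebraMap D K (c * d) * y ∈ I
        rw [map_mul, mul_assoc]
        exact hI _ (algebraMap_mem_ringAt c) _ hd }
  obtain ⟨s, hs', h⟩ := exists_avoid hs 𝔞 (p := p) fun M hM h => by
    obtain ⟨d, hd, h'⟩ := hy M hM
    exact hd (h h')
  have h2 := hI _ (inv_mem_ringAt h) _ (show algebraMap D K s * y ∈ I from hs')
  obtain ⟨M, hM⟩ := maxAbove_nonempty p
  have := algebraMap_ne_zero_of_notMem (K := K) (h M hM)
  rwa [← mul_assoc, inv_mul_cancel₀ this, one_mul] at h2

/-- A family of primes directly above `q`, independent over `q`. -/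
structure Fan {ι : Type*} (q : PrimeSpectrum D) (pr : ι → PrimeSpectrum D) : Prop where
  lt : ∀ i, q < pr i
  cover : ∀ M ∈ maxAbove q, ∃ i, pr i ≤ M
  sep : ∀ i j, i ≠ j → ∀ r, r ≤ pr i → r ≤ pr j → r ≤ q

namespace Fan

variable {ι : Type*} {pr : ι → PrimeSpectrum D} (F : Fan q pr)

include F

theorem max_sub (i : ι) {M : PrimeSpectrum D} (hM : M ∈ maxAbove (pr i)) : M ∈ maxAbove q :=
  ⟨hM.1, (F.lt i).le.trans hM.2⟩

theorem sep_max (hP : IsPrufer D K) {i j : ι} (hij : i ≠ j) {M N : PrimeSpectrum D}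
    (hM : pr i ≤ M) (hN : pr j ≤ N) {r : PrimeSpectrum D} (hr : r ≤ M) (hr' : r ≤ N) : r ≤ q := by
  have h1 : ¬ pr i ≤ pr j := fun h => (F.lt i).not_ge (F.sep i j hij _ le_rfl h)
  have h2 : ¬ pr j ≤ pr i := fun h => (F.lt j).not_ge (F.sep i j hij _ h le_rfl)
  have h3 : r ≤ pr i := by
    refine (prime_chain K hP hr hM).resolve_right fun h => ?_
    exact (prime_chain K hP (h.trans hr') hN).elim h1 h2
  have h4 : r ≤ pr j := by
    refine (prime_chain K hP hr' hN).resolve_right fun h => ?_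
    exact (prime_chain K hP hM (h.trans hr)).elim h1 h2
  exact F.sep i j hij r h3 h4

/-- Localizing at independent maximal ideals gives the common localization. -/
theorem exists_mul_mem (hs : IsSemilocal D) {i j : ι} (hij : i ≠ j) {M : PrimeSpectrum D}
    (hM : pr i ≤ M) {x : K} (hx : x ∈ valAt hP q) :
    ∃ d ∉ M.asIdeal, algebraMap D K d * x ∈ ringAt hP (pr j) := by
  classical
  have key : ∀ N ∈ maxAbove (pr j), ∃ d ∉ M.asIdeal, algebraMap D K d * x ∈ valAt hP N := by
    intro N hN
    let 𝔟 : Ideal D :=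
      { carrier := {d | algebraMap D K d * x ∈ valAt hP N}
        zero_mem' := by simp [(valAt hP N).zero_mem]
        add_mem' := fun {a b} ha hb => by
          change algebraMap D K (a + b) * x ∈ valAt hP N
          rw [map_add, add_mul]; exact (valAt hP N).add_mem _ _ ha hb
        smul_mem' := fun c d hd => by
          change algebraMap D K (c * d) * x ∈ valAt hP N
          rw [map_mul, mul_assoc]
          exact (valAt hP N).mul_mem _ _ (algebraMap_mem_valAt c) hd }
    have hb : ∀ d, d ∈ 𝔟 ↔ algebraMap D K d * x ∈ valAt hP N := fun d => Iff.rfl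
    by_contra! hcon
    have hdis : Disjoint (𝔟 : Set D) (M.asIdeal.primeCompl ⊔ N.asIdeal.primeCompl : Submonoid D) := by
      rw [Set.disjoint_left]
      rintro d hd hd'
      obtain ⟨a, ha, b, hb', rfl⟩ := Submonoid.mem_sup.1 hd'
      apply hcon a ha
      have h1 := (hb _).1 hd
      rw [← ValuationSubring.valuation_le_one_iff, map_mul, map_mul, map_mul,
        val_algebraMap_eq hb', mul_one, ← map_mul] at h1
      exact ((valAt hP N).valuation_le_one_iff _).1 h1
    obtain ⟨r, hr, hbr, hdr⟩ := Ideal.exists_le_prime_disjoint 𝔟 _ hdis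
    have h1 : r ≤ M.asIdeal := fun a ha => by
      by_contra h
      exact Set.disjoint_left.1 hdr ha (Submonoid.mem_sup_left h)
    have h2 : r ≤ N.asIdeal := fun a ha => by
      by_contra h
      exact Set.disjoint_left.1 hdr ha (Submonoid.mem_sup_right h)
    have h3 : r ≤ q.asIdeal := F.sep_max hP hij hM hN.2 (r := ⟨r, hr⟩) h1 h2
    obtain ⟨d, hd, a, ha⟩ := mem_valAt.1 hx
    refine hd (h3 (hbr ((hb d).2 ?_)))
    rw [ha]; exact algebraMap_mem_valAt a
  choose! f hf hf' using key
  have hfin := maxAbove_finite hs (pr j)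
  refine ⟨∏ N ∈ hfin.toFinset, f N, ?_, ?_⟩
  · rw [M.2.prod_mem_iff]
    rintro ⟨N, hN, h⟩
    exact hf N (hfin.mem_toFinset.1 hN) h
  · refine mem_ringAt.2 fun N hN => ?_
    rw [← Finset.prod_erase_mul _ _ (hfin.mem_toFinset.2 hN), map_mul, mul_assoc]
    exact (valAt hP N).mul_mem _ _ (algebraMap_mem_valAt _) (hf' N hN)

/-- Independent approximation of units. -/
theorem exists_approx [Finite ι] (hs : IsSemilocal D) (y : ι → K)
    (hy : ∀ i, (valAt hP q).valuation (y i) = 1) :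
    ∃ u : K, ∀ i, ∀ M ∈ maxAbove (pr i), (valAt hP M).valuation (u / y i) = 1 := by
  classical
  have := Fintype.ofFinite ι
  have hy0 : ∀ i, y i ≠ 0 := fun i h => by have := hy i; rw [h, map_zero] at this; simp at this
  have hfin := maxAbove_finite hs q
  have h1 : ∀ i, ∀ M ∈ maxAbove (pr i), ∃ d ∉ M.asIdeal, ∀ j,
      algebraMap D K d * (y i / y j) ∈ ringAt hP (pr j) := by
    intro i M hM
    have : ∀ j, ∃ d ∉ M.asIdeal, algebraMap D K d * (y i / y j) ∈ ringAt hP (pr j) := by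
      intro j
      by_cases hij : i = j
      · subst hij
        refine ⟨1, (Ideal.ne_top_iff_one _).1 M.2.ne_top, ?_⟩
        rw [div_self (hy0 i), map_one, mul_one]
        exact (ringAt hP _).one_mem
      · refine F.exists_mul_mem hs hij hM.2 ?_
        rw [← ValuationSubring.valuation_le_one_iff, map_div₀, hy, hy, div_one]
    choose f hf hf' using this
    refine ⟨∏ j, f j, ?_, fun j => ?_⟩
    · rw [M.2.prod_mem_iff]
      rintro ⟨j, -, h⟩
      exact hf j h
    · rw [← Finset.prod_erase_mul _ _ (Finset.mem_univ j), map_mul, mul_assoc]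
      exact (ringAt hP _).mul_mem (algebraMap_mem_ringAt _) (hf' j)
  have h2 : ∀ M ∈ maxAbove q, ∃ i, pr i ≤ M := F.cover
  have : Nonempty ι := ⟨(h2 _ (maxAbove_nonempty q).some_mem).choose⟩
  choose! ix hix using h2
  have h3 : ∀ M ∈ maxAbove q, ∃ d ∉ M.asIdeal, ∀ j,
      algebraMap D K d * (y (ix M) / y j) ∈ ringAt hP (pr j) :=
    fun M hM => h1 (ix M) M ⟨hM.1, hix M hM⟩
  choose! d hd hd' using h3
  have h4 : ∀ M ∈ maxAbove q, ∃ e ∉ M.asIdeal, ∀ N ∈ maxAbove q, N ≠ M → e ∈ N.asIdeal := by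
    intro M hM
    by_contra! hcon
    have h5 : (hfin.toFinset.erase M).inf PrimeSpectrum.asIdeal ≤ M.asIdeal := by
      intro e he
      by_contra hcon'
      obtain ⟨N, hN, hNM, h⟩ := hcon e hcon'
      apply h
      exact (Finset.inf_le (f := PrimeSpectrum.asIdeal)
        (Finset.mem_erase.2 ⟨hNM, hfin.mem_toFinset.2 hN⟩)) he
    obtain ⟨N, hN, h⟩ := M.2.inf_le'.1 h5
    obtain ⟨hNM, hN⟩ := Finset.mem_erase.1 hN
    exact hNM (PrimeSpectrum.ext ((hfin.mem_toFinset.1 hN).1.eq_of_le M.2.ne_top h))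
  choose! e he he' using h4
  refine ⟨∑ N ∈ hfin.toFinset, algebraMap D K (e N) * (algebraMap D K (d N) * y (ix N)), ?_⟩
  intro i M hM
  have hMq := F.max_sub i hM
  have hi : ix M = i := by
    by_contra h
    exact (F.lt i).not_ge (F.sep_max hP h (hix M hMq) le_rfl hM.2 le_rfl)
  rw [Finset.sum_div, ← Finset.add_sum_erase _ _ (hfin.mem_toFinset.2 hMq), hi]
  have h5 : (valAt hP M).valuation
      (algebraMap D K (e M) * (algebraMap D K (d M) * y i) / y i) = 1 := by
    rw [← mul_assoc, mul_div_assoc, div_self (hy0 i), mul_one, map_mul,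
      val_algebraMap_eq (he M hMq), val_algebraMap_eq (hd M hMq), one_mul]
  have h6 : (valAt hP M).valuation (∑ N ∈ hfin.toFinset.erase M,
      algebraMap D K (e N) * (algebraMap D K (d N) * y (ix N)) / y i) < 1 := by
    refine Valuation.map_sum_lt _ one_ne_zero fun N hN => ?_
    obtain ⟨hNM, hN⟩ := Finset.mem_erase.1 hN
    have hNq := hfin.mem_toFinset.1 hN
    have h7 : (valAt hP M).valuation (algebraMap D K (d N) * (y (ix N) / y i)) ≤ 1 :=
      ((valAt hP M).valuation_le_one_iff _).2 (mem_ringAt.1 (hd' N hNq i) M hM)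
    have h8 : (valAt hP M).valuation (algebraMap D K (e N)) < 1 :=
      val_algebraMap_lt.2 (he' N hNq M hMq (Ne.symm hNM))
    rw [mul_div_assoc, mul_div_assoc, map_mul]
    exact (mul_le_of_le_one_right' h7).trans_lt h8
  rw [Valuation.map_add_eq_of_lt_left, h5]
  rwa [h5]

end Fan

end pruefer

section adjoinTop

variable {K : Type*} [Field K] {T : Subring K} {U : ValuationSubring K}

/-- The largest element of `ModX T U`. -/
def wholeX (hT : ∀ t ∈ T, t ∈ U) : ModX T U :=
  ⟨U.toAddSubgroup,
    { stable := fun t ht _ hy => U.mul_mem _ _ (hT t ht) hy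
      of_lt := fun _ hy => (U.valuation_le_one_iff _).1 hy.le
      unit := ⟨1, U.one_mem, map_one _⟩
      le_one := fun _ hy => (U.valuation_le_one_iff _).2 hy }⟩

theorem mem_wholeX {hT : ∀ t ∈ T, t ∈ U} {y : K} : y ∈ (wholeX hT).1 ↔ U.valuation y ≤ 1 :=
  (U.valuation_le_one_iff y).symm

/-- The poset `ModX T U` is `ModY T U` with a top element adjoined. -/
def ofTop (hT : ∀ t ∈ T, t ∈ U) : WithTop (ModY T U) → ModX T U
  | ⊤ => wholeX hT
  | (J : ModY T U) => ⟨J.1, J.2.toIsModX⟩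

theorem ofTop_top (hT : ∀ t ∈ T, t ∈ U) : ofTop hT ⊤ = wholeX hT := rfl

theorem ofTop_le_iff (hT : ∀ t ∈ T, t ∈ U) {a b : WithTop (ModY T U)} :
    ofTop hT a ≤ ofTop hT b ↔ a ≤ b := by
  cases a with
  | top =>
    cases b with
    | top => simp
    | coe J =>
      simp only [top_le_iff, WithTop.coe_ne_top, iff_false]
      intro h
      obtain ⟨y, h1, hy⟩ := J.2.missing
      exact hy (h ((mem_wholeX (hT := hT)).2 h1.le))
  | coe I =>
    cases b with
    | top =>
      simp only [le_top, iff_true]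
      exact fun y hy => (mem_wholeX (hT := hT)).2 (I.2.le_one y hy)
    | coe J =>
      rw [WithTop.coe_le_coe]
      exact Iff.rfl

theorem ofTop_surjective (hT : ∀ t ∈ T, t ∈ U) : Function.Surjective (ofTop hT) := by
  intro I
  by_cases h : ∃ y, U.valuation y = 1 ∧ y ∉ I.1
  · exact ⟨((⟨I.1, { I.2 with missing := h }⟩ : ModY T U) : WithTop (ModY T U)), rfl⟩
  · refine ⟨⊤, Subtype.ext (AddSubgroup.ext fun y => ?_)⟩
    rw [ofTop_top, mem_wholeX]
    refine ⟨fun hy => ?_, fun hy => I.2.le_one y hy⟩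
    rcases hy.lt_or_eq with h1 | h1
    · exact I.2.of_lt y h1
    · by_contra h2
      exact h ⟨y, h1, h2⟩

/-- The order isomorphism underlying `ofTop`. -/
def topIso (hT : ∀ t ∈ T, t ∈ U) : WithTop (ModY T U) ≃o ModX T U where
  toEquiv := Equiv.ofBijective (ofTop hT)
    ⟨fun _ _ h => le_antisymm ((ofTop_le_iff hT).1 h.le) ((ofTop_le_iff hT).1 h.ge),
      ofTop_surjective hT⟩
  map_rel_iff' := ofTop_le_iff hT

theorem topIso_apply (hT : ∀ t ∈ T, t ∈ U) (x) : topIso hT x = ofTop hT x := rfl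

theorem topIso_act (hT : ∀ t ∈ T, t ∈ U) (u : U.unitGroup) (x : WithTop (ModY T U)) :
    topIso hT (x.map (actY T U u)) = actX T U u (topIso hT x) := by
  cases x with
  | coe J => rfl
  | top =>
    refine Subtype.ext (AddSubgroup.ext fun y => ?_)
    rw [WithTop.map_top, actX_coe, mem_scale, topIso_apply, ofTop_top, mem_wholeX, mem_wholeX,
      map_mul, val_unit_inv, one_mul]

end adjoinTop

namespace Fan

variable {D : Type*} [CommRing D] [IsDomain D]
variable {K : Type*} [Field K] [Algebra D K] [IsFractionRing D K]
variable {hP : IsPrufer D K} {q : PrimeSpectrum D}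
variable {ι : Type*} [Finite ι] {pr : ι → PrimeSpectrum D} (F : Fan q pr) (hs : IsSemilocal D)

theorem isModX_loc (F : Fan q pr) {I : AddSubgroup K} (hI : IsModX (ringAt hP q) (valAt hP q) I)
    (i : ι) :
    IsModX (ringAt hP (pr i)) (valAt hP q)
      (locMod (pr i) I fun d => hI.stable _ (algebraMap_mem_ringAt d)) where
  stable t ht y hy M hM := by
    obtain ⟨e, he, h⟩ := hy M hM
    obtain ⟨d, hd, a, h'⟩ := mem_valAt.1 (mem_ringAt.1 ht M hM)
    refine ⟨d * e, fun hde => (M.2.mem_or_mem hde).elim hd he, ?_⟩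
    have : algebraMap D K (d * e) * (t * y) = algebraMap D K a * (algebraMap D K e * y) := by
      rw [← h', map_mul]; ring
    rw [this]
    exact hI.stable _ (algebraMap_mem_ringAt a) _ h
  of_lt y hy M _ := ⟨1, (Ideal.ne_top_iff_one _).1 M.2.ne_top, by
    rw [map_one, one_mul]; exact hI.of_lt y hy⟩
  unit := by
    obtain ⟨y, hy, h⟩ := hI.unit
    exact ⟨y, fun M _ => ⟨1, (Ideal.ne_top_iff_one _).1 M.2.ne_top, by
      rwa [map_one, one_mul]⟩, h⟩
  le_one y hy := by
    obtain ⟨M, hM⟩ := maxAbove_nonempty (pr i)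
    obtain ⟨d, hd, h⟩ := hy M hM
    have := hI.le_one _ h
    rwa [map_mul, val_algebraMap_eq (fun h => hd ((F.lt i).le.trans hM.2 h)), one_mul] at this

theorem stable_loc {I : AddSubgroup K} {i : ι} (hI : IsModX (ringAt hP (pr i)) (valAt hP q) I) :
    ∀ t ∈ ringAt hP q, q ≤ pr i → ∀ y ∈ I, t * y ∈ I :=
  fun t ht h y hy => hI.stable t (ringAt_mono h ht) y hy

theorem isModX_iInf (F : Fan q pr) (hs : IsSemilocal D)
    (J : ∀ i, ModX (ringAt hP (pr i)) (valAt hP q)) :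
    IsModX (ringAt hP q) (valAt hP q) (⨅ i, (J i).1) where
  stable t ht y hy := by
    rw [AddSubgroup.mem_iInf] at *
    exact fun i => stable_loc (J i).2 t ht (F.lt i).le y (hy i)
  of_lt y hy := by
    rw [AddSubgroup.mem_iInf]
    exact fun i => (J i).2.of_lt y hy
  unit := by
    choose y hy h1 using fun i => (J i).2.unit
    obtain ⟨u, hu⟩ := F.exists_approx hs y h1
    obtain ⟨i, hi⟩ := F.cover _ (maxAbove_nonempty q).some_mem
    have h0 : ∀ i, y i ≠ 0 := fun i h => by
      have := h1 i; rw [h, map_zero] at this; simp at this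
    refine ⟨u, ?_, ?_⟩
    · rw [AddSubgroup.mem_iInf]
      intro i
      have : u = u / y i * y i := by rw [div_mul_cancel₀ _ (h0 i)]
      rw [this]
      refine (J i).2.stable _ (mem_ringAt.2 fun M hM => ?_) _ (hy i)
      rw [← ValuationSubring.valuation_le_one_iff, hu i M hM]
    · have := val_one_of_le (maxAbove_nonempty q).some_mem.2 (hu i _
        ⟨(maxAbove_nonempty q).some_mem.1, hi⟩)
      rwa [map_div₀, h1, div_one] at this
  le_one y hy := by
    rw [AddSubgroup.mem_iInf] at hy
    obtain ⟨i, hi⟩ := F.cover _ (maxAbove_nonempty q).some_mem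
    exact (J i).2.le_one y (hy i)

/-- Modules are determined by their localizations at the members of a fan. -/
def locIso : ModX (ringAt hP q) (valAt hP q) ≃o ∀ i, ModX (ringAt hP (pr i)) (valAt hP q) :=
  Equiv.toOrderIso
    { toFun := fun I i => ⟨_, F.isModX_loc I.2 i⟩
      invFun := fun J => ⟨_, F.isModX_iInf hs J⟩
      left_inv := fun I => Subtype.ext (by
        refine le_antisymm (fun y hy => locMod_le hs I.2.stable fun M hM => ?_)
          (le_iInf fun i y hy M _ => ⟨1, (Ideal.ne_top_iff_one _).1 M.2.ne_top, by
            rwa [map_one, one_mul]⟩)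
        obtain ⟨i, hi⟩ := F.cover M hM
        exact (AddSubgroup.mem_iInf.1 hy i) M ⟨hM.1, hi⟩)
      right_inv := fun J => funext fun i => Subtype.ext (by
        classical
        have := Fintype.ofFinite ι
        refine le_antisymm (fun y hy => locMod_le hs (J i).2.stable fun M hM => ?_)
          (fun y hy M hM => ?_)
        · obtain ⟨d, hd, h⟩ := hy M hM
          exact ⟨d, hd, AddSubgroup.mem_iInf.1 h i⟩
        · have : ∀ j, ∃ d ∉ M.asIdeal, algebraMap D K d * y ∈ (J j).1 := by
            intro j
            by_cases hij : i = j
            · subst hij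
              exact ⟨1, (Ideal.ne_top_iff_one _).1 M.2.ne_top, by rwa [map_one, one_mul]⟩
            · obtain ⟨z, hz, h1⟩ := (J j).2.unit
              have h0 : z ≠ 0 := fun h => by rw [h, map_zero] at h1; simp at h1
              obtain ⟨d, hd, h⟩ := F.exists_mul_mem (hP := hP) hs hij hM.2 (x := y / z) (by
                rw [← ValuationSubring.valuation_le_one_iff, map_div₀, h1, div_one]
                exact (J i).2.le_one y hy)
              refine ⟨d, hd, ?_⟩
              have := (J j).2.stable _ h _ hz
              rwa [mul_assoc, div_mul_cancel₀ _ h0] at this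
          choose f hf hf' using this
          refine ⟨∏ j, f j, ?_, AddSubgroup.mem_iInf.2 fun j => ?_⟩
          · rw [M.2.prod_mem_iff]
            rintro ⟨j, -, h⟩
            exact hf j h
          · rw [← Finset.prod_erase_mul _ _ (Finset.mem_univ j), map_mul, mul_assoc]
            exact (J j).2.stable _ (algebraMap_mem_ringAt _) _ (hf' j)) }
    (fun I J h i y hy M hM => by
      obtain ⟨d, hd, h'⟩ := hy M hM
      exact ⟨d, hd, h h'⟩)
    (fun I J h => show (⨅ i, (I i).1) ≤ ⨅ i, (J i).1 from iInf_mono fun i => h i)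

theorem mem_locIso_symm {J : ∀ i, ModX (ringAt hP (pr i)) (valAt hP q)} {y : K} :
    y ∈ ((F.locIso hs).symm J).1 ↔ ∀ i, y ∈ (J i).1 := AddSubgroup.mem_iInf

theorem le_valAt_of_lt (F : Fan q pr) (i : ι) : ∀ t ∈ ringAt hP (pr i), t ∈ valAt hP q :=
  fun _ ht => valAt_mono (F.lt i).le (ringAt_le ht)

/-- The coordinates of a module with respect to a fan. -/
def coords : ModX (ringAt hP q) (valAt hP q) ≃o
    ∀ i, WithTop (ModY (ringAt hP (pr i)) (valAt hP q)) :=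
  (F.locIso hs).trans (piIso fun i => (topIso (F.le_valAt_of_lt i)).symm)

theorem mem_coords_symm {J : ∀ i, WithTop (ModY (ringAt hP (pr i)) (valAt hP q))} {y : K} :
    y ∈ ((F.coords hs).symm J).1 ↔ ∀ i, y ∈ (ofTop (F.le_valAt_of_lt i) (J i)).1 :=
  F.mem_locIso_symm hs

/-- Independent translates can be realized by a single translation. -/
theorem exists_act (γ : ι → (valAt hP q).unitGroup) : ∃ u : (valAt hP q).unitGroup,
    ∀ x, F.coords hs (actX (ringAt hP q) (valAt hP q) u x) =
      piAct (fun i => actY (ringAt hP (pr i)) (valAt hP q)) γ (F.coords hs x) := by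
  obtain ⟨u, hu⟩ := F.exists_approx (hP := hP) hs (fun i => ((γ i : Kˣ) : K))
    (fun i => val_unit (γ i))
  obtain ⟨i, hi⟩ := F.cover _ (maxAbove_nonempty q).some_mem
  have h1 : (valAt hP q).valuation u = 1 := by
    have := val_one_of_le (maxAbove_nonempty q).some_mem.2 (hu i _
      ⟨(maxAbove_nonempty q).some_mem.1, hi⟩)
    rwa [map_div₀, val_unit, div_one] at this
  refine ⟨unitOf u h1, fun x => ?_⟩
  obtain ⟨J, rfl⟩ := (F.coords hs).symm.surjective x
  rw [OrderIso.apply_symm_apply]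
  refine (F.coords hs).symm.injective ?_
  rw [OrderIso.symm_apply_apply]
  refine Subtype.ext (AddSubgroup.ext fun y => ?_)
  rw [mem_coords_symm, actX_coe, mem_scale, mem_coords_symm]
  refine forall_congr' fun i => ?_
  rw [piAct_apply]
  have h2 : ofTop (F.le_valAt_of_lt i) ((J i).map (actY (ringAt hP (pr i)) (valAt hP q) (γ i))) =
    actX (ringAt hP (pr i)) (valAt hP q) (γ i) (ofTop (F.le_valAt_of_lt i) (J i)) :=
    topIso_act _ _ _
  rw [h2, actX_coe, mem_scale]
  set I := ofTop (F.le_valAt_of_lt (hP := hP) i) (J i)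
  have hu0 : u ≠ 0 := fun h => by rw [h, map_zero] at h1; simp at h1
  have hg0 : ((γ i : Kˣ) : K) ≠ 0 := Units.ne_zero _
  have e1 : (((unitOf u h1 : (valAt hP q).unitGroup) : Kˣ)⁻¹ : Kˣ) = (u : K)⁻¹ := by
    rw [Units.val_inv_eq_inv_val, coe_unitOf]
  rw [e1, Units.val_inv_eq_inv_val]
  constructor
  · intro h
    have := I.2.stable (u / ((γ i : Kˣ) : K)) (mem_ringAt.2 fun M hM => by
      rw [← ValuationSubring.valuation_le_one_iff, hu i M hM]) _ h
    convert this using 1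
    field_simp
  · intro h
    have := I.2.stable (((γ i : Kˣ) : K) / u) (mem_ringAt.2 fun M hM => by
      rw [← ValuationSubring.valuation_le_one_iff, ← inv_div, map_inv₀, hu i M hM, inv_one]) _ h
    convert this using 1
    field_simp

theorem act_const (u : (valAt hP q).unitGroup) (x) :
    F.coords hs (actX (ringAt hP q) (valAt hP q) u x) =
      piAct (fun i => actY (ringAt hP (pr i)) (valAt hP q)) (fun _ => u) (F.coords hs x) := by
  obtain ⟨J, rfl⟩ := (F.coords hs).symm.surjective x
  rw [OrderIso.apply_symm_apply]
  refine (F.coords hs).symm.injective ?_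
  rw [OrderIso.symm_apply_apply]
  refine Subtype.ext (AddSubgroup.ext fun y => ?_)
  rw [mem_coords_symm, actX_coe, mem_scale, mem_coords_symm]
  refine forall_congr' fun i => ?_
  rw [piAct_apply]
  have h2 : ofTop (F.le_valAt_of_lt i) ((J i).map (actY (ringAt hP (pr i)) (valAt hP q) u)) =
    actX (ringAt hP (pr i)) (valAt hP q) u (ofTop (F.le_valAt_of_lt i) (J i)) :=
    topIso_act _ _ _
  rw [h2, actX_coe, mem_scale]

/-- The closure operators at a branching prime, in terms of those at the members of the fan. -/
def fanIso : EqClo (actX (ringAt hP q) (valAt hP q)) ≃o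
    Phi fun i => EqClo (actY (ringAt hP (pr i)) (valAt hP q)) :=
  (EqClo.transport (F.coords hs) (F.exists_act hs)
    (fun u => ⟨fun _ => u, F.act_const hs u⟩)).trans
    (prodIso (fun i => (tower hP (F.lt i)).emb (tower hP (F.lt i)).base)
      (fun _ => ⟨1, actY_one⟩) fun i => (tower hP (F.lt i)).arch)

end Fan

section chains

variable {α : Type*} [PartialOrder α] [Finite α]

theorem exists_orderIso_fin (tot : ∀ a b : α, a ≤ b ∨ b ≤ a) :
    Nonempty (α ≃o Fin (Nat.card α)) := by
  classical
  have := Fintype.ofFinite α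
  let L : LinearOrder α := { (inferInstance : PartialOrder α) with
    le_total := tot
    toDecidableLE := Classical.decRel _ }
  exact ⟨(@Fintype.orderIsoFinOfCardEq α L _ _ (Nat.card_eq_fintype_card).symm).symm⟩

/-- A finite chain splits along a lower set. -/
theorem exists_orderIso_lower (tot : ∀ a b : α, a ≤ b ∨ b ≤ a) (S : Set α) (hS : IsLowerSet S) :
    Nat.card S ≤ Nat.card α ∧
    ∃ φ : α ≃o Fin (Nat.card S) ⊕ₗ Fin (Nat.card α - Nat.card S),
      ∀ a, a ∈ S ↔ ∃ n, φ a = Sum.inlₗ n := by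
  classical
  obtain ⟨e₁⟩ := exists_orderIso_fin (α := S) fun a b => tot a b
  obtain ⟨e₂⟩ := exists_orderIso_fin (α := (Sᶜ : Set α)) fun a b => tot a b
  have hcard : Nat.card S + Nat.card (Sᶜ : Set α) = Nat.card α := by
    rw [← Nat.card_sum]
    exact Nat.card_congr (Equiv.Set.sumCompl S)
  have h2 : Nat.card (Sᶜ : Set α) = Nat.card α - Nat.card S := by omega
  refine ⟨by omega, ?_⟩
  rw [← h2]
  let ψ : Fin (Nat.card S) ⊕ₗ Fin (Nat.card (Sᶜ : Set α)) → α := fun x =>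
    Sum.elim (fun i => (e₁.symm i).1) (fun i => (e₂.symm i).1) (ofLex x)
  have hle : ∀ x y, ψ x ≤ ψ y ↔ x ≤ y := by
    intro x y
    induction x using Lex.rec with
    | _ x =>
    induction y using Lex.rec with
    | _ y =>
    rcases x with i | i <;> rcases y with j | j
    · rw [Sum.Lex.inl_le_inl_iff, ← e₁.symm.le_iff_le]; exact Iff.rfl
    · refine iff_of_true ?_ (Sum.Lex.inl_le_inr _ _)
      refine (tot _ _).resolve_right fun h => (e₂.symm j).2 (hS h (e₁.symm i).2)
    · refine iff_of_false (fun h => (e₂.symm i).2 (hS h (e₁.symm j).2)) Sum.Lex.not_inr_le_inl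
    · rw [Sum.Lex.inr_le_inr_iff, ← e₂.symm.le_iff_le]; exact Iff.rfl
  have hsurj : Function.Surjective ψ := by
    intro a
    by_cases h : a ∈ S
    · exact ⟨Sum.inlₗ (e₁ ⟨a, h⟩), congrArg Subtype.val (e₁.symm_apply_apply ⟨a, h⟩)⟩
    · exact ⟨Sum.inrₗ (e₂ ⟨a, h⟩), congrArg Subtype.val (e₂.symm_apply_apply ⟨a, h⟩)⟩
  let Ψ : Fin (Nat.card S) ⊕ₗ Fin (Nat.card (Sᶜ : Set α)) ≃o α :=
    RelIso.mk (Equiv.ofBijective ψ ⟨fun x y h => le_antisymm ((hle x y).1 h.le)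
      ((hle y x).1 h.ge), hsurj⟩) (fun {x y} => hle x y)
  have hS' : ∀ x, Ψ x ∈ S ↔ ∃ n, x = Sum.inlₗ n := by
    intro x
    induction x using Lex.rec with
    | _ x =>
    rcases x with i | i
    · exact iff_of_true (e₁.symm i).2 ⟨i, rfl⟩
    · refine iff_of_false (e₂.symm i).2 ?_
      rintro ⟨n, h⟩
      exact Sum.inr_ne_inl (toLex.injective h)
  refine ⟨Ψ.symm, fun a => ?_⟩
  rw [← hS', OrderIso.apply_symm_apply]

end chains

namespace Tower

variable {K : Type*} [Field K] {T : Subring K} {V U : ValuationSubring K} (H : Tower T V U)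

theorem star_inl (c : {c : EqClo (actX T V) // c.toFun H.base ≠ H.topX}) :
    (H.lexFun (Sum.inlₗ c)).toFun (H.emb H.base) = H.emb H.base ↔ c.1.toFun H.base = H.base := by
  rw [lexFun_inl, ext_emb]
  exact H.emb_injective.eq_iff

theorem not_star_inr (h : ∃ x ∈ V, x ∉ T) (d : EqClo (actY V.toSubring U)) :
    (H.lexFun (Sum.inrₗ d)).toFun (H.emb H.base) ≠ H.emb H.base := by
  obtain ⟨x, hx, hx'⟩ := h
  intro h
  rw [lexFun_inr] at h
  have h1 : (H.embV (d.toFun (H.vspan (H.emb H.base)))).1 = (H.emb H.base).1 := congrArg Subtype.val h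
  have h2 := d.le' (H.vspan (H.emb H.base))
  rw [H.vspan_base] at h1 h2
  have h3 : x ∈ (H.embV (d.toFun H.topV)).1 := h2 (H.mem_topV.2 ((V.valuation_le_one_iff _).2 hx))
  rw [h1] at h3
  exact hx' h3

theorem exists_iso_of_eq (hT : T = V.toSubring) :
    ∃ φ : EqClo (actY T U) ≃o EqClo (actY V.toSubring U),
      ∀ f, f.toFun (H.emb H.base) = H.emb H.base ↔ (φ f).toFun H.topV = H.topV := by
  subst hT
  exact ⟨OrderIso.refl _, fun f => Iff.rfl⟩

theorem isLowerSet_star : IsLowerSet {d : EqClo (actY V.toSubring U) | d.toFun H.topV = H.topV} :=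
  fun _ b hba ha => le_antisymm ((hba _).trans (le_of_eq ha)) (b.le' _)

end Tower

namespace Fan

variable {D : Type*} [CommRing D] [IsDomain D]
variable {K : Type*} [Field K] [Algebra D K] [IsFractionRing D K]
variable {hP : IsPrufer D K} {p q : PrimeSpectrum D}
variable {ι : Type*} [Finite ι] {pr : ι → PrimeSpectrum D} (F : Fan q pr) (hs : IsSemilocal D)

theorem coords_base {B : ModX (ringAt hP q) (valAt hP q)} (hB : ∀ y, y ∈ B.1 ↔ y ∈ ringAt hP q) :
    F.coords hs B = fun i => (((tower hP (F.lt i)).emb (tower hP (F.lt i)).base : ModY _ _) :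
      WithTop (ModY _ _)) := by
  rw [← OrderIso.eq_symm_apply]
  refine Subtype.ext (AddSubgroup.ext fun y => ?_)
  rw [mem_coords_symm, hB]
  constructor
  · exact fun h i => ringAt_mono (F.lt i).le h
  · intro h
    refine mem_ringAt.2 fun M hM => ?_
    obtain ⟨i, hi⟩ := F.cover M hM
    exact mem_ringAt.1 ((tower hP (F.lt i)).mem_base.1 (h i)) M ⟨hM.1, hi⟩

theorem coords_whole {W : ModX (ringAt hP q) (valAt hP q)}
    (hW : ∀ y, y ∈ W.1 ↔ (valAt hP q).valuation y ≤ 1) : F.coords hs W = ⊤ := by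
  rw [← OrderIso.eq_symm_apply]
  refine Subtype.ext (AddSubgroup.ext fun y => ?_)
  rw [mem_coords_symm, hW]
  obtain ⟨i, -⟩ := F.cover _ (maxAbove_nonempty q).some_mem
  constructor
  · exact fun h i => (mem_wholeX (hT := F.le_valAt_of_lt i)).2 h
  · exact fun h => (mem_wholeX (hT := F.le_valAt_of_lt i)).1 (h i)

theorem fanIso_star {B : ModX (ringAt hP q) (valAt hP q)} (hB : ∀ y, y ∈ B.1 ↔ y ∈ ringAt hP q)
    (c : EqClo (actX (ringAt hP q) (valAt hP q))) :
    c.toFun B = B ↔ Phi.Star (fun i => {f | f.toFun ((tower hP (F.lt i)).emb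
      (tower hP (F.lt i)).base) = (tower hP (F.lt i)).emb (tower hP (F.lt i)).base})
      (F.fanIso hs c) := by
  refine Iff.trans ?_ (prodIso_star _ _ _ _)
  rw [← F.coords_base hs hB]
  change _ ↔ (EqClo.toFun (EqClo.transport (F.coords hs) (F.exists_act hs)
    (fun u => ⟨fun _ => u, F.act_const hs u⟩) c) _) = _
  rw [EqClo.transport_apply]
  exact (F.coords hs).injective.eq_iff.symm

theorem fanIso_triv {B : ModX (ringAt hP q) (valAt hP q)} (hB : ∀ y, y ∈ B.1 ↔ y ∈ ringAt hP q)
    {W : ModX (ringAt hP q) (valAt hP q)} (hW : ∀ y, y ∈ W.1 ↔ (valAt hP q).valuation y ≤ 1)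
    (c : EqClo (actX (ringAt hP q) (valAt hP q))) :
    c.toFun B = W ↔ Phi.Triv (F.fanIso hs c) := by
  refine Iff.trans ?_ (prodIso_triv _ _ _ _)
  rw [← F.coords_base hs hB]
  change _ ↔ (EqClo.toFun (EqClo.transport (F.coords hs) (F.exists_act hs)
    (fun u => ⟨fun _ => u, F.act_const hs u⟩) c) _) = _
  rw [EqClo.transport_apply, ← F.coords_whole hs hW]
  exact (F.coords hs).injective.eq_iff.symm

/-- The recursive description of the closure operators at a prime with a fan above it. -/
theorem exists_levelIso (F : Fan q pr) (hs : IsSemilocal D) (h : p < q) :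
    ∃ φ : EqClo (actY (ringAt hP q) (valAt hP p)) ≃o
      {g : Phi (fun i => EqClo (actY (ringAt hP (pr i)) (valAt hP q))) // ¬ Phi.Triv g} ⊕ₗ
        EqClo (actY (valAt hP q).toSubring (valAt hP p)),
      ∀ f, f.toFun ((tower hP h).emb (tower hP h).base) = (tower hP h).emb (tower hP h).base ↔
        ∃ g : {g : Phi (fun i => EqClo (actY (ringAt hP (pr i)) (valAt hP q))) // ¬ Phi.Triv g},
          Phi.Star (fun i => {f | f.toFun ((tower hP (F.lt i)).emb
            (tower hP (F.lt i)).base) = (tower hP (F.lt i)).emb (tower hP (F.lt i)).base}) g.1 ∧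
          φ f = Sum.inlₗ g := by
  set H := tower hP h
  let e : {c : EqClo (actX (ringAt hP q) (valAt hP q)) // c.toFun H.base ≠ H.topX} ≃o
      {g : Phi (fun i => EqClo (actY (ringAt hP (pr i)) (valAt hP q))) // ¬ Phi.Triv g} :=
    { toEquiv := (F.fanIso hs).toEquiv.subtypeEquiv fun c =>
        (F.fanIso_triv hs (fun _ => Iff.rfl) (fun _ => H.mem_topX) c).not
      map_rel_iff' := fun {a b} => (F.fanIso hs).le_iff_le }
  have he : ∀ c, (e c).1 = F.fanIso hs c.1 := fun _ => rfl
  refine ⟨H.lexIso.trans (OrderIso.sumLexCongr e (OrderIso.refl _)), fun f => ?_⟩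
  obtain ⟨x, rfl⟩ := H.lexIso.symm.surjective f
  rw [OrderIso.trans_apply, OrderIso.apply_symm_apply]
  change (H.lexFun x).toFun _ = _ ↔ _
  induction x using Lex.rec with
  | _ x =>
  rcases x with c | d
  · refine (H.star_inl c).trans ((F.fanIso_star hs (fun _ => Iff.rfl) c.1).trans ?_)
    rw [← he]
    constructor
    · exact fun h => ⟨e c, h, rfl⟩
    · rintro ⟨g, hg, h⟩
      have : e c = g := Sum.inl_injective (toLex.injective h)
      rwa [this]
  · refine iff_of_false (H.not_star_inr ?_ d) ?_
    · by_contra! hcon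
      have hmax := isMaximal_of_ringAt (hP := hP) (p := q) hcon
      obtain ⟨i, -⟩ := F.cover _ (maxAbove_nonempty q).some_mem
      exact (F.lt i).ne (PrimeSpectrum.ext (hmax.eq_of_le (pr i).2.ne_top (F.lt i).le))
    · rintro ⟨g, -, h⟩
      exact Sum.inr_ne_inl (toLex.injective h)

end Fan

/-- A presentation of the fraction field of `Z` as the residue field of `U`, in which `Z` is the
image of `V`. -/
structure ResMap {K : Type*} [Field K] (V U : ValuationSubring K) (Z : Type*) [CommRing Z]
    [IsDomain Z] where
  map : U →+* FractionRing Z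
  surj : Function.Surjective map
  zero_iff : ∀ x, map x = 0 ↔ U.valuation x < 1
  range_iff : ∀ x : U, (∃ z, algebraMap Z (FractionRing Z) z = map x) ↔ (x : K) ∈ V

namespace ResMap

variable {K : Type*} [Field K] {V U : ValuationSubring K} {Z : Type*} [CommRing Z] [IsDomain Z]
variable (ρ : ResMap V U Z) (H : Tower V.toSubring V U)

/-- Nonzero fractional ideals. -/
abbrev NzIdeal (Z : Type*) [CommRing Z] [IsDomain Z] : Type _ :=
  {I : FractionalIdeal (nonZeroDivisors Z) (FractionRing Z) // I ≠ 0}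

theorem mem_U {x : K} (h : U.valuation x ≤ 1) : x ∈ U := (U.valuation_le_one_iff x).1 h

theorem val_eq_one_iff (x : U) : U.valuation (x : K) = 1 ↔ ρ.map x ≠ 0 := by
  rw [Ne, ρ.zero_iff, not_lt]
  exact ⟨fun h => h.ge, fun h => le_antisymm ((U.valuation_le_one_iff _).2 x.2) h⟩

theorem exists_unit {l : FractionRing Z} (hl : l ≠ 0) :
    ∃ x : U, U.valuation (x : K) = 1 ∧ ρ.map x = l := by
  obtain ⟨x, rfl⟩ := ρ.surj l
  exact ⟨x, (ρ.val_eq_one_iff x).2 hl, rfl⟩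

/-- The preimage of a fractional ideal. -/
def pull (I : FractionalIdeal (nonZeroDivisors Z) (FractionRing Z)) : AddSubgroup K where
  carrier := {y | ∃ h : y ∈ U, ρ.map ⟨y, h⟩ ∈ I}
  zero_mem' := ⟨U.zero_mem, by
    have : (⟨0, U.zero_mem⟩ : U) = 0 := rfl
    rw [this, map_zero]; exact I.zero_mem⟩
  neg_mem' {y} := by
    rintro ⟨h, hy⟩
    refine ⟨neg_mem h, ?_⟩
    have : (⟨-y, neg_mem h⟩ : U) = -⟨y, h⟩ := rfl
    rw [this, map_neg]
    exact (I : Submodule Z (FractionRing Z)).neg_mem hy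
  add_mem' {y z} := by
    rintro ⟨h, hy⟩ ⟨h', hz⟩
    refine ⟨add_mem h h', ?_⟩
    have : (⟨y + z, add_mem h h'⟩ : U) = ⟨y, h⟩ + ⟨z, h'⟩ := rfl
    rw [this, map_add]
    exact (I : Submodule Z (FractionRing Z)).add_mem hy hz

theorem mem_pull_coe {I : FractionalIdeal (nonZeroDivisors Z) (FractionRing Z)} {y : U} :
    (y : K) ∈ ρ.pull I ↔ ρ.map y ∈ I := ⟨fun h => h.2, fun h => ⟨y.2, h⟩⟩

include H in
theorem isModY_pull (I : NzIdeal Z) : IsModY V.toSubring U (ρ.pull I.1) where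
  stable t ht y hy := by
    obtain ⟨h, hy⟩ := hy
    obtain ⟨z, hz⟩ := (ρ.range_iff ⟨t, H.le' t ht⟩).2 ht
    refine ⟨U.mul_mem _ _ (H.le' t ht) h, ?_⟩
    have : (⟨t * y, U.mul_mem _ _ (H.le' t ht) h⟩ : U) = ⟨t, H.le' t ht⟩ * ⟨y, h⟩ := rfl
    rw [this, map_mul, ← hz, ← Algebra.smul_def]
    exact (I.1 : Submodule Z (FractionRing Z)).smul_mem z hy
  of_lt y hy := ⟨mem_U hy.le, by rw [(ρ.zero_iff _).2 hy]; exact I.1.zero_mem⟩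
  unit := by
    have : ∃ l ∈ I.1, l ≠ 0 := by
      by_contra! hcon
      exact I.2 (FractionalIdeal.eq_zero_iff.2 hcon)
    obtain ⟨l, hl, h0⟩ := this
    obtain ⟨x, hx, rfl⟩ := ρ.exists_unit h0
    exact ⟨x, ρ.mem_pull_coe.2 hl, hx⟩
  le_one y hy := (U.valuation_le_one_iff _).2 hy.1
  missing := by
    by_contra! hcon
    have h1 : ∀ l : FractionRing Z, l ∈ I.1 := by
      intro l
      by_cases h0 : l = 0
      · rw [h0]; exact I.1.zero_mem
      · obtain ⟨x, hx, rfl⟩ := ρ.exists_unit h0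
        exact ρ.mem_pull_coe.1 (hcon x hx)
    obtain ⟨a, ha, h2⟩ := I.1.isFractional
    obtain ⟨z, hz, hz'⟩ := H.lt
    have ha0 : algebraMap Z (FractionRing Z) a ≠ 0 :=
      IsFractionRing.to_map_ne_zero_of_mem_nonZeroDivisors ha
    obtain ⟨w, hw⟩ := h2 (ρ.map ⟨z, hz⟩ / algebraMap Z (FractionRing Z) a) (h1 _)
    refine hz' ((ρ.range_iff ⟨z, hz⟩).1 ⟨w, ?_⟩)
    rw [hw, Algebra.smul_def, mul_div_cancel₀ _ ha0]

theorem push_aux (J : ModY V.toSubring U) : ∃ y : U, ρ.map y ≠ 0 ∧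
    ∀ x ∈ J.1, x / (y : K) ∈ V := by
  obtain ⟨y, h1, hy⟩ := J.2.missing
  refine ⟨⟨y, mem_U h1.le⟩, (ρ.val_eq_one_iff _).1 h1, fun x hx => ?_⟩
  by_contra h
  have h2 := (V.mem_or_inv_mem (x / y)).resolve_left h
  apply hy
  have h3 := J.2.stable _ h2 x hx
  have hx0 : x ≠ 0 := by rintro rfl; rw [zero_div] at h; exact h V.zero_mem
  rwa [inv_div, div_mul_cancel₀ _ hx0] at h3

/-- The image of a module. -/
def push (J : ModY V.toSubring U) : NzIdeal Z :=
  ⟨⟨{ carrier := {l | ∃ x : U, (x : K) ∈ J.1 ∧ ρ.map x = l}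
      zero_mem' := ⟨0, J.1.zero_mem, map_zero _⟩
      add_mem' := by
        rintro _ _ ⟨x, hx, rfl⟩ ⟨y, hy, rfl⟩
        exact ⟨x + y, J.1.add_mem hx hy, map_add _ _ _⟩
      smul_mem' := by
        rintro z _ ⟨x, hx, rfl⟩
        obtain ⟨t, ht⟩ := ρ.surj (algebraMap Z _ z)
        refine ⟨t * x, J.2.stable _ ((ρ.range_iff t).1 ⟨z, ht.symm⟩) _ hx, ?_⟩
        rw [map_mul, ht, Algebra.smul_def] }, by
    obtain ⟨y, hy, h⟩ := ρ.push_aux J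
    obtain ⟨a, b, hb, hab⟩ := IsFractionRing.div_surjective (A := Z) (ρ.map y)⁻¹
    have hb0 : algebraMap Z (FractionRing Z) b ≠ 0 :=
      IsFractionRing.to_map_ne_zero_of_mem_nonZeroDivisors hb
    have ha0 : a ≠ 0 := by
      rintro rfl
      rw [map_zero, zero_div] at hab
      exact inv_ne_zero hy hab.symm
    refine ⟨a, mem_nonZeroDivisors_of_ne_zero ha0, ?_⟩
    rintro _ ⟨x, hx, rfl⟩
    have h1 : U.valuation (y : K) = 1 := (ρ.val_eq_one_iff y).2 hy
    have hy0 : (y : K) ≠ 0 := fun h0 => by rw [h0, map_zero] at h1; simp at h1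
    have hxy : x / (y : K) ∈ U := div_mem_valuationSubring (by rw [h1]; exact J.2.le_one _ hx)
    obtain ⟨w, hw⟩ := (ρ.range_iff ⟨x / (y : K), hxy⟩).2 (h x hx)
    have h2 : (⟨x / (y : K), hxy⟩ : U) * y = x := Subtype.ext (div_mul_cancel₀ _ hy0)
    refine ⟨b * w, ?_⟩
    have h4 : ρ.map x = ρ.map ⟨x / (y : K), hxy⟩ * ρ.map y := by rw [← map_mul, h2]
    have h3 : algebraMap Z (FractionRing Z) a = (ρ.map y)⁻¹ * algebraMap Z (FractionRing Z) b := by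
      rw [← hab, div_mul_cancel₀ _ hb0]
    rw [map_mul, hw, h4, Algebra.smul_def, h3]
    field_simp⟩, by
    intro h0
    obtain ⟨y, hy, h1⟩ := J.2.unit
    have h2 : ρ.map ⟨y, mem_U h1.le⟩ = 0 := (FractionalIdeal.eq_zero_iff.1 h0) _ ⟨_, hy, rfl⟩
    exact (ρ.val_eq_one_iff _).1 h1 h2⟩

theorem map_mem_push {J : ModY V.toSubring U} {x : U} :
    ρ.map x ∈ (ρ.push J).1 ↔ (x : K) ∈ J.1 := by
  refine ⟨?_, fun h => ⟨x, h, rfl⟩⟩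
  rintro ⟨y, hy, h⟩
  have h1 : ρ.map (x - y) = 0 := by rw [map_sub, h, sub_self]
  have h2 := J.2.of_lt _ ((ρ.zero_iff _).1 h1)
  have := J.1.add_mem h2 hy
  simpa using this

/-- Nonzero fractional ideals as modules over `V`. -/
def idealIso : NzIdeal Z ≃o ModY V.toSubring U :=
  Equiv.toOrderIso
    { toFun := fun I => ⟨ρ.pull I.1, ρ.isModY_pull H I⟩
      invFun := ρ.push
      left_inv := fun I => Subtype.ext (FractionalIdeal.ext fun l => by
        obtain ⟨x, rfl⟩ := ρ.surj l
        rw [map_mem_push]; exact ρ.mem_pull_coe)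
      right_inv := fun J => Subtype.ext (AddSubgroup.ext fun y => by
        refine ⟨fun ⟨h, hy⟩ => ρ.map_mem_push.1 hy, fun hy => ?_⟩
        exact ⟨mem_U (J.2.le_one y hy), ρ.map_mem_push.2 hy⟩) }
    (fun _ _ h _ ⟨hy, hy'⟩ => ⟨hy, h hy'⟩)
    (fun _ _ h _ ⟨x, hx, hx'⟩ => ⟨x, h hx, hx'⟩)

theorem mem_idealIso {I : NzIdeal Z} {y : U} : (y : K) ∈ (ρ.idealIso H I).1 ↔ ρ.map y ∈ I.1 :=
  ρ.mem_pull_coe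

theorem ext_of_mem {J J' : ModY V.toSubring U} (h : ∀ y : U, (y : K) ∈ J.1 ↔ (y : K) ∈ J'.1) :
    J = J' :=
  Subtype.ext (AddSubgroup.ext fun y =>
    ⟨fun hy => (h ⟨y, mem_U (J.2.le_one y hy)⟩).1 hy,
      fun hy => (h ⟨y, mem_U (J'.2.le_one y hy)⟩).2 hy⟩)

theorem idealIso_smul (u : U.unitGroup) (I I' : NzIdeal Z) {x : U}
    (hx : (x : K) = ((u : Kˣ) : K))
    (hI : I'.1 = FractionalIdeal.spanSingleton _ (ρ.map x) * I.1) :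
    ρ.idealIso H I' = actY V.toSubring U u (ρ.idealIso H I) := by
  have hx1 : U.valuation (x : K) = 1 := by rw [hx, val_unit]
  have hx0 : ρ.map x ≠ 0 := (ρ.val_eq_one_iff _).1 hx1
  refine ext_of_mem fun y => ?_
  have hxi : (((u : Kˣ)⁻¹ : Kˣ) : K) ∈ U := mem_U (val_unit_inv u).le
  have h1 : ((((u : Kˣ)⁻¹ : Kˣ) : K) * (y : K)) = ((⟨_, hxi⟩ * y : U) : K) := rfl
  have h2 : ρ.map ⟨_, hxi⟩ * ρ.map x = 1 := by
    rw [← map_mul, ← map_one ρ.map]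
    congr 1
    refine Subtype.ext ?_
    change (((u : Kˣ)⁻¹ : Kˣ) : K) * (x : K) = 1
    rw [hx]; simp
  rw [mem_idealIso, actY_coe, mem_scale, h1, mem_idealIso, hI, FractionalIdeal.mem_singleton_mul,
    map_mul]
  constructor
  · rintro ⟨l, hl, h⟩
    rwa [h, ← mul_assoc, h2, one_mul]
  · intro h
    exact ⟨_, h, by rw [← mul_assoc, mul_comm (ρ.map x), h2, one_mul]⟩

theorem exists_unitOf {l : FractionRing Z} (hl : l ≠ 0) :
    ∃ (u : U.unitGroup) (x : U), (x : K) = ((u : Kˣ) : K) ∧ ρ.map x = l := by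
  obtain ⟨x, h1, h⟩ := ρ.exists_unit hl
  exact ⟨unitOf x h1, x, rfl, h⟩

include ρ H in
theorem star_zero (s : AFracStar Z) : s.toFun 0 = 0 := by
  by_contra h0
  obtain ⟨y, h1, hy⟩ := (ρ.idealIso H ⟨_, h0⟩).2.missing
  obtain ⟨z, hz, h2⟩ := (ρ.idealIso H ⟨_, h0⟩).2.unit
  have hz0 : z ≠ 0 := fun h => by rw [h, map_zero] at h2; simp at h2
  have h3 : U.valuation (y / z) = 1 := by rw [map_div₀, h1, h2, div_one]
  have h4 : ρ.map ⟨y / z, mem_U h3.le⟩ ≠ 0 := (ρ.val_eq_one_iff _).1 h3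
  have h5 := s.smul' _ h4 0
  rw [mul_zero] at h5
  have h6 := ρ.idealIso_smul H (unitOf _ h3) ⟨_, h0⟩ ⟨_, h0⟩ (x := ⟨y / z, mem_U h3.le⟩) rfl h5
  apply hy
  rw [h6, actY_coe]
  have := (mul_mem_scale (u := (unitOf _ h3 : U.unitGroup))).2 hz
  rwa [coe_unitOf, div_mul_cancel₀ _ hz0] at this

theorem nz_star (s : AFracStar Z) (I : NzIdeal Z) : s.toFun I.1 ≠ 0 := fun h =>
  I.2 (le_antisymm ((s.le_star' I.1).trans h.le) (FractionalIdeal.zero_le _))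

theorem smul_nz {l : FractionRing Z} (hl : l ≠ 0) (I : NzIdeal Z) :
    FractionalIdeal.spanSingleton (nonZeroDivisors Z) l * I.1 ≠ 0 := fun h =>
  I.2 (FractionalIdeal.eq_zero_iff.2 fun i hi => (mul_eq_zero.1 (FractionalIdeal.eq_zero_iff.1 h
    (l * i) (FractionalIdeal.mem_singleton_mul.2 ⟨i, hi, rfl⟩))).resolve_left hl)

open Classical in
/-- Fractional star operations as equivariant closure operators. -/
def starEquiv : AFracStar Z ≃ EqClo (actY V.toSubring U) where
  toFun s :=
    { toFun := fun J => ρ.idealIso H ⟨s.toFun ((ρ.idealIso H).symm J).1, nz_star s _⟩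
      le' := fun J => by
        rw [← OrderIso.symm_apply_le]
        exact s.le_star' _
      mono' := fun J J' h => (ρ.idealIso H).monotone (s.mono' ((ρ.idealIso H).symm.monotone h))
      idem' := fun J => by
        rw [(ρ.idealIso H).injective.eq_iff]
        refine Subtype.ext ?_
        simp only [OrderIso.symm_apply_apply, s.idem']
      equiv' := fun u J => by
        have hu : U.valuation ((u : Kˣ) : K) = 1 := val_unit u
        have h0 := (ρ.val_eq_one_iff ⟨_, mem_U hu.le⟩).1 hu
        have h1 : (ρ.idealIso H).symm (actY V.toSubring U u J) =
            ⟨_, smul_nz h0 ((ρ.idealIso H).symm J)⟩ := by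
          rw [OrderIso.symm_apply_eq]
          rw [ρ.idealIso_smul H u ((ρ.idealIso H).symm J) ⟨_, smul_nz h0 _⟩
            (x := ⟨_, mem_U hu.le⟩) rfl rfl, OrderIso.apply_symm_apply]
        refine ρ.idealIso_smul H u _ _ (x := ⟨_, mem_U hu.le⟩) rfl ?_
        simp only [h1]
        exact s.smul' _ h0 _ }
  invFun c :=
    { toFun := fun I => if h : I = 0 then 0 else
        ((ρ.idealIso H).symm (c.toFun (ρ.idealIso H ⟨I, h⟩))).1
      le_star' := fun I => by
        split_ifs with h
        · exact h.le
        · exact (OrderIso.le_symm_apply _).2 (c.le' (ρ.idealIso H ⟨I, h⟩))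
      mono' := fun I J hIJ => by
        split_ifs with h h' h'
        · exact le_rfl
        · exact FractionalIdeal.zero_le _
        · exact absurd (le_antisymm (hIJ.trans h'.le) (FractionalIdeal.zero_le _)) h
        · exact (ρ.idealIso H).symm.monotone (c.mono' ((ρ.idealIso H).monotone hIJ))
      idem' := fun I => by
        by_cases h : I = 0
        · simp [h]
        · have h1 := ((ρ.idealIso H).symm (c.toFun (ρ.idealIso H ⟨I, h⟩))).2
          rw [dif_neg h, dif_neg h1]
          simp [c.idem']
      smul' := fun l hl I => by
        by_cases h : I = 0
        · simp [h]
        · have h1 := smul_nz hl ⟨I, h⟩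
          rw [dif_neg h, dif_neg h1]
          obtain ⟨u, x, hx, rfl⟩ := ρ.exists_unitOf hl
          rw [ρ.idealIso_smul H u ⟨I, h⟩ ⟨_, h1⟩ hx rfl, c.equiv']
          have h2 := ρ.idealIso_smul H u ((ρ.idealIso H).symm (c.toFun (ρ.idealIso H ⟨I, h⟩)))
            ⟨_, smul_nz hl _⟩ hx rfl
          rw [OrderIso.apply_symm_apply] at h2
          rw [← h2, OrderIso.symm_apply_apply] }
  left_inv s := AFracStar.ext' (funext fun I => by
    by_cases h : I = 0
    · simp [h, ρ.star_zero H s]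
    · simp [h])
  right_inv c := EqClo.ext' fun J => by
    have h : ((ρ.idealIso H).symm J).1 ≠ 0 := ((ρ.idealIso H).symm J).2
    simp [h]

theorem starEquiv_star (s : AFracStar Z) :
    s.toFun 1 = 1 ↔ (ρ.starEquiv H s).toFun H.topV = H.topV := by
  have h : H.topV = ρ.idealIso H ⟨1, one_ne_zero⟩ := by
    refine ext_of_mem fun y => ?_
    rw [mem_idealIso, H.mem_topV, FractionalIdeal.mem_one_iff, ρ.range_iff,
      ValuationSubring.valuation_le_one_iff]
  change _ ↔ ρ.idealIso H _ = _
  rw [h, (ρ.idealIso H).injective.eq_iff, Subtype.ext_iff]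
  simp only [OrderIso.symm_apply_apply]

end ResMap

section Extend

variable {D : Type*} [CommRing D] [IsDomain D]
variable {K : Type*} [Field K] [Algebra D K] [IsFractionRing D K]
variable {hP : IsPrufer D K} {p q : PrimeSpectrum D} {L : Type*} [Field L] {G : D →+* L}

theorem exists_ext_val (hG : ∀ d, G d = 0 ↔ d ∈ q.asIdeal) (x : valAt hP q) :
    ∃ l : L, ∀ d ∉ q.asIdeal, ∀ a, algebraMap D K d * x = algebraMap D K a → l * G d = G a := by
  obtain ⟨d, hd, a, h⟩ := mem_valAt.1 x.2
  have h0 : G d ≠ 0 := fun h => hd ((hG d).1 h)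
  refine ⟨G a / G d, fun d' hd' a' h' => ?_⟩
  have h1 : a * d' = d * a' := by
    apply FaithfulSMul.algebraMap_injective D K
    rw [map_mul, map_mul, ← h, ← h']; ring
  have h2 := congrArg G h1
  rw [map_mul, map_mul] at h2
  rw [div_mul_eq_mul_div, h2, mul_comm, mul_div_cancel_right₀ _ h0]

/-- The extension to the localization at `q` of a ring homomorphism with kernel `q`. -/
def extMap (hG : ∀ d, G d = 0 ↔ d ∈ q.asIdeal) : valAt hP q →+* L where
  toFun x := (exists_ext_val hG x).choose
  map_one' := by
    have := (exists_ext_val (hP := hP) hG 1).choose_spec 1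
      ((Ideal.ne_top_iff_one _).1 q.2.ne_top) 1 (by simp)
    simpa using this
  map_zero' := by
    have := (exists_ext_val (hP := hP) hG 0).choose_spec 1
      ((Ideal.ne_top_iff_one _).1 q.2.ne_top) 0 (by simp)
    simpa using this
  map_mul' x y := by
    obtain ⟨d, hd, a, h⟩ := mem_valAt.1 x.2
    obtain ⟨d', hd', a', h'⟩ := mem_valAt.1 y.2
    have h0 : G d ≠ 0 := fun h => hd ((hG d).1 h)
    have h0' : G d' ≠ 0 := fun h => hd' ((hG d').1 h)
    have h1 := (exists_ext_val hG x).choose_spec d hd a h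
    have h2 := (exists_ext_val hG y).choose_spec d' hd' a' h'
    have h3 := (exists_ext_val hG (x * y)).choose_spec (d * d') (q.2.mul_notMem hd hd') (a * a')
      (by rw [map_mul, map_mul, ← h, ← h', Subring.coe_mul]; ring)
    rw [map_mul, map_mul, ← h1, ← h2] at h3
    apply mul_right_cancel₀ (mul_ne_zero h0 h0')
    rw [h3]; ring
  map_add' x y := by
    obtain ⟨d, hd, a, h⟩ := mem_valAt.1 x.2
    obtain ⟨d', hd', a', h'⟩ := mem_valAt.1 y.2
    have h0 : G d ≠ 0 := fun h => hd ((hG d).1 h)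
    have h0' : G d' ≠ 0 := fun h => hd' ((hG d').1 h)
    have h1 := (exists_ext_val hG x).choose_spec d hd a h
    have h2 := (exists_ext_val hG y).choose_spec d' hd' a' h'
    have h3 := (exists_ext_val hG (x + y)).choose_spec (d * d') (q.2.mul_notMem hd hd')
      (a * d' + d * a')
      (by rw [map_mul, map_add, map_mul, map_mul, ← h, ← h', Subring.coe_add]; ring)
    rw [map_mul, map_add, map_mul, map_mul, ← h1, ← h2] at h3
    apply mul_right_cancel₀ (mul_ne_zero h0 h0')
    rw [h3]; ring

theorem extMap_mul (hG : ∀ d, G d = 0 ↔ d ∈ q.asIdeal) (x : valAt hP q) {d a : D}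
    (hd : d ∉ q.asIdeal) (h : algebraMap D K d * x = algebraMap D K a) :
    extMap hG x * G d = G a := (exists_ext_val hG x).choose_spec d hd a h

theorem extMap_eq_zero (hG : ∀ d, G d = 0 ↔ d ∈ q.asIdeal) (x : valAt hP q) :
    extMap hG x = 0 ↔ (valAt hP q).valuation x < 1 := by
  obtain ⟨d, hd, a, h⟩ := mem_valAt.1 x.2
  have h0 : G d ≠ 0 := fun h => hd ((hG d).1 h)
  have h1 := extMap_mul hG x hd h
  have h2 : (valAt hP q).valuation (x : K) = (valAt hP q).valuation (algebraMap D K a) := by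
    rw [← h, map_mul, val_algebraMap_eq hd, one_mul]
  rw [h2, val_algebraMap_lt, ← hG, ← h1, mul_eq_zero, or_iff_left h0]

end Extend

section Res

variable {D : Type*} [CommRing D] [IsDomain D]
variable {K : Type*} [Field K] [Algebra D K] [IsFractionRing D K]
variable (hP : IsPrufer D K) {p q : PrimeSpectrum D}
variable {Z : Type*} [CommRing Z] [IsDomain Z] {g : D →+* Z}

theorem compFrac_eq_zero (hg : ∀ d, g d = 0 ↔ d ∈ q.asIdeal) (d : D) :
    ((algebraMap Z (FractionRing Z)).comp g) d = 0 ↔ d ∈ q.asIdeal := by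
  rw [RingHom.comp_apply, FaithfulSMul.algebraMap_eq_zero_iff, hg]

/-- The residue map of a ring of fractions of a quotient. -/
def resMapOf (hqp : q ≤ p) (hg : ∀ d, g d = 0 ↔ d ∈ q.asIdeal)
    (hu : ∀ d ∉ p.asIdeal, IsUnit (g d))
    (hsurj : ∀ z, ∃ d ∉ p.asIdeal, ∃ a, g d * z = g a) : ResMap (valAt hP p) (valAt hP q) Z where
  map := extMap (compFrac_eq_zero hg)
  surj l := by
    obtain ⟨z, w, hw, rfl⟩ := IsFractionRing.div_surjective (A := Z) l
    have hw0 : w ≠ 0 := nonZeroDivisors.ne_zero hw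
    obtain ⟨d, hd, a, h⟩ := hsurj z
    obtain ⟨d', hd', a', h'⟩ := hsurj w
    have ha' : a' ∉ q.asIdeal := fun hh => by
      rw [← hg, ← h', mul_eq_zero] at hh
      exact hw0 (hh.resolve_left (hu _ hd').ne_zero)
    have hdq : d ∉ q.asIdeal := fun hh => hd (hqp hh)
    have hda : d * a' ∉ q.asIdeal := q.2.mul_notMem hdq ha'
    have h0 : algebraMap D K (d * a') ≠ 0 := algebraMap_ne_zero_of_notMem hda
    have hx : algebraMap D K (d * a') * (algebraMap D K (a * d') / algebraMap D K (d * a')) =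
        algebraMap D K (a * d') := mul_div_cancel₀ _ h0
    refine ⟨⟨_, mem_valAt.2 ⟨_, hda, _, hx⟩⟩, ?_⟩
    have h1 := extMap_mul (hP := hP) (compFrac_eq_zero hg) ⟨_, mem_valAt.2 ⟨_, hda, _, hx⟩⟩ hda hx
    have h2 : ((algebraMap Z (FractionRing Z)).comp g) (d * a') ≠ 0 := fun hh =>
      hda ((compFrac_eq_zero hg _).1 hh)
    apply mul_right_cancel₀ h2
    rw [h1]
    have hw1 : algebraMap Z (FractionRing Z) w ≠ 0 := by
      rwa [Ne, FaithfulSMul.algebraMap_eq_zero_iff]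
    rw [div_mul_eq_mul_div, eq_div_iff hw1]
    simp only [RingHom.comp_apply, map_mul, ← h, ← h']
    ring
  zero_iff x := extMap_eq_zero _ x
  range_iff x := by
    constructor
    · rintro ⟨z, hz⟩
      obtain ⟨d, hd, a, h⟩ := hsurj z
      have hdq : d ∉ q.asIdeal := fun hh => hd (hqp hh)
      have h0 : algebraMap D K d ≠ 0 := algebraMap_ne_zero_of_notMem hd
      have hy : algebraMap D K d * (algebraMap D K a / algebraMap D K d) = algebraMap D K a :=
        mul_div_cancel₀ _ h0
      have hyp : algebraMap D K a / algebraMap D K d ∈ valAt hP p := mem_valAt.2 ⟨_, hd, _, hy⟩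
      let y : valAt hP q := ⟨_, valAt_mono hqp hyp⟩
      have h1 := extMap_mul (compFrac_eq_zero hg) y hdq hy
      have h2 : ((algebraMap Z (FractionRing Z)).comp g) d ≠ 0 := fun hh =>
        hdq ((compFrac_eq_zero hg _).1 hh)
      have h3 : extMap (compFrac_eq_zero hg) (x - y) = 0 := by
        rw [map_sub, sub_eq_zero]
        apply mul_right_cancel₀ h2
        rw [h1, ← hz, RingHom.comp_apply, RingHom.comp_apply, ← h, map_mul, mul_comm]
      have h4 := val_lt_of_le hqp ((extMap_eq_zero _ _).1 h3)
      have h5 := (valAt hP p).add_mem _ _ (((valAt hP p).valuation_le_one_iff _).1 h4.le) hyp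
      simpa [y] using h5
    · intro hx
      obtain ⟨d, hd, a, h⟩ := mem_valAt.1 hx
      have hdq : d ∉ q.asIdeal := fun hh => hd (hqp hh)
      have h1 := extMap_mul (compFrac_eq_zero hg) x hdq h
      obtain ⟨v, hv⟩ := (hu d hd).exists_right_inv
      refine ⟨g a * v, ?_⟩
      have h2 : ((algebraMap Z (FractionRing Z)).comp g) d ≠ 0 := fun hh =>
        hdq ((compFrac_eq_zero hg _).1 hh)
      apply mul_right_cancel₀ h2
      rw [h1, RingHom.comp_apply, RingHom.comp_apply, ← map_mul, mul_assoc, mul_comm v, hv, mul_one]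

theorem exists_starEquiv (h : q < p) (hg : ∀ d, g d = 0 ↔ d ∈ q.asIdeal)
    (hu : ∀ d ∉ p.asIdeal, IsUnit (g d))
    (hsurj : ∀ z, ∃ d ∉ p.asIdeal, ∃ a, g d * z = g a) :
    ∃ φ : AFracStar Z ≃ EqClo (actY (valAt hP p).toSubring (valAt hP q)),
      ∀ s, s.toFun 1 = 1 ↔ (φ s).toFun (tower hP h).topV = (tower hP h).topV := by
  have H : Tower (valAt hP p).toSubring (valAt hP p) (valAt hP q) := (tower hP h).toV
  exact ⟨(resMapOf hP h.le hg hu hsurj).starEquiv H,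
    fun s => (resMapOf hP h.le hg hu hsurj).starEquiv_star H s⟩

theorem omegaAt_eq (h : q < p) : omegaAt D p.asIdeal q.asIdeal p.2 =
    Nat.card (EqClo (actY (valAt hP p).toSubring (valAt hP q))) := by
  have hle : q.asIdeal ≤ p.asIdeal := h.le
  have hdis : Disjoint (p.asIdeal.primeCompl : Set D) (q.asIdeal : Set D) :=
    Set.disjoint_left.2 fun x hx hx' => hx (hle hx')
  have hpr : (Ideal.map (algebraMap D (locRing D p.asIdeal p.2)) q.asIdeal).IsPrime :=
    IsLocalization.isPrime_of_isPrime_disjoint p.asIdeal.primeCompl _ _ q.2 hdis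
  have : IsDomain (Zring D p.asIdeal q.asIdeal p.2) := (Ideal.Quotient.isDomain_iff_prime _).2 hpr
  obtain ⟨φ, -⟩ := exists_starEquiv hP h (Z := Zring D p.asIdeal q.asIdeal p.2)
    (g := (Ideal.Quotient.mk _).comp (algebraMap D (locRing D p.asIdeal p.2)))
    (fun d => by
      rw [RingHom.comp_apply, Ideal.Quotient.eq_zero_iff_mem]
      exact SetLike.ext_iff.1 (IsLocalization.under_map_of_isPrime_disjoint p.asIdeal.primeCompl
        (locRing D p.asIdeal p.2) q.2 hdis) d)
    (fun d hd => by
      rw [RingHom.comp_apply]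
      exact (IsLocalization.map_units (locRing D p.asIdeal p.2)
        (⟨d, hd⟩ : p.asIdeal.primeCompl)).map _)
    (fun z => by
      obtain ⟨z, rfl⟩ := Ideal.Quotient.mk_surjective z
      obtain ⟨⟨a, d⟩, h⟩ := IsLocalization.surj p.asIdeal.primeCompl z
      refine ⟨d, d.2, a, ?_⟩
      rw [RingHom.comp_apply, RingHom.comp_apply, ← map_mul, ← h, mul_comm])
  exact Nat.card_congr φ

end Res

section

namespace Phi

variable {ι : Type*} {F : ι → Type*} [∀ i, PartialOrder (F i)]

open Classical in
/-- The element of the model given by a family of constants. -/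
def const (f : ∀ i, F i) : Phi F where
  toFun S i := if i ∈ S then (f i : WithTop (F i)) else ⊤
  anti S S' h i := by
    by_cases hi : i ∈ S
    · simp [hi, h hi]
    · simp [hi]
  supp_sub S i hi := by
    by_contra h
    exact hi (if_neg h)
  idem S := by
    ext i
    by_cases hi : i ∈ S <;> simp [suppT, hi]

theorem const_univ (f : ∀ i, F i) (i : ι) : (const f).toFun Set.univ i = f i :=
  if_pos (Set.mem_univ i)

theorem star_const {St : ∀ i, Set (F i)} {f : ∀ i, F i} (h : ∀ i, f i ∈ St i) :
    (const f).Star St := fun i => ⟨f i, h i, const_univ f i⟩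

theorem not_triv_const [Nonempty ι] (f : ∀ i, F i) : ¬ (const f).Triv := fun h => by
  have := h (Classical.arbitrary ι)
  rw [const_univ] at this
  exact WithTop.coe_ne_top this

theorem card_star_unit {F : Type*} [PartialOrder F] (St : Set F) :
    Nat.card {g : Phi (fun _ : Unit => F) // Star (fun _ => St) g} = Nat.card St := by
  symm
  refine Nat.card_eq_of_bijective (fun f => ⟨const fun _ => f.1, star_const fun _ => f.2⟩) ⟨?_, ?_⟩
  · intro f f' h
    have h1 := congrArg (fun g => g.1.toFun Set.univ ()) h
    simp only [const_univ] at h1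
    exact Subtype.ext (WithTop.coe_injective h1)
  · rintro ⟨g, hg⟩
    obtain ⟨f, hf, h⟩ := hg ()
    refine ⟨⟨f, hf⟩, Subtype.ext (ext' fun S i => ?_)⟩
    cases i
    by_cases hS : () ∈ S
    · have : S = Set.univ := Set.eq_univ_of_forall fun _ => hS
      subst this
      rw [h]; exact const_univ _ _
    · have h1 : g.toFun S () = ⊤ := by
        by_contra h2
        exact hS (g.supp_sub S h2)
      rw [h1]; exact if_neg hS

end Phi

namespace Tower

variable {K : Type*} [Field K] {V U : ValuationSubring K} (H : Tower V.toSubring V U)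

/-- The poset of modules with top as a function on a one-element type. -/
def unitIso : ModX V.toSubring U ≃o (Unit → WithTop (ModY V.toSubring U)) :=
  (topIso H.le').symm.trans (OrderIso.funUnique Unit _).symm

theorem unitIso_act (u : U.unitGroup) (x) : H.unitIso (actX V.toSubring U u x) =
    piAct (fun _ => actY V.toSubring U) (fun _ => u) (H.unitIso x) := by
  obtain ⟨w, rfl⟩ := (topIso H.le').surjective x
  rw [← topIso_act]
  funext i
  simp [unitIso]
  rfl

theorem unitIso_topV : H.unitIso ⟨H.topV.1, H.topV.2.toIsModX⟩ =
    fun _ => (H.topV : WithTop (ModY V.toSubring U)) := by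
  have : (⟨H.topV.1, H.topV.2.toIsModX⟩ : ModX V.toSubring U) =
    topIso H.le' (H.topV : WithTop (ModY V.toSubring U)) := rfl
  rw [this]
  funext i
  simp [unitIso]

theorem card_star_eq : Nat.card {c : EqClo (actX V.toSubring U) //
      c.toFun ⟨H.topV.1, H.topV.2.toIsModX⟩ = ⟨H.topV.1, H.topV.2.toIsModX⟩} =
    Nat.card {d : EqClo (actY V.toSubring U) | d.toFun H.topV = H.topV} := by
  have t1 : ∀ g' : Unit → U.unitGroup, ∃ g, ∀ x, H.unitIso (actX V.toSubring U g x) =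
      piAct (fun _ => actY V.toSubring U) g' (H.unitIso x) := fun g' => ⟨g' (), H.unitIso_act _⟩
  have t2 : ∀ g, ∃ g' : Unit → U.unitGroup, ∀ x, H.unitIso (actX V.toSubring U g x) =
      piAct (fun _ => actY V.toSubring U) g' (H.unitIso x) := fun g => ⟨_, H.unitIso_act g⟩
  rw [← Phi.card_star_unit]
  refine Nat.card_congr (((EqClo.transport H.unitIso t1 t2).trans
    (prodIso (fun _ => H.topV) (fun _ => ⟨1, actY_one⟩) fun _ => H.arch)).toEquiv.subtypeEquiv
      fun c => ?_)
  refine Iff.trans ?_ (prodIso_star (fun _ => H.topV) (fun _ => ⟨1, actY_one⟩) (fun _ => H.arch) _)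
  rw [← H.unitIso_topV]
  change _ ↔ (EqClo.toFun (EqClo.transport H.unitIso t1 t2 c) _) = _
  rw [EqClo.transport_apply]
  exact H.unitIso.injective.eq_iff.symm

/-- Passing to a coarser valuation ring does not change the number of star operations. -/
theorem card_star_coarsen {W : ValuationSubring K} (H' : Tower W.toSubring W V)
    (H'' : Tower W.toSubring V U) (H0 : Tower W.toSubring W U) :
    Nat.card {d : EqClo (actY W.toSubring U) | d.toFun H0.topV = H0.topV} =
      Nat.card {d : EqClo (actY W.toSubring V) | d.toFun H'.topV = H'.topV} := by
  rw [← H'.card_star_eq]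
  have hb : H''.base = ⟨H'.topV.1, H'.topV.2.toIsModX⟩ := rfl
  have ht : H0.topV = H''.emb H''.base := rfl
  have hne : H''.base ≠ H''.topX := fun h => by
    obtain ⟨z, hz, hz'⟩ := H'.lt
    exact hz' (H''.mem_base.1 (h ▸ H''.mem_topX.2 ((V.valuation_le_one_iff z).2 hz)))
  symm
  refine Nat.card_eq_of_bijective (fun c => ⟨H''.lexFun (Sum.inlₗ ⟨c.1, fun h => hne
    (c.2.symm.trans h)⟩), (H''.star_inl _).2 c.2⟩) ⟨?_, ?_⟩
  · intro c c' h
    have h1 := H''.lexIso.symm.injective (a₁ := Sum.inlₗ ⟨c.1, fun h => hne (c.2.symm.trans h)⟩)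
      (a₂ := Sum.inlₗ ⟨c'.1, fun h => hne (c'.2.symm.trans h)⟩) (Subtype.ext_iff.1 h)
    have h2 := Sum.inl_injective (toLex.injective h1)
    exact Subtype.ext (Subtype.ext_iff.1 h2 :)
  · rintro ⟨d, hd⟩
    obtain ⟨x, rfl⟩ := H''.lexFun_surjective d
    induction x using Lex.rec with
    | _ x =>
    rcases x with c | c
    · exact ⟨⟨c.1, (H''.star_inl c).1 hd⟩, rfl⟩
    · refine absurd hd (H''.not_star_inr ?_ c)
      obtain ⟨z, hz, hz'⟩ := H'.lt
      exact ⟨z, hz, hz'⟩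

end Tower

variable {D : Type*} [CommRing D] [IsDomain D]
variable {K : Type*} [Field K] [Algebra D K] [IsFractionRing D K]

theorem epsilonOf_eq (hP : IsPrufer D K) {p q : PrimeSpectrum D} (h : q < p) :
    epsilonOf D p.asIdeal = Nat.card {d : EqClo (actY (valAt hP p).toSubring (valAt hP q)) |
      d.toFun (tower hP h).topV = (tower hP h).topV} := by
  let o : PrimeSpectrum D := ⟨⊥, Ideal.isPrime_bot⟩
  have ho : ∀ r : PrimeSpectrum D, o ≤ r := fun r => (bot_le : (⊥ : Ideal D) ≤ r.asIdeal)
  have key : ∀ h0 : o < p, epsilonOf D p.asIdeal =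
      Nat.card {d : EqClo (actY (valAt hP p).toSubring (valAt hP o)) |
      d.toFun (tower hP h0).topV = (tower hP h0).topV} := by
    intro h0
    rw [epsilonOf, dif_pos p.2]
    have := IsLocalization.isDomain_localization p.asIdeal.primeCompl_le_nonZeroDivisors
    have hinj := IsLocalization.injective (locRing D p.asIdeal p.2)
      p.asIdeal.primeCompl_le_nonZeroDivisors
    obtain ⟨φ, hφ⟩ := exists_starEquiv hP h0 (Z := locRing D p.asIdeal p.2)
      (g := algebraMap D (locRing D p.asIdeal p.2))
      (fun d => by rw [map_eq_zero_iff _ hinj]; exact Iff.rfl)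
      (fun d hd => IsLocalization.map_units (locRing D p.asIdeal p.2)
        (⟨d, hd⟩ : p.asIdeal.primeCompl))
      (fun z => by
        obtain ⟨⟨a, d⟩, h⟩ := IsLocalization.surj p.asIdeal.primeCompl z
        exact ⟨d, d.2, a, by rw [← h, mul_comm]⟩)
    exact Nat.card_congr (φ.subtypeEquiv hφ)
  rcases (ho q).eq_or_lt with rfl | hq
  · exact key h
  · rw [key (hq.trans h)]
    exact Tower.card_star_coarsen (tower hP h).toV
      { le := fun _ hx => valAt_mono h.le hx
        of_lt := fun y hy => ((valAt hP p).valuation_le_one_iff y).1 (val_lt_of_le h.le hy).le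
        le' := (tower hP hq).le'
        lt := (tower hP hq).lt } (tower hP (hq.trans h)).toV

end

section

variable {D : Type*} [CommRing D] [IsDomain D]

/-- The largest prime below two given primes. -/
theorem exists_meet (K : Type*) [Field K] [Algebra D K] [IsFractionRing D K] (hP : IsPrufer D K)
    (p q : PrimeSpectrum D) : ∃ m : PrimeSpectrum D, m ≤ p ∧ m ≤ q ∧
      ∀ r : PrimeSpectrum D, r ≤ p → r ≤ q → r ≤ m := by
  have tot : ∀ r r' : PrimeSpectrum D, r ≤ p → r' ≤ p → r ≤ r' ∨ r' ≤ r :=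
    fun r r' h h' => prime_chain K hP h h'
  let o : PrimeSpectrum D := ⟨⊥, Ideal.isPrime_bot⟩
  have ho : ∀ r : PrimeSpectrum D, o ≤ r := fun r => (bot_le : (⊥ : Ideal D) ≤ r.asIdeal)
  let m : Ideal D :=
    { carrier := {x | ∃ r : PrimeSpectrum D, r ≤ p ∧ r ≤ q ∧ x ∈ r.asIdeal}
      zero_mem' := ⟨o, ho p, ho q, o.asIdeal.zero_mem⟩
      add_mem' := by
        rintro x y ⟨r, h1, h2, h3⟩ ⟨r', h1', h2', h3'⟩
        rcases tot r r' h1 h1' with h | h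
        · exact ⟨r', h1', h2', r'.asIdeal.add_mem (h h3) h3'⟩
        · exact ⟨r, h1, h2, r.asIdeal.add_mem h3 (h h3')⟩
      smul_mem' := by
        rintro a x ⟨r, h1, h2, h3⟩
        exact ⟨r, h1, h2, r.asIdeal.mul_mem_left a h3⟩ }
  have hm : m.IsPrime :=
    { ne_top' := by
        rw [Ideal.ne_top_iff_one]
        rintro ⟨r, -, -, h⟩
        exact (Ideal.ne_top_iff_one _).1 r.2.ne_top h
      mem_or_mem' := by
        rintro x y ⟨r, h1, h2, h3⟩
        exact (r.2.mem_or_mem h3).imp (fun h => ⟨r, h1, h2, h⟩) fun h => ⟨r, h1, h2, h⟩ }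
  refine ⟨⟨m, hm⟩, ?_, ?_, fun r h1 h2 x hx => ⟨r, h1, h2, hx⟩⟩
  · rintro x ⟨r, h, -, hx⟩
    exact h hx
  · rintro x ⟨r, -, h, hx⟩
    exact h hx

theorem isBranchPoint_meet {p q m : PrimeSpectrum D} (h1 : ¬ p ≤ q) (h2 : ¬ q ≤ p) (hp : m ≤ p)
    (hq : m ≤ q) (hm : ∀ r : PrimeSpectrum D, r ≤ p → r ≤ q → r ≤ m) :
    IsBranchPoint D m.asIdeal := by
  refine ⟨{p.asIdeal, q.asIdeal}, ?_, ?_, ?_, ?_, ?_⟩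
  · rintro _ (rfl | rfl)
    exacts [p.2, q.2]
  · rintro _ (rfl | rfl) _ (rfl | rfl) hne
    exacts [absurd rfl hne, ⟨h1, h2⟩, ⟨h2, h1⟩, absurd rfl hne]
  · rintro (h | h)
    · exact h1 (PrimeSpectrum.ext h ▸ hq)
    · exact h2 (PrimeSpectrum.ext h ▸ hp)
  · rintro _ (rfl | rfl)
    exacts [hp, hq]
  · exact fun P' hP' h => hm ⟨P', hP'⟩ (h _ (Or.inl rfl)) (h _ (Or.inr rfl))

section Tree

variable {P : Type*} [PartialOrder P] (e : ↥(hiSpec D) ≃o P)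

/-- The prime corresponding to a vertex. -/
def vtx (y : P) : PrimeSpectrum D := ⟨(e.symm y).1, (e.symm y).2.1⟩

theorem vtx_le_vtx {y z : P} : vtx e y ≤ vtx e z ↔ y ≤ z := e.symm.le_iff_le

theorem vtx_lt_vtx {y z : P} : vtx e y < vtx e z ↔ y < z := by
  rw [lt_iff_le_not_ge, lt_iff_le_not_ge, vtx_le_vtx, vtx_le_vtx]

theorem exists_vtx {p : PrimeSpectrum D} (h : p.asIdeal ∈ hiSpec D) : ∃ y, vtx e y = p :=
  ⟨e ⟨p.asIdeal, h⟩, PrimeSpectrum.ext (by simp [vtx])⟩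

theorem vtx_mem (y : P) : (vtx e y).asIdeal ∈ hiSpec D := (e.symm y).2

theorem isMaximal_vtx {y : P} : (vtx e y).asIdeal.IsMaximal ↔ IsMax y := by
  constructor
  · intro h z hz
    exact (vtx_le_vtx e).1 (h.eq_of_le (vtx e z).2.ne_top ((vtx_le_vtx e).2 hz)).ge
  · intro h
    obtain ⟨M, hM, hle⟩ := (maxAbove_nonempty (vtx e y))
    obtain ⟨z, rfl⟩ := exists_vtx e (maximal_mem_hiSpec hM)
    rwa [h.eq_of_le ((vtx_le_vtx e).1 hle)]

theorem directlyBelow_vtx {y z : P} :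
    DirectlyBelow D (vtx e y).asIdeal (vtx e z).asIdeal ↔ y ⋖ z := by
  constructor
  · rintro ⟨-, -, h, h'⟩
    exact ⟨(vtx_lt_vtx e).1 h, fun w hw hw' => h' _ (vtx_mem e w) ((vtx_lt_vtx e).2 hw)
      ((vtx_lt_vtx e).2 hw')⟩
  · intro h
    refine ⟨vtx_mem e y, vtx_mem e z, (vtx_lt_vtx e).2 h.1, fun R hR h1 h2 => ?_⟩
    obtain ⟨w, hw⟩ := exists_vtx (p := ⟨R, hR.1⟩) e hR
    have hw' := congrArg PrimeSpectrum.asIdeal hw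
    dsimp only at hw'
    rw [← hw'] at h1 h2
    exact h.2 ((vtx_lt_vtx e).1 h1) ((vtx_lt_vtx e).1 h2)

theorem fan_vtx (K : Type*) [Field K] [Algebra D K] [IsFractionRing D K] (hP : IsPrufer D K)
    [Finite P] {y : P} (hy : ¬ IsMax y) :
    Fan (vtx e y) (fun z : {z : P // y ⋖ z} => vtx e z.1) where
  lt z := (vtx_lt_vtx e).2 z.2.1
  cover M hM := by
    obtain ⟨z, rfl⟩ := exists_vtx e (maximal_mem_hiSpec hM.1)
    have h : y < z := lt_of_le_of_ne ((vtx_le_vtx e).1 hM.2) (by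
      rintro rfl; exact hy ((isMaximal_vtx e).1 hM.1))
    obtain ⟨w, hw, hw'⟩ := exists_covBy_le_of_lt h
    exact ⟨⟨w, hw⟩, (vtx_le_vtx e).2 hw'⟩
  sep i j hij r hi hj := by
    have h1 : ∀ i j : {z : P // y ⋖ z}, i ≠ j → ¬ vtx e i.1 ≤ vtx e j.1 := fun i j hij h =>
      hij (Subtype.ext ((j.2.eq_or_eq i.2.1.le ((vtx_le_vtx e).1 h)).resolve_left i.2.1.ne'))
    obtain ⟨m, hmi, hmj, hm⟩ := exists_meet K hP (vtx e i.1) (vtx e j.1)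
    obtain ⟨w, rfl⟩ := exists_vtx e (p := m)
      ⟨m.2, Or.inr (Or.inr (isBranchPoint_meet (h1 i j hij) (h1 j i hij.symm) hmi hmj hm))⟩
    have hyw : y ≤ w := (vtx_le_vtx e).1 (hm _ ((vtx_le_vtx e).2 i.2.1.le) ((vtx_le_vtx e).2 j.2.1.le))
    rcases i.2.eq_or_eq hyw ((vtx_le_vtx e).1 hmi) with h | h
    · exact h ▸ hm r hi hj
    · exact absurd (h ▸ hmj) (h1 i j hij)

end Tree

end

section

universe w

/-- Functoriality of the subtype of nontrivial elements of the model. -/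
def Phi.nonTrivMap {ι : Type*} {F F' : ι → Type*} [∀ i, PartialOrder (F i)]
    [∀ i, PartialOrder (F' i)] (φ : ∀ i, F i ≃o F' i) :
    {g : Phi F // ¬ g.Triv} ≃o {g : Phi F' // ¬ g.Triv} where
  toEquiv := (Phi.map φ).toEquiv.subtypeEquiv fun g => (Phi.map_triv φ g).not
  map_rel_iff' := (Phi.map φ).le_iff_le

/-- The condition that the closure operators at the vertex `y` are described by the poset `N`,
followed by a chain, the star operations corresponding to `St`. -/
def Models {D : Type u} [CommRing D] [IsDomain D] {K : Type v} [Field K] [Algebra D K]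
    [IsFractionRing D K] (hP : IsPrufer D K) {P : Type w} [PartialOrder P]
    (e : ↥(hiSpec D) ≃o P) {N : Type w} [PartialOrder N] (St : Set N) (d : ℕ) {z y : P}
    (h : z < y) (m : ℕ) : Prop :=
  d ≤ m ∧ ∃ φ : EqClo (actY (ringAt hP (vtx e y)) (valAt hP (vtx e z))) ≃o N ⊕ₗ Fin (m - d),
    ∀ f, f.toFun ((tower hP ((vtx_lt_vtx e).2 h)).emb (tower hP ((vtx_lt_vtx e).2 h)).base) =
      (tower hP ((vtx_lt_vtx e).2 h)).emb (tower hP ((vtx_lt_vtx e).2 h)).base ↔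
      ∃ n ∈ St, φ f = Sum.inlₗ n

theorem models_of_isMax {D : Type u} [CommRing D] [IsDomain D] {K : Type v} [Field K] [Algebra D K]
    [IsFractionRing D K] (hP : IsPrufer D K) {P : Type w} [PartialOrder P]
    (e : ↥(hiSpec D) ≃o P) {z y : P} (h : z < y) (hy : IsMax y)
    (hpos : 0 < omegaAt D (vtx e y).asIdeal (vtx e z).asIdeal (vtx e y).2) :
    Models hP e (Set.univ : Set (ULift.{w} (Fin (epsilonOf D (vtx e y).asIdeal))))
      (epsilonOf D (vtx e y).asIdeal) h
      (omegaAt D (vtx e y).asIdeal (vtx e z).asIdeal (vtx e y).2) := by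
  have hlt := (vtx_lt_vtx e).2 h
  obtain ⟨ψ, hψ⟩ := (tower hP hlt).exists_iso_of_eq (ringAt_of_isMaximal ((isMaximal_vtx e).2 hy))
  rw [omegaAt_eq hP hlt] at hpos ⊢
  rw [epsilonOf_eq hP hlt]
  have := Nat.finite_of_card_ne_zero hpos.ne'
  obtain ⟨hle, φ, hφ⟩ := exists_orderIso_lower eqClo_valuation_total _
    (tower hP hlt).isLowerSet_star
  refine ⟨hle, (ψ.trans φ).trans (OrderIso.sumLexCongr ULift.orderIso.symm (OrderIso.refl _)),
    fun f => ?_⟩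
  rw [hψ]
  refine (hφ (ψ f)).trans ?_
  constructor
  · rintro ⟨n, hn⟩
    exact ⟨ULift.up n, trivial, by rw [OrderIso.trans_apply, OrderIso.trans_apply, hn]; rfl⟩
  · rintro ⟨n, -, hn⟩
    refine ⟨n.down, ?_⟩
    rw [OrderIso.trans_apply, ← OrderIso.eq_symm_apply] at hn
    exact hn

theorem models_of_fan {D : Type u} [CommRing D] [IsDomain D] {K : Type v} [Field K] [Algebra D K]
    [IsFractionRing D K] (hP : IsPrufer D K) (hs : IsSemilocal D) {P : Type w} [PartialOrder P]
    [Finite P] (e : ↥(hiSpec D) ≃o P) {z y : P} (h : z < y) (hy : ¬ IsMax y)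
    (hpos : 0 < omegaAt D (vtx e y).asIdeal (vtx e z).asIdeal (vtx e y).2)
    {N : {x : P // y ⋖ x} → Type w} [∀ x, PartialOrder (N x)] (St : ∀ x, Set (N x))
    (d m : {x : P // y ⋖ x} → ℕ) (hM : ∀ x, Models hP e (St x) (d x) x.2.1 (m x)) :
    Models hP e {g : {g : Phi (fun x => N x ⊕ₗ Fin (m x - d x)) // ¬ g.Triv} |
        g.1.Star fun x => {f | ∃ n ∈ St x, f = Sum.inlₗ n}} 0 h
      (omegaAt D (vtx e y).asIdeal (vtx e z).asIdeal (vtx e y).2) := by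
  have hlt := (vtx_lt_vtx e).2 h
  choose hd φ hφ using hM
  obtain ⟨ψ, hψ⟩ := Fan.exists_levelIso (hP := hP) (fan_vtx e K hP hy) hs hlt
  rw [omegaAt_eq hP hlt] at hpos ⊢
  have := Nat.finite_of_card_ne_zero hpos.ne'
  obtain ⟨χ⟩ := exists_orderIso_fin
    (α := EqClo (actY (valAt hP (vtx e y)).toSubring (valAt hP (vtx e z)))) eqClo_valuation_total
  refine ⟨Nat.zero_le _, ψ.trans (OrderIso.sumLexCongr (Phi.nonTrivMap φ) χ), fun f => ?_⟩
  rw [hψ]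
  have key := fun g => Phi.map_star φ (St := fun x => {f | f.toFun
    ((tower hP ((vtx_lt_vtx e).2 x.2.1)).emb (tower hP ((vtx_lt_vtx e).2 x.2.1)).base) =
    (tower hP ((vtx_lt_vtx e).2 x.2.1)).emb (tower hP ((vtx_lt_vtx e).2 x.2.1)).base})
    (St' := fun x => {f | ∃ n ∈ St x, f = Sum.inlₗ n}) hφ g
  constructor
  · rintro ⟨g, hg, h⟩
    exact ⟨Phi.nonTrivMap φ g, (key g.1).1 hg, by rw [OrderIso.trans_apply, h]; rfl⟩
  · rintro ⟨n, hn, h⟩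
    obtain ⟨g, rfl⟩ := (Phi.nonTrivMap φ).surjective n
    refine ⟨g, (key g.1).2 hn, ?_⟩
    rw [OrderIso.trans_apply, ← OrderIso.eq_symm_apply] at h
    rw [h]
    exact congrArg Sum.inlₗ ((Phi.nonTrivMap φ).symm_apply_apply g)

/-- The closure operators at a vertex have a description that depends only on the tree, the
values `b` of `ω` strictly above the vertex, and the values `c` of `ε`. -/
theorem exists_model {P : Type w} [PartialOrder P] [Finite P] (b c : P → ℕ) (hb : ∀ x, 0 < b x)
    (hc : ∀ x, IsMax x → 0 < c x) (y : P) :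
    ∃ (N : Type w) (_ : PartialOrder N) (_ : Finite N) (St : Set N) (d : ℕ), St.Nonempty ∧
      ∀ (D : Type u) (K : Type v) [CommRing D] [IsDomain D] [Field K] [Algebra D K]
        [IsFractionRing D K] (hP : IsPrufer D K) (_ : IsSemilocal D) (e : ↥(hiSpec D) ≃o P),
        (∀ z x, z ⋖ x → y < x →
          omegaAt D (vtx e x).asIdeal (vtx e z).asIdeal (vtx e x).2 = b x) →
        (∀ x, IsMax x → epsilonOf D (vtx e x).asIdeal = c x) →
        ∀ z (h : z ⋖ y), 0 < omegaAt D (vtx e y).asIdeal (vtx e z).asIdeal (vtx e y).2 →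
          Models hP e St d h.1 (omegaAt D (vtx e y).asIdeal (vtx e z).asIdeal (vtx e y).2) := by
  induction y using WellFoundedGT.induction with
  | ind y ih =>
  by_cases hy : IsMax y
  · refine ⟨ULift.{w} (Fin (c y)), inferInstance, inferInstance, Set.univ, c y,
      ⟨⟨⟨0, hc y hy⟩⟩, trivial⟩, ?_⟩
    intro D K _ _ _ _ _ hP hs e _ hε z h hpos
    rw [← hε y hy]
    exact models_of_isMax hP e h.1 hy hpos
  · have ih' := fun x : {x : P // y ⋖ x} => ih x.1 x.2.1
    choose N iN fN St d hne hM using ih'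
    have hne' : Nonempty {x : P // y ⋖ x} := by
      obtain ⟨x, hx⟩ := not_isMax_iff.1 hy
      obtain ⟨x', hx', -⟩ := exists_covBy_le_of_lt hx
      exact ⟨⟨x', hx'⟩⟩
    have hfin : ∀ x, Finite (N x ⊕ₗ Fin (b x.1 - d x)) := fun x =>
      inferInstanceAs (Finite (N x ⊕ Fin (b x.1 - d x)))
    refine ⟨{g : Phi (fun x : {x : P // y ⋖ x} => N x ⊕ₗ Fin (b x.1 - d x)) // ¬ g.Triv},
      inferInstance, inferInstance,
      {g | g.1.Star fun x => {f | ∃ n ∈ St x, f = Sum.inlₗ n}}, 0, ?_, ?_⟩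
    · choose n hn using hne
      exact ⟨⟨Phi.const fun x => Sum.inlₗ (n x), Phi.not_triv_const _⟩,
        Phi.star_const fun x => ⟨n x, hn x, rfl⟩⟩
    · intro D K _ _ _ _ _ hP hs e hω hε z h hpos
      refine models_of_fan hP hs e h.1 hy hpos St d (fun x => b x.1) fun x => ?_
      have h1 := hω _ _ x.2 x.2.1
      rw [← h1]
      exact hM x D K hP hs e (fun z w h h' => hω z w h (x.2.1.trans h')) hε y x.2
        (by rw [h1]; exact hb _)

end

section Root

variable {D : Type*} [CommRing D] [IsDomain D]
variable {K : Type*} [Field K] [Algebra D K] [IsFractionRing D K]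
variable {hP : IsPrufer D K} {q : PrimeSpectrum D}

theorem mem_valAt_of_eq_bot (hq : q.asIdeal = ⊥) (x : K) : x ∈ valAt hP q := by
  obtain ⟨a, d, hd, rfl⟩ := IsFractionRing.div_surjective (A := D) x
  have hd0 : d ∉ q.asIdeal := by
    rw [hq]; exact nonZeroDivisors.ne_zero hd
  exact mem_valAt.2 ⟨d, hd0, a, mul_div_cancel₀ _ (algebraMap_ne_zero_of_notMem hd0)⟩

theorem val_le_of_eq_bot (hq : q.asIdeal = ⊥) (x : K) : (valAt hP q).valuation x ≤ 1 :=
  ((valAt hP q).valuation_le_one_iff _).2 (mem_valAt_of_eq_bot hq x)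

theorem val_eq_of_eq_bot (hq : q.asIdeal = ⊥) {x : K} (hx : x ≠ 0) :
    (valAt hP q).valuation x = 1 := by
  refine le_antisymm (val_le_of_eq_bot hq x) ?_
  have := val_le_of_eq_bot (hP := hP) hq x⁻¹
  rw [map_inv₀] at this
  exact (inv_le_one₀ (zero_lt_iff.2 ((Valuation.ne_zero_iff _).2 hx))).1 this

theorem mem_ringAt_of_eq_bot (hq : q.asIdeal = ⊥) {x : K} :
    x ∈ ringAt hP q ↔ ∃ a, algebraMap D K a = x := by
  constructor
  · intro hx
    let 𝔞 : Ideal D :=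
      { carrier := {d | ∃ a, algebraMap D K d * x = algebraMap D K a}
        zero_mem' := ⟨0, by simp⟩
        add_mem' := by
          rintro d d' ⟨a, h⟩ ⟨a', h'⟩
          exact ⟨a + a', by rw [map_add, add_mul, h, h', map_add]⟩
        smul_mem' := by
          rintro t d ⟨a, h⟩
          exact ⟨t * a, by rw [smul_eq_mul, map_mul, mul_assoc, h, map_mul]⟩ }
    have h1 : 𝔞 = ⊤ := by
      by_contra hne
      obtain ⟨M, hM, hle⟩ := 𝔞.exists_le_maximal hne
      have hMq : (⟨M, hM.isPrime⟩ : PrimeSpectrum D) ∈ maxAbove q := ⟨hM, by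
        change q.asIdeal ≤ M
        rw [hq]; exact bot_le⟩
      obtain ⟨d, hd, a, h⟩ := mem_valAt.1 (mem_ringAt.1 hx _ hMq)
      exact hd (hle ⟨a, h⟩)
    obtain ⟨a, ha⟩ := (Ideal.eq_top_iff_one _).1 h1
    exact ⟨a, by rw [← ha, map_one, one_mul]⟩
  · rintro ⟨a, rfl⟩
    exact algebraMap_mem_ringAt a

variable (hP) in
/-- Nonzero submodules of the quotient field, as modules over the localization at zero. -/
def subIso (hq : q.asIdeal = ⊥) :
    {I : Submodule D K // I ≠ ⊥} ≃o ModX (ringAt hP q) (valAt hP q) where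
  toFun I := ⟨I.1.toAddSubgroup,
    { stable := fun t ht y hy => by
        obtain ⟨a, rfl⟩ := (mem_ringAt_of_eq_bot hq).1 ht
        rw [← Algebra.smul_def]
        exact I.1.smul_mem a hy
      of_lt := fun y hy => by
        by_cases h0 : y = 0
        · rw [h0]; exact I.1.zero_mem
        · exact absurd (val_eq_of_eq_bot hq h0) hy.ne
      unit := by
        obtain ⟨y, hy, h0⟩ := I.1.exists_mem_ne_zero_of_ne_bot I.2
        exact ⟨y, hy, val_eq_of_eq_bot hq h0⟩
      le_one := fun y _ => val_le_of_eq_bot hq y }⟩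
  invFun J := ⟨{ J.1 with
      smul_mem' := fun a y hy => by
        rw [Algebra.smul_def]
        exact J.2.stable _ (algebraMap_mem_ringAt a) y hy }, fun h => by
    obtain ⟨y, hy, h1⟩ := J.2.unit
    have h2 : y ∈ (⊥ : Submodule D K) := h ▸ hy
    rw [Submodule.mem_bot] at h2
    rw [h2, map_zero] at h1
    exact zero_ne_one h1⟩
  left_inv _ := rfl
  right_inv _ := rfl
  map_rel_iff' := Iff.rfl

theorem mem_subIso (hq : q.asIdeal = ⊥) {I : {I : Submodule D K // I ≠ ⊥}} {y : K} :
    y ∈ (subIso hP hq I).1 ↔ y ∈ I.1 := Iff.rfl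

theorem span_mul_ne_bot {x : K} (hx : x ≠ 0) {I : Submodule D K} (hI : I ≠ ⊥) :
    Submodule.span D {x} * I ≠ ⊥ := by
  obtain ⟨y, hy, h0⟩ := I.exists_mem_ne_zero_of_ne_bot hI
  intro h
  have : x * y ∈ (⊥ : Submodule D K) := h ▸ Submodule.mem_span_singleton_mul.2 ⟨y, hy, rfl⟩
  exact mul_ne_zero hx h0 ((Submodule.mem_bot D).1 this)

theorem subIso_smul (hq : q.asIdeal = ⊥) (u : (valAt hP q).unitGroup)
    (I I' : {I : Submodule D K // I ≠ ⊥})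
    (h : I'.1 = Submodule.span D {((u : Kˣ) : K)} * I.1) :
    subIso hP hq I' = actX (ringAt hP q) (valAt hP q) u (subIso hP hq I) := by
  refine Subtype.ext (AddSubgroup.ext fun y => ?_)
  rw [actX_coe, mem_scale, mem_subIso, mem_subIso, h, Submodule.mem_span_singleton_mul]
  constructor
  · rintro ⟨z, hz, rfl⟩
    simpa using hz
  · intro hz
    exact ⟨_, hz, by simp⟩

theorem ne_bot_of_le {I J : Submodule D K} (h : I ≤ J) (hI : I ≠ ⊥) : J ≠ ⊥ := fun hJ =>
  hI (le_bot_iff.1 (hJ ▸ h))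

theorem Semistar.bot_of_one (hD : ¬ ∀ x : K, ∃ a, algebraMap D K a = x) {s : Semistar D K}
    (hs : s.toFun 1 = 1) : s.toFun ⊥ = ⊥ := by
  by_contra h0
  obtain ⟨y, hy, hy0⟩ := (s.toFun ⊥).exists_mem_ne_zero_of_ne_bot h0
  apply hD
  intro x
  have h1 : x ∈ s.toFun ⊥ := by
    by_cases hx : x = 0
    · rw [hx]; exact zero_mem _
    · have h2 := s.smul' (x / y) (div_ne_zero hx hy0) ⊥
      rw [Submodule.mul_bot] at h2
      rw [h2, Submodule.mem_span_singleton_mul]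
      exact ⟨y, hy, div_mul_cancel₀ _ hy0⟩
  have h3 : x ∈ (1 : Submodule D K) := hs ▸ s.mono' bot_le h1
  exact Submodule.mem_one.1 h3

variable (hP) in
/-- The equivariant closure operator of a semistar operation. -/
def ofSemistar (hq : q.asIdeal = ⊥) (s : Semistar D K) :
    EqClo (actX (ringAt hP q) (valAt hP q)) where
  toFun J := subIso hP hq ⟨s.toFun ((subIso hP hq).symm J).1,
    ne_bot_of_le (s.le_star' _) ((subIso hP hq).symm J).2⟩
  le' J := fun _ hy => s.le_star' ((subIso hP hq).symm J).1 hy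
  mono' J J' h := (subIso hP hq).monotone (s.mono' ((subIso hP hq).symm.monotone h))
  idem' J := by
    rw [(subIso hP hq).injective.eq_iff]
    refine Subtype.ext ?_
    simp only [OrderIso.symm_apply_apply, s.idem']
  equiv' u J := by
    have h1 : (subIso hP hq).symm (actX (ringAt hP q) (valAt hP q) u J) =
        ⟨_, span_mul_ne_bot (u : Kˣ).ne_zero ((subIso hP hq).symm J).2⟩ := by
      rw [OrderIso.symm_apply_eq]
      rw [subIso_smul hq u ((subIso hP hq).symm J) ⟨_, span_mul_ne_bot (u : Kˣ).ne_zero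
        ((subIso hP hq).symm J).2⟩ rfl, OrderIso.apply_symm_apply]
    refine subIso_smul hq u _ _ ?_
    simp only [h1]
    exact s.smul' _ (u : Kˣ).ne_zero _

open Classical in
variable (hP) in
/-- The semistar operation of an equivariant closure operator. -/
def toSemistar (hq : q.asIdeal = ⊥) (c : EqClo (actX (ringAt hP q) (valAt hP q))) :
    Semistar D K where
  toFun I := if h : I = ⊥ then ⊥ else ((subIso hP hq).symm (c.toFun (subIso hP hq ⟨I, h⟩))).1
  le_star' I := by
    split_ifs with h
    · exact h.le
    · exact (OrderIso.le_symm_apply _).2 (c.le' (subIso hP hq ⟨I, h⟩))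
  mono' I J hIJ := by
    split_ifs with h h' h'
    · exact le_rfl
    · exact bot_le
    · exact absurd (le_bot_iff.1 (hIJ.trans h'.le)) h
    · exact (subIso hP hq).symm.monotone (c.mono' ((subIso hP hq).monotone hIJ))
  idem' I := by
    by_cases h : I = ⊥
    · simp [h]
    · have h1 := ((subIso hP hq).symm (c.toFun (subIso hP hq ⟨I, h⟩))).2
      rw [dif_neg h, dif_neg h1]
      simp [c.idem']
  smul' x hx I := by
    by_cases h : I = ⊥
    · simp [h]
    · have h1 := span_mul_ne_bot hx h
      rw [dif_neg h, dif_neg h1]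
      let u : (valAt hP q).unitGroup := unitOf x (val_eq_of_eq_bot hq hx)
      rw [subIso_smul hq u ⟨I, h⟩ ⟨_, h1⟩ rfl, c.equiv']
      have h2 := subIso_smul hq u ((subIso hP hq).symm (c.toFun (subIso hP hq ⟨I, h⟩)))
        ⟨_, span_mul_ne_bot hx ((subIso hP hq).symm _).2⟩ rfl
      rw [OrderIso.apply_symm_apply] at h2
      rw [← h2, OrderIso.symm_apply_apply]

/-- (Semi)star operations as equivariant closure operators. -/
theorem card_semistar (hP : IsPrufer D K) (hD : ¬ ∀ x : K, ∃ a, algebraMap D K a = x)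
    (hq : q.asIdeal = ⊥) {B : ModX (ringAt hP q) (valAt hP q)}
    (hB : ∀ y, y ∈ B.1 ↔ y ∈ ringAt hP q) :
    Nat.card {s : Semistar D K // s.toFun 1 = 1} =
      Nat.card {c : EqClo (actX (ringAt hP q) (valAt hP q)) // c.toFun B = B} := by
  have h1 : (1 : Submodule D K) ≠ ⊥ := one_ne_zero
  have hB' : B = subIso hP hq ⟨1, h1⟩ := by
    refine Subtype.ext (AddSubgroup.ext fun y => ?_)
    rw [hB, mem_subIso, mem_ringAt_of_eq_bot hq, Submodule.mem_one]
  have hs : ∀ s : Semistar D K, s.toFun 1 = 1 ↔ (ofSemistar hP hq s).toFun B = B := by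
    intro s
    change _ ↔ subIso hP hq _ = _
    rw [hB', (subIso hP hq).injective.eq_iff, Subtype.ext_iff]
    simp only [OrderIso.symm_apply_apply]
  have hr : ∀ c, ofSemistar hP hq (toSemistar hP hq c) = c := fun c => EqClo.ext' fun J => by
    have h : ((subIso hP hq).symm J).1 ≠ ⊥ := ((subIso hP hq).symm J).2
    simp [ofSemistar, toSemistar, h]
  refine Nat.card_congr
    { toFun := fun s => ⟨ofSemistar hP hq s.1, (hs s.1).1 s.2⟩
      invFun := fun c => ⟨toSemistar hP hq c.1, (hs _).2 (by rw [hr]; exact c.2)⟩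
      left_inv := fun s => Subtype.ext (Semistar.ext' (funext fun I => by
        by_cases h : I = ⊥
        · simp [toSemistar, h, Semistar.bot_of_one hD s.2]
        · simp [ofSemistar, toSemistar, h]))
      right_inv := fun c => Subtype.ext (hr c.1) }

/-- Over a field, there are exactly two (semi)star operations. -/
theorem card_semistar_field (hD : ∀ x : K, ∃ a, algebraMap D K a = x) :
    Nat.card {s : Semistar D K // s.toFun 1 = 1} = 2 := by
  have htop : (1 : Submodule D K) = ⊤ := eq_top_iff.2 fun x _ => Submodule.mem_one.2 (hD x)
  have hbt : ∀ I : Submodule D K, I = ⊥ ∨ I = ⊤ := by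
    intro I
    by_cases h : I = ⊥
    · exact Or.inl h
    · obtain ⟨y, hy, h0⟩ := I.exists_mem_ne_zero_of_ne_bot h
      refine Or.inr (eq_top_iff.2 fun x _ => ?_)
      obtain ⟨a, ha⟩ := hD (x / y)
      have := I.smul_mem a hy
      rwa [Algebra.smul_def, ha, div_mul_cancel₀ _ h0] at this
  have hxt : ∀ x : K, x ≠ 0 → Submodule.span D {x} * (⊤ : Submodule D K) = ⊤ := fun x hx => by
    refine (hbt _).resolve_left (span_mul_ne_bot hx ?_)
    rw [← htop]; exact one_ne_zero
  let t : Semistar D K :=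
    { toFun := fun _ => ⊤
      le_star' := fun _ => le_top
      mono' := fun _ _ _ => le_rfl
      idem' := fun _ => rfl
      smul' := fun x hx _ => (hxt x hx).symm }
  have hst : ∀ s : Semistar D K, s.toFun ⊤ = ⊤ := fun s => eq_top_iff.2 (s.le_star' _)
  have hbne : (⊥ : Submodule D K) ≠ ⊤ := by
    rw [← htop]; exact one_ne_zero.symm
  rw [Nat.card_eq_two_iff]
  refine ⟨⟨dOp D K, rfl⟩, ⟨t, htop.symm⟩, ?_, Set.eq_univ_of_forall ?_⟩
  · intro h
    have h1 : dOp D K = t := Subtype.ext_iff.1 h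
    exact hbne (congrArg (fun s : Semistar D K => s.toFun ⊥) h1)
  · rintro ⟨s, hs⟩
    rcases hbt (s.toFun ⊥) with h | h
    · refine Or.inl (Subtype.ext (Semistar.ext' (funext fun I => ?_)))
      rcases hbt I with rfl | rfl
      exacts [h, hst s]
    · refine Or.inr (Subtype.ext (Semistar.ext' (funext fun I => ?_)))
      rcases hbt I with rfl | rfl
      exacts [h, hst s]

end Root

/-- The order embedding of ordinal sums induced by an embedding of the upper summands. -/
def sumLexMapRight (N : Type*) [PartialOrder N] {C C' : Type*} [PartialOrder C] [PartialOrder C']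
    (f : C ↪o C') : N ⊕ₗ C ↪o N ⊕ₗ C' :=
  OrderEmbedding.ofMapLEIff (fun x => toLex (Sum.map id f (ofLex x))) (by
    intro x y
    obtain ⟨x, rfl⟩ := toLex.surjective x
    obtain ⟨y, rfl⟩ := toLex.surjective y
    rcases x with x | x <;> rcases y with y | y <;> simp [Sum.Lex.toLex_le_toLex])

theorem card_proper {ι : Type*} [Finite ι] (i : ι) :
    Nat.card {S : Set ι // i ∈ S ∧ S ≠ Set.univ} = 2 ^ (Nat.card ι - 1) - 1 := by
  classical
  have := Fintype.ofFinite ι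
  have h : Nat.card {S : Set ι // i ∈ S ∧ S ≠ Set.univ} =
      Nat.card ((Finset.univ.erase i).powerset.erase ∅ : Finset (Finset ι)) := by
    refine Nat.card_eq_of_bijective (fun S => ⟨(S.1)ᶜ.toFinset, ?_⟩) ⟨?_, ?_⟩
    · rw [Finset.mem_erase, Finset.mem_powerset]
      refine ⟨fun h => S.2.2 ?_, fun x hx => ?_⟩
      · rw [Set.toFinset_eq_empty] at h
        exact Set.compl_empty_iff.1 h
      · rw [Set.mem_toFinset] at hx
        refine Finset.mem_erase.2 ⟨?_, Finset.mem_univ _⟩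
        rintro rfl
        exact hx S.2.1
    · intro S S' h
      have h1 := (Subtype.ext_iff.1 h :)
      exact Subtype.ext (compl_injective (Set.toFinset_inj.1 h1))
    · rintro ⟨T, hT⟩
      rw [Finset.mem_erase, Finset.mem_powerset] at hT
      refine ⟨⟨(T : Set ι)ᶜ, fun hi => ?_, fun h => hT.1 ?_⟩, Subtype.ext ?_⟩
      · exact (Finset.mem_erase.1 (hT.2 hi)).1 rfl
      · rw [Set.compl_univ_iff] at h
        exact Finset.coe_eq_empty.1 h
      · simp
  rw [h, Nat.card_eq_fintype_card, Fintype.card_coe, Finset.card_erase_of_mem (by simp),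
    Finset.card_powerset, Finset.card_erase_of_mem (Finset.mem_univ _), Finset.card_univ,
    Nat.card_eq_fintype_card]

namespace Phi

section MapEmb

variable {ι : Type*} {F F' : ι → Type*} [∀ i, PartialOrder (F i)] [∀ i, PartialOrder (F' i)]

/-- Functoriality of the model on order embeddings. -/
def mapEmb (φ : ∀ i, F i ↪o F' i) (g : Phi F) : Phi F' where
  toFun S i := (φ i).withTopMap (g.toFun S i)
  anti S S' h i := (φ i).withTopMap.monotone (g.anti h i)
  supp_sub S i hi := g.supp_sub S (by simpa [suppT] using hi)
  idem S := by
    have : suppT (fun i => (φ i).withTopMap (g.toFun S i)) = suppT (g.toFun S) := by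
      ext i; simp [suppT]
    rw [this, g.idem]

theorem mapEmb_injective (φ : ∀ i, F i ↪o F' i) : Function.Injective (mapEmb φ) :=
  fun _ _ h => ext' fun S i =>
    (φ i).withTopMap.injective (congrFun (congrFun (congrArg Phi.toFun h) S) i)

theorem exists_mapEmb_eq (φ : ∀ i, F i ↪o F' i) {g : Phi F'}
    (h : ∀ S i, g.toFun S i ∈ Set.range (φ i).withTopMap) : ∃ g', mapEmb φ g' = g := by
  choose t ht using h
  have hs : ∀ S, suppT (t S) = suppT (g.toFun S) := fun S => by
    ext i
    simp only [suppT, Set.mem_ofPred_eq, ← ht]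
    simp
  refine ⟨⟨t, ?_, fun S => ?_, fun S => funext fun i => ?_⟩, ext' ht⟩
  · intro S S' h i
    rw [← (φ i).withTopMap.le_iff_le, ht, ht]
    exact g.anti h i
  · rw [hs]; exact g.supp_sub S
  · apply (φ i).withTopMap.injective
    rw [ht, ht, hs, g.idem]

end MapEmb

section Chain

variable {ι : Type*} {N : ι → Type*} [∀ i, PartialOrder (N i)] (St : ∀ i, Set (N i))

/-- Marked elements of the lower summand. -/
abbrev inlSet (C : ι → Type*) (i : ι) : Set (N i ⊕ₗ C i) :=
  {f | ∃ n ∈ St i, f = Sum.inlₗ n}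

/-- The set of values attained in the upper summand. -/
def chainPart {C : ι → Type*} [∀ i, PartialOrder (C i)] (g : Phi fun i => N i ⊕ₗ C i) (i : ι) :
    Set (C i) :=
  {a | ∃ S, g.toFun S i = ((Sum.inrₗ a : N i ⊕ₗ C i) : WithTop (N i ⊕ₗ C i))}

/-- The number of marked elements attaining all values of the chains. -/
def chainCount (j : ι → ℕ) : ℕ :=
  Nat.card {g : Phi fun i => N i ⊕ₗ Fin (j i) //
    g.Star (inlSet St fun i => Fin (j i)) ∧ ∀ i, g.chainPart i = Set.univ}

variable {St}

section

variable {C C' : ι → Type*} [∀ i, PartialOrder (C i)] [∀ i, PartialOrder (C' i)]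
  (φ : ∀ i, C i ↪o C' i) (g : Phi fun i => N i ⊕ₗ C i)

theorem star_mapEmb : (mapEmb (fun i => sumLexMapRight (N i) (φ i)) g).Star (inlSet St C') ↔
    g.Star (inlSet St C) := by
  refine forall_congr' fun i => ⟨?_, ?_⟩
  · rintro ⟨f, ⟨n, hn, rfl⟩, h⟩
    refine ⟨_, ⟨n, hn, rfl⟩, (sumLexMapRight (N i) (φ i)).withTopMap.injective (h.trans rfl)⟩
  · rintro ⟨f, ⟨n, hn, rfl⟩, h⟩
    exact ⟨_, ⟨n, hn, rfl⟩, (congrArg (sumLexMapRight (N i) (φ i)).withTopMap h).trans rfl⟩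

theorem chainPart_mapEmb (i : ι) :
    (mapEmb (fun i => sumLexMapRight (N i) (φ i)) g).chainPart i = φ i '' g.chainPart i := by
  ext a
  constructor
  · rintro ⟨S, h⟩
    change (sumLexMapRight (N i) (φ i)).withTopMap (g.toFun S i) = _ at h
    cases hg : g.toFun S i with
    | top => rw [hg] at h; exact absurd h (WithTop.top_ne_coe)
    | coe x =>
      rw [hg] at h
      have h1 := WithTop.coe_injective h
      obtain ⟨x, rfl⟩ := toLex.surjective x
      rcases x with x | x
      · exact absurd (toLex.injective h1) Sum.inl_ne_inr
      · exact ⟨x, ⟨S, hg⟩, Sum.inr_injective (toLex.injective h1)⟩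
  · rintro ⟨x, ⟨S, h⟩, rfl⟩
    exact ⟨S, (congrArg (sumLexMapRight (N i) (φ i)).withTopMap h).trans rfl⟩

theorem exists_sumLexMapRight_eq {g : Phi fun i => N i ⊕ₗ C' i}
    (h : ∀ i, g.chainPart i ⊆ Set.range (φ i)) :
    ∃ g', mapEmb (fun i => sumLexMapRight (N i) (φ i)) g' = g := by
  refine exists_mapEmb_eq _ fun S i => ?_
  cases hg : g.toFun S i with
  | top => exact ⟨⊤, rfl⟩
  | coe x =>
    obtain ⟨x, rfl⟩ := toLex.surjective x
    rcases x with x | x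
    · exact ⟨((Sum.inlₗ x : N i ⊕ₗ C i) : WithTop (N i ⊕ₗ C i)), rfl⟩
    · obtain ⟨y, rfl⟩ := h i ⟨S, hg⟩
      exact ⟨((Sum.inrₗ y : N i ⊕ₗ C i) : WithTop (N i ⊕ₗ C i)), rfl⟩

end

variable [Finite ι] [∀ i, Finite (N i)]

instance finite_sumLex (m : ι → ℕ) : Finite (Phi fun i => N i ⊕ₗ Fin (m i)) := by
  have : ∀ i, Finite (N i ⊕ₗ Fin (m i)) := fun i => inferInstanceAs (Finite (N i ⊕ Fin (m i)))
  infer_instance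

omit [Finite ι] [∀ i, Finite (N i)] in
theorem card_chainPart_eq (m : ι → ℕ) (T : ∀ i, Finset (Fin (m i))) :
    Nat.card {g : Phi fun i => N i ⊕ₗ Fin (m i) //
      g.Star (inlSet St fun i => Fin (m i)) ∧ ∀ i, g.chainPart i = T i} =
      chainCount St fun i => (T i).card := by
  symm
  refine Nat.card_eq_of_bijective (fun g => ⟨mapEmb (fun i => sumLexMapRight (N i)
    ((T i).orderEmbOfFin rfl)) g.1, (star_mapEmb _ _).2 g.2.1, fun i => ?_⟩) ⟨?_, ?_⟩
  · rw [chainPart_mapEmb, g.2.2 i, Set.image_univ, Finset.range_orderEmbOfFin]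
  · intro g g' h
    exact Subtype.ext (mapEmb_injective _ (Subtype.ext_iff.1 h :))
  · rintro ⟨g, hg, hT⟩
    obtain ⟨g', rfl⟩ := exists_sumLexMapRight_eq (fun i => (T i).orderEmbOfFin rfl) (g := g)
      fun i => by rw [Finset.range_orderEmbOfFin, hT]
    refine ⟨⟨g', (star_mapEmb _ _).1 hg, fun i => ?_⟩, rfl⟩
    have h1 := hT i
    rw [chainPart_mapEmb, ← Finset.range_orderEmbOfFin (T i) rfl, ← Set.image_univ] at h1
    exact ((T i).orderEmbOfFin rfl).injective.image_injective h1

theorem card_star_eq_sum [Fintype ι] [DecidableEq ι] (m : ι → ℕ) :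
    Nat.card {g : Phi fun i => N i ⊕ₗ Fin (m i) // g.Star (inlSet St fun i => Fin (m i))} =
      ∑ T : ∀ i, Finset (Fin (m i)), chainCount St fun i => (T i).card := by
  classical
  rw [← Nat.card_congr (Equiv.sigmaFiberEquiv fun g : {g : Phi fun i => N i ⊕ₗ Fin (m i) //
    g.Star (inlSet St fun i => Fin (m i))} => fun i => (g.1.chainPart i).toFinset), Nat.card_sigma]
  refine Finset.sum_congr rfl fun T _ => ?_
  rw [← card_chainPart_eq]
  refine Nat.card_congr ((Equiv.subtypeSubtypeEquivSubtypeInter _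
    fun g : Phi fun i => N i ⊕ₗ Fin (m i) => (fun i => (g.chainPart i).toFinset) = T).trans
    (Equiv.subtypeEquivRight fun g => and_congr_right fun _ => ?_))
  rw [funext_iff]
  refine forall_congr' fun i => ?_
  rw [← Finset.coe_inj, Set.coe_toFinset]

omit [∀ i, Finite (N i)] in
theorem le_of_chainCount_ne_zero {j : ι → ℕ} (h : chainCount St j ≠ 0) (i : ι) :
    j i ≤ 2 ^ (Nat.card ι - 1) - 1 := by
  obtain ⟨⟨g, hg, hT⟩⟩ : Nonempty _ := (Nat.card_ne_zero.1 h).1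
  have h1 : ∀ a : Fin (j i), ∃ S, g.toFun S i =
      ((Sum.inrₗ a : N i ⊕ₗ Fin (j i)) : WithTop (N i ⊕ₗ Fin (j i))) := fun a => by
    have : a ∈ g.chainPart i := by rw [hT]; trivial
    exact this
  choose S hS using h1
  rw [← card_proper i]
  have h2 : ∀ a, i ∈ S a ∧ S a ≠ Set.univ := fun a => by
    constructor
    · refine g.supp_sub _ ?_
      change _ ≠ _
      rw [hS]; exact WithTop.coe_ne_top
    · intro h
      obtain ⟨f, ⟨n, -, rfl⟩, hn⟩ := hg i
      rw [← h, hS a] at hn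
      exact Sum.inr_ne_inl (toLex.injective (WithTop.coe_injective hn))
  conv_lhs => rw [← Nat.card_fin (j i)]
  refine Nat.card_le_card_of_injective (fun a => ⟨S a, h2 a⟩) fun a a' h => ?_
  have h3 := hS a
  have h4 : S a = S a' := Subtype.ext_iff.1 h
  rw [h4, hS] at h3
  exact (Sum.inr_injective (toLex.injective (WithTop.coe_injective h3))).symm

omit [∀ i, Finite (N i)] in
theorem exists_rank (i : ι) : ∃ r : {S : Set ι // i ∈ S ∧ S ≠ Set.univ} →
    Fin (2 ^ (Nat.card ι - 1) - 1), Function.Surjective r ∧ Antitone r := by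
  have : Finite (LinearExtension {S : Set ι // i ∈ S ∧ S ≠ Set.univ}) :=
    inferInstanceAs (Finite {S : Set ι // i ∈ S ∧ S ≠ Set.univ})
  have := Fintype.ofFinite (LinearExtension {S : Set ι // i ∈ S ∧ S ≠ Set.univ})
  have hc : Fintype.card (LinearExtension {S : Set ι // i ∈ S ∧ S ≠ Set.univ}) =
      2 ^ (Nat.card ι - 1) - 1 := by
    rw [← card_proper i, ← Nat.card_eq_fintype_card]; rfl
  let f := (monoEquivOfFin _ hc).symm
  refine ⟨fun S => (f (toLinearExtension S)).rev,
    Fin.rev_surjective.comp (f.surjective.comp fun x => ⟨x, rfl⟩), fun S S' h => ?_⟩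
  exact Fin.rev_le_rev.2 (f.monotone (toLinearExtension.monotone h))

theorem chainCount_pos (hne : ∀ i, (St i).Nonempty) :
    0 < chainCount St fun _ : ι => 2 ^ (Nat.card ι - 1) - 1 := by
  classical
  choose n hn using hne
  choose r hr hanti using exists_rank (ι := ι)
  let F := fun i => N i ⊕ₗ Fin (2 ^ (Nat.card ι - 1) - 1)
  let t : Set ι → ∀ i, WithTop (F i) := fun S i =>
    if h : i ∈ S then if h' : S = Set.univ then ((Sum.inlₗ (n i) : F i) : WithTop (F i))
      else ((Sum.inrₗ (r i ⟨S, h, h'⟩) : F i) : WithTop (F i)) else ⊤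
  have hs : ∀ S, suppT (t S) = S := fun S => by
    ext i
    simp only [suppT, Set.mem_ofPred_eq, t]
    split_ifs with h h' <;> simp [h]
  let g : Phi F :=
    { toFun := t
      anti := by
        intro S S' h i
        simp only [t]
        by_cases hi : i ∈ S
        · rw [dif_pos hi, dif_pos (h hi)]
          by_cases hu : S' = Set.univ
          · rw [dif_pos hu]
            split_ifs
            · exact le_rfl
            · exact WithTop.coe_le_coe.2 (Sum.Lex.inl_le_inr _ _)
          · have hu' : S ≠ Set.univ := fun h' => hu (Set.univ_subset_iff.1 (h' ▸ h))
            rw [dif_neg hu, dif_neg hu']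
            exact WithTop.coe_le_coe.2 (Sum.Lex.inr_le_inr_iff.2 (hanti i h))
        · rw [dif_neg hi]; exact le_top
      supp_sub := fun S => (hs S).le
      idem := fun S => by rw [hs] }
  have : Nonempty {g : Phi F // g.Star (inlSet St fun _ => Fin (2 ^ (Nat.card ι - 1) - 1)) ∧
      ∀ i, g.chainPart i = Set.univ} := by
    refine ⟨⟨g, fun i => ⟨_, ⟨n i, hn i, rfl⟩, ?_⟩, fun i => Set.eq_univ_of_forall fun a => ?_⟩⟩
    · change t _ i = _
      simp [t]
    · obtain ⟨⟨S, h, h'⟩, rfl⟩ := hr i a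
      refine ⟨S, ?_⟩
      change t _ i = _
      simp only [t]
      rw [dif_pos h, dif_neg h']
  exact Nat.card_pos_iff.2 ⟨this, inferInstance⟩

/-- The number of marked elements, in terms of binomial coefficients. -/
theorem card_star_eq_sum_choose [Fintype ι] [DecidableEq ι] (m : ι → ℕ) :
    Nat.card {g : Phi fun i => N i ⊕ₗ Fin (m i) // g.Star (inlSet St fun i => Fin (m i))} =
      ∑ j ∈ Fintype.piFinset fun _ : ι => Finset.range (2 ^ (Nat.card ι - 1) - 1 + 1),
        chainCount St j * ∏ i, (m i).choose (j i) := by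
  classical
  set n := 2 ^ (Nat.card ι - 1) - 1 with hn
  have h0 : ∀ T ∈ (Finset.univ : Finset (∀ i, Finset (Fin (m i)))),
      (chainCount St fun i => (T i).card) ≠ 0 → ∀ i, (T i).card ≤ n :=
    fun T _ h => le_of_chainCount_ne_zero h
  rw [card_star_eq_sum, ← Finset.sum_filter_of_ne h0,
    ← Finset.sum_fiberwise_of_maps_to (g := fun (T : ∀ i, Finset (Fin (m i))) i => (T i).card)
    (t := Fintype.piFinset fun _ : ι => Finset.range (n + 1))]
  · refine Finset.sum_congr rfl fun j hj => ?_
    rw [Finset.sum_congr rfl (g := fun _ => chainCount St j)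
      fun T hT => by rw [← (Finset.mem_filter.1 hT).2], Finset.sum_const, smul_eq_mul, mul_comm]
    congr 1
    have : ({T ∈ ({T | ∀ i, (T i).card ≤ n} : Finset (∀ i, Finset (Fin (m i)))) |
        (fun i => (T i).card) = j}) =
        Fintype.piFinset fun i => Finset.powersetCard (j i) (Finset.univ : Finset (Fin (m i))) := by
      ext T
      simp only [Finset.mem_filter, Finset.mem_univ, true_and, Fintype.mem_piFinset,
        Finset.mem_powersetCard, Finset.subset_univ, funext_iff]
      refine ⟨fun h => h.2, fun h => ⟨fun i => ?_, h⟩⟩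
      rw [h i]
      exact Nat.lt_succ_iff.1 (Finset.mem_range.1 (Fintype.mem_piFinset.1 hj i))
    rw [this, Fintype.card_piFinset]
    exact Finset.prod_congr rfl fun i _ => by rw [Finset.card_powersetCard, Finset.card_fin]
  · intro T hT
    exact Fintype.mem_piFinset.2 fun i => Finset.mem_range.2
      (Nat.lt_succ_iff.2 ((Finset.mem_filter.1 hT).2 i))

end Chain

end Phi

section

/-- The polynomial with values the binomial coefficients of `X - d` and `j`. -/
def binomPoly (d j : ℕ) : Polynomial ℚ :=
  Polynomial.C ((j.factorial : ℚ)⁻¹) *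
    (descPochhammer ℚ j).comp (Polynomial.X - Polynomial.C (d : ℚ))

theorem eval_binomPoly {d a : ℕ} (h : d ≤ a) (j : ℕ) :
    (binomPoly d j).eval (a : ℚ) = ((a - d).choose j : ℚ) := by
  rw [binomPoly, Polynomial.eval_C_mul, Polynomial.eval_comp, Polynomial.eval_sub,
    Polynomial.eval_X, Polynomial.eval_C, ← Nat.cast_sub h, Nat.cast_choose_eq_descPochhammer_div,
    div_eq_inv_mul]

theorem natDegree_binomPoly (d j : ℕ) : (binomPoly d j).natDegree = j := by
  rw [binomPoly, Polynomial.natDegree_C_mul (inv_ne_zero (Nat.cast_ne_zero.2 j.factorial_ne_zero)),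
    Polynomial.natDegree_comp, descPochhammer_natDegree, Polynomial.natDegree_X_sub_C, mul_one]

theorem binomPoly_ne_zero (d j : ℕ) : binomPoly d j ≠ 0 := by
  rw [binomPoly]
  refine mul_ne_zero (Polynomial.C_ne_zero.2 (inv_ne_zero (Nat.cast_ne_zero.2 j.factorial_ne_zero)))
    (Polynomial.Monic.ne_zero ?_)
  exact (monic_descPochhammer ℚ j).comp (Polynomial.monic_X_sub_C _)
    (by rw [Polynomial.natDegree_X_sub_C]; exact one_ne_zero)

theorem totalDegree_aeval_X_le {σ R : Type*} [CommSemiring R] (p : Polynomial R) (i : σ) :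
    (Polynomial.aeval (MvPolynomial.X i : MvPolynomial σ R) p).totalDegree ≤ p.natDegree := by
  rw [Polynomial.aeval_eq_sum_range]
  refine MvPolynomial.totalDegree_finsetSum_le fun k hk => ?_
  refine (MvPolynomial.totalDegree_smul_le _ _).trans ((MvPolynomial.totalDegree_pow _ _).trans ?_)
  refine (Nat.mul_le_mul_left k (?_ : _ ≤ 1)).trans
    (by rw [mul_one]; exact Nat.lt_succ_iff.1 (Finset.mem_range.1 hk))
  cases subsingleton_or_nontrivial R
  · rw [Subsingleton.elim (MvPolynomial.X i : MvPolynomial σ R) 0, MvPolynomial.totalDegree_zero]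
    exact Nat.zero_le _
  · exact (MvPolynomial.totalDegree_X i).le

variable {ι : Type*} [Fintype ι] [DecidableEq ι]

/-- A linear combination of products of binomial coefficients. -/
def countPoly (n : ℕ) (τ : (ι → ℕ) → ℕ) (d : ι → ℕ) : MvPolynomial ι ℚ :=
  ∑ j ∈ Fintype.piFinset fun _ : ι => Finset.range (n + 1),
    MvPolynomial.C (τ j : ℚ) * ∏ i, Polynomial.aeval (MvPolynomial.X i) (binomPoly (d i) (j i))

theorem eval_countPoly {n : ℕ} {τ : (ι → ℕ) → ℕ} {d a : ι → ℕ} (h : ∀ i, d i ≤ a i) :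
    MvPolynomial.eval (fun i => (a i : ℚ)) (countPoly n τ d) =
      (∑ j ∈ Fintype.piFinset fun _ : ι => Finset.range (n + 1),
        τ j * ∏ i, (a i - d i).choose (j i) : ℕ) := by
  rw [countPoly, map_sum, Nat.cast_sum]
  refine Finset.sum_congr rfl fun j _ => ?_
  rw [map_mul, MvPolynomial.eval_C, map_prod, Nat.cast_mul, Nat.cast_prod]
  congr 1
  refine Finset.prod_congr rfl fun i _ => ?_
  rw [← eval_binomPoly (h i), ← MvPolynomial.coe_aeval_eq_eval, RingHom.coe_coe,
    ← Polynomial.aeval_algHom_apply, MvPolynomial.aeval_X, Polynomial.coe_aeval_eq_eval]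

theorem totalDegree_countPoly {n : ℕ} {τ : (ι → ℕ) → ℕ} (hτ : τ (fun _ => n) ≠ 0) (d : ι → ℕ) :
    (countPoly n τ d).totalDegree = Fintype.card ι * n := by
  have hJ : ∀ j ∈ Fintype.piFinset fun _ : ι => Finset.range (n + 1), ∀ i, j i ≤ n := fun j hj i =>
    Nat.lt_succ_iff.1 (Finset.mem_range.1 (Fintype.mem_piFinset.1 hj i))
  refine le_antisymm (MvPolynomial.totalDegree_finsetSum_le fun j hj => ?_) ?_
  · refine (MvPolynomial.totalDegree_mul _ _).trans ?_
    rw [MvPolynomial.totalDegree_C, zero_add]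
    refine (MvPolynomial.totalDegree_finsetProd _ _).trans ?_
    refine (Finset.sum_le_card_nsmul _ _ n fun i _ => ?_).trans
      (by rw [Finset.card_univ, smul_eq_mul])
    exact (totalDegree_aeval_X_le _ _).trans ((natDegree_binomPoly _ _).trans_le (hJ j hj i))
  · have h1 := MvPolynomial.aeval_natDegree_le (countPoly n τ d) le_rfl
      (fun _ => (Polynomial.X : Polynomial ℚ)) (n := 1) fun _ => Polynomial.natDegree_X_le
    rw [mul_one] at h1
    refine le_trans (Polynomial.le_natDegree_of_ne_zero ?_) h1
    have h2 : MvPolynomial.aeval (fun _ => (Polynomial.X : Polynomial ℚ)) (countPoly n τ d) =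
        ∑ j ∈ Fintype.piFinset fun _ : ι => Finset.range (n + 1),
          Polynomial.C (τ j : ℚ) * ∏ i, binomPoly (d i) (j i) := by
      rw [countPoly, map_sum]
      refine Finset.sum_congr rfl fun j _ => ?_
      rw [map_mul, map_prod, MvPolynomial.aeval_C]
      congr 1
      refine Finset.prod_congr rfl fun i _ => ?_
      rw [← Polynomial.aeval_algHom_apply, MvPolynomial.aeval_X, Polynomial.aeval_X_left_apply]
    have h3 : ∀ j ∈ Fintype.piFinset fun _ : ι => Finset.range (n + 1),
        (Polynomial.C (τ j : ℚ) * ∏ i, binomPoly (d i) (j i)).coeff (Fintype.card ι * n) =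
          τ j * ∏ i, (binomPoly (d i) (j i)).coeff n := fun j hj => by
      rw [Polynomial.coeff_C_mul, ← Finset.card_univ, Polynomial.coeff_prod_of_natDegree_le]
      exact fun i _ => (natDegree_binomPoly _ _).trans_le (hJ j hj i)
    rw [h2, Polynomial.finsetSum_coeff, Finset.sum_congr rfl h3,
      Finset.sum_eq_single_of_mem (fun _ => n)
        (Fintype.mem_piFinset.2 fun _ => Finset.mem_range.2 n.lt_succ_self)]
    · refine mul_ne_zero (Nat.cast_ne_zero.2 hτ) (Finset.prod_ne_zero_iff.2 fun i _ => ?_)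
      have := Polynomial.leadingCoeff_ne_zero.2 (binomPoly_ne_zero (d i) n)
      rwa [Polynomial.leadingCoeff, natDegree_binomPoly] at this
    · intro j hj hne
      obtain ⟨i, hi⟩ := Function.ne_iff.1 hne
      rw [Finset.prod_eq_zero (Finset.mem_univ i), mul_zero]
      exact Polynomial.coeff_eq_zero_of_natDegree_lt
        (by rw [natDegree_binomPoly]; exact lt_of_le_of_ne (hJ j hj i) hi)

end

section

universe w

theorem isMinNR_iff_bot_covBy {P : Type*} [PartialOrder P] [OrderBot P] {x : P} :
    IsMinNR x ↔ ⊥ ⋖ x := by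
  constructor
  · rintro ⟨h, h'⟩
    exact ⟨bot_lt_iff_ne_bot.2 h, fun y hy hyx => hyx.ne (h' y hy.ne' hyx.le)⟩
  · intro h
    exact ⟨h.1.ne', fun y hy hyx => (h.eq_or_eq bot_le hyx).resolve_left hy⟩

theorem Fan.reindex {D : Type*} [CommRing D] {ι κ : Type*} {q : PrimeSpectrum D}
    {pr : ι → PrimeSpectrum D} (F : Fan q pr) (σ : κ ≃ ι) : Fan q (pr ∘ σ) where
  lt i := F.lt _
  cover M hM := by
    obtain ⟨i, hi⟩ := F.cover M hM
    exact ⟨σ.symm i, by simpa using hi⟩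
  sep i j hij := F.sep _ _ (σ.injective.ne hij)

section

variable {D : Type*} [CommRing D] [IsDomain D] {P : Type*} [PartialOrder P] [OrderBot P]
  (e : ↥(hiSpec D) ≃o P)

theorem vtx_bot : (vtx e ⊥).asIdeal = ⊥ := by
  obtain ⟨y, hy⟩ := exists_vtx (p := ⟨⊥, Ideal.isPrime_bot⟩) e ⟨Ideal.isPrime_bot, Or.inl rfl⟩
  refine le_bot_iff.1 (le_of_le_of_eq ((vtx_le_vtx e).2 (bot_le : ⊥ ≤ y)) ?_)
  rw [hy]

include e in
theorem isMax_bot_iff (K : Type*) [Field K] [Algebra D K] [IsFractionRing D K] :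
    IsMax (⊥ : P) ↔ ∀ x : K, ∃ a, algebraMap D K a = x := by
  rw [← isMaximal_vtx e, vtx_bot, ← Ring.isField_iff_maximal_bot]
  constructor
  · exact fun h => (IsFractionRing.surjective_iff_isField (R := D) (K := K)).2 h
  · exact fun h => (IsFractionRing.surjective_iff_isField (R := D) (K := K)).1 h

end

section

variable {D : Type*} [CommRing D] [IsDomain D] {P : Type w} [PartialOrder P] [Fintype P] [OrderBot P]
  {K : Type*} [Field K] [Algebra D K] [IsFractionRing D K]

open Classical in
/-- The number of (semi)star operations as the number of marked elements of the model. -/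
theorem card_semistar_eq (hP : IsPrufer D K) (hs : IsSemilocal D) (e : ↥(hiSpec D) ≃o P)
    (hmax : ¬ IsMax (⊥ : P)) {N : {x : P // IsMinNR x} → Type w} [∀ x, PartialOrder (N x)]
    [∀ x, Finite (N x)] (St : ∀ x, Set (N x)) (d m : {x : P // IsMinNR x} → ℕ)
    (hM : ∀ x, Models hP e (St x) (d x) (isMinNR_iff_bot_covBy.1 x.2).1 (m x)) :
    Nat.card {s : Semistar D K // s.toFun 1 = 1} =
      Nat.card {g : Phi fun x => N x ⊕ₗ Fin (m x - d x) //
        g.Star (Phi.inlSet St fun x => Fin (m x - d x))} := by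
  choose hd φ hφ using hM
  have hq := vtx_bot e
  have hD := fun h => hmax ((isMax_bot_iff e K).2 h)
  have h1 : (1 : Submodule D K) ≠ ⊥ := one_ne_zero
  have hB : ∀ y, y ∈ (subIso hP hq ⟨1, h1⟩).1 ↔ y ∈ ringAt hP (vtx e ⊥) := fun y => by
    rw [mem_subIso, mem_ringAt_of_eq_bot hq, Submodule.mem_one]
  let σ : {x : P // IsMinNR x} ≃ {z : P // ⊥ ⋖ z} :=
    Equiv.subtypeEquivRight fun _ => isMinNR_iff_bot_covBy
  let F := (fan_vtx e K hP hmax).reindex σ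
  rw [card_semistar hP hD hq hB]
  refine Nat.card_congr (((F.fanIso (hP := hP) hs).trans (Phi.map φ)).toEquiv.subtypeEquiv fun c => ?_)
  refine (F.fanIso_star hs hB c).trans ?_
  exact Phi.map_star φ hφ _

end

end

/-- Let `𝒫` be a finite rooted homeomorphically irreducible tree
with root `0 = ⊥`, maximal elements `m₁, …, m_t`, and let `p₁, …, p_k` be the
minimal elements of `𝒫 \ {0}`. Fixing the values of `ω` outside `{p₁, …, p_k}` and
the values `ε ∈ {1, 2}` at the maximal elements, the number of (semi)star
operations of a semilocal finite-dimensional Prüfer domain `D` with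
`hiSpec(D) ≅ 𝒫`, as a function of `ω(p₁), …, ω(p_k)`, is a polynomial with rational
coefficients of total degree `k·(2^(k-1) - 1)`. -/
theorem statement18
    (P : Type*) [PartialOrder P] [Fintype P] [OrderBot P]
    (htree : ∀ x : P, IsChain (· ≤ ·) {y : P | y ≤ x})
    (hhi : ∀ x : P, x = ⊥ ∨ IsMax x ∨
      ∃ S : Set P, (S.Pairwise fun a b => ¬a ≤ b ∧ ¬b ≤ a) ∧ x ∉ S ∧ IsGLB S x)
    (b : P → ℕ) (hb : ∀ x, 0 < b x)
    (c : P → ℕ) (hc : ∀ x : P, IsMax x → c x = 1 ∨ c x = 2) :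
    ∃ π : MvPolynomial {x : P // IsMinNR x} ℚ,
      π.totalDegree =
        Nat.card {x : P // IsMinNR x} *
          (2 ^ (Nat.card {x : P // IsMinNR x} - 1) - 1) ∧
      ∀ (a : {x : P // IsMinNR x} → ℕ), (∀ i, 0 < a i) →
        ∀ (D : Type u) (K : Type v) [CommRing D] [IsDomain D] [Field K]
          [Algebra D K] [IsFractionRing D K],
          IsPrufer D K → IsSemilocal D → ringKrullDim D < ⊤ →
          ∀ e : ↥(hiSpec D) ≃o P,
            (∀ (Pp Qq : ↥(hiSpec D)), DirectlyBelow D Qq.1 Pp.1 →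
              ∀ h : IsMinNR (e Pp),
                omegaAt D Pp.1 Qq.1 (mem_hiSpec_prime Pp.2) = a ⟨e Pp, h⟩) →
            (∀ (Pp Qq : ↥(hiSpec D)), DirectlyBelow D Qq.1 Pp.1 →
              ¬IsMinNR (e Pp) →
                omegaAt D Pp.1 Qq.1 (mem_hiSpec_prime Pp.2) = b (e Pp)) →
            (∀ Pp : ↥(hiSpec D), Pp.1.IsMaximal → epsilonOf D Pp.1 = c (e Pp)) →
            (Nat.card {s : Semistar D K // s.toFun 1 = 1} : ℚ) =
              MvPolynomial.eval (fun i => (a i : ℚ)) π := by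
  classical
  by_cases hmax : IsMax (⊥ : P)
  · have : IsEmpty {x : P // IsMinNR x} := ⟨fun x => x.2.1 (hmax.eq_of_le bot_le).symm⟩
    refine ⟨MvPolynomial.C 2, by simp, ?_⟩
    intro a _ D K _ _ _ _ _ _ _ _ e _ _ _
    rw [card_semistar_field ((isMax_bot_iff e K).1 hmax), MvPolynomial.eval_C, Nat.cast_ofNat]
  · have hc' : ∀ x, IsMax x → 0 < c x := fun x hx => by
      rcases hc x hx with h | h <;> omega
    choose N iN fN St d hne hM using
      fun x : {x : P // IsMinNR x} => exists_model.{u, v, _} b c hb hc' x.1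
    refine ⟨countPoly (2 ^ (Nat.card {x : P // IsMinNR x} - 1) - 1) (Phi.chainCount St) d, ?_, ?_⟩
    · rw [totalDegree_countPoly (Phi.chainCount_pos hne).ne', Nat.card_eq_fintype_card]
    · intro a ha D K _ _ _ _ _ hP hs _ e hωa hωb hε
      have hω : ∀ z x (h : z ⋖ x) (hx : IsMinNR x),
          omegaAt D (vtx e x).asIdeal (vtx e z).asIdeal (vtx e x).2 = a ⟨x, hx⟩ := by
        intro z x h hx
        have h1 := hωa (e.symm x) (e.symm z) ((directlyBelow_vtx e).2 h)
          (by rwa [OrderIso.apply_symm_apply])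
        refine Eq.trans h1 (congrArg a (Subtype.ext (e.apply_symm_apply x)))
      have hMod : ∀ x : {x : P // IsMinNR x},
          Models hP e (St x) (d x) (isMinNR_iff_bot_covBy.1 x.2).1 (a x) := fun x => by
        have h1 := hω ⊥ x.1 (isMinNR_iff_bot_covBy.1 x.2) x.2
        have h2 := hM x D K hP hs e ?_ ?_ ⊥ (isMinNR_iff_bot_covBy.1 x.2) (by rw [h1]; exact ha x)
        · rwa [h1] at h2
        · intro z y hzy hxy
          have hy : ¬ IsMinNR y := fun h => hxy.ne (h.2 _ x.2.1 hxy.le)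
          have h3 := hωb (e.symm y) (e.symm z) ((directlyBelow_vtx e).2 hzy)
            (by rwa [OrderIso.apply_symm_apply])
          rwa [OrderIso.apply_symm_apply] at h3
        · intro y hy
          have h3 := hε (e.symm y) ((isMaximal_vtx e).2 hy)
          rwa [OrderIso.apply_symm_apply] at h3
      rw [card_semistar_eq hP hs e hmax St d a hMod, Phi.card_star_eq_sum_choose,
        eval_countPoly fun x => (hMod x).1]

end Paper
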